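/- Let u_n be a blowing-up sequence as in the hypotheses of the main theorem, with blow-up point p ∈ ∂𝔻. Let H be the harmonic extension of h to 𝔻 (ΔH = 0 in 𝔻, H = h on ∂𝔻) and Φ(z) := H(z) + √(H(z)² + K(z)). Then 2 h_τ(p) + K_τ(p)/Φ(p) = 0, where h_τ and K_τ denote the tangential derivatives along ∂𝔻 in the direction τ; equivalently, Φ_τ(p) = 0. -/

import Mathlib

open MeasureTheory Filter

noncomputable section

/-- The open unit disk in ℝ² ≅ ℂ. -/
def unitDisk : Set ℂ := Metric.ball 0 1

/-- The closed unit disk. -/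
def unitClosedDisk : Set ℂ := Metric.closedBall 0 1

/-- The unit circle ∂𝔻. -/
def unitCircle : Set ℂ := Metric.sphere 0 1

/-- Arc-length measure: the 1-dimensional Hausdorff measure on ℂ. -/
def arcMeasure : Measure ℂ := μH[1]

/-- Directional derivative of `u` at `z` in direction `v`. -/
def dirDeriv (v : ℂ) (u : ℂ → ℝ) (z : ℂ) : ℝ := fderiv ℝ u z v

/-- Euclidean gradient of `u` at `z`, realized as a complex number. -/
def grad (u : ℂ → ℝ) (z : ℂ) : ℂ := ⟨dirDeriv 1 u z, dirDeriv Complex.I u z⟩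

/-- Euclidean Laplacian. -/
def lap (u : ℂ → ℝ) (z : ℂ) : ℝ :=
  dirDeriv 1 (dirDeriv 1 u) z + dirDeriv Complex.I (dirDeriv Complex.I u) z

/-- Outward normal derivative on the unit circle: ν(z) = z. -/
def normalDeriv (u : ℂ → ℝ) (z : ℂ) : ℝ := fderiv ℝ u z z

/-- Tangential derivative on the unit circle: τ(z) = iz. -/
def tangentialDeriv (u : ℂ → ℝ) (z : ℂ) : ℝ := fderiv ℝ u z (Complex.I * z)

/-- Euclidean dot product on ℂ ≅ ℝ². -/
def dot (z w : ℂ) : ℝ := z.re * w.re + z.im * w.im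

/-- `u` solves `-Δu = 2K e^u` in 𝔻, `∂u/∂ν + 2 = 2h e^{u/2}` on ∂𝔻. -/
def SolvesLiouville (K h u : ℂ → ℝ) : Prop :=
  (∀ z ∈ unitDisk, -lap u z = 2 * K z * Real.exp (u z)) ∧
  (∀ z ∈ unitCircle, normalDeriv u z + 2 = 2 * h z * Real.exp (u z / 2))

/-- Convergence in C² on a set: uniform convergence of the derivatives up to order 2. -/
def TendstoC2On (F : ℕ → ℂ → ℝ) (G : ℂ → ℝ) (s : Set ℂ) : Prop :=
  ∀ i : ℕ, i ≤ 2 →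
    TendstoUniformlyOn (fun n => iteratedFDeriv ℝ i (F n)) (iteratedFDeriv ℝ i G)
      Filter.atTop s

/-- `sup u_n → +∞` on the closed disk. -/
def BlowsUp (u : ℕ → ℂ → ℝ) : Prop :=
  ∀ M : ℝ, ∀ᶠ n in Filter.atTop, ∃ z ∈ unitClosedDisk, M < u n z

/-- `u_n → -∞` locally uniformly on `s`. -/
def TendstoLocallyUniformlyBotOn (u : ℕ → ℂ → ℝ) (s : Set ℂ) : Prop :=
  ∀ (M : ℝ) (S : Set ℂ), IsCompact S → S ⊆ s →
    ∀ᶠ n in Filter.atTop, ∀ z ∈ S, u n z < M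

/-- Bounded total mass: area plus boundary length. -/
def MassBound (u : ℕ → ℂ → ℝ) (C : ℝ) : Prop :=
  ∀ n, (∫ z in unitDisk, Real.exp (u n z)) +
       (∫ z in unitCircle, Real.exp (u n z / 2) ∂arcMeasure) ≤ C

/-- The point `p * exp (iθ)`. -/
def circ (p : ℂ) (θ : ℝ) : ℂ := p * Complex.exp (θ * Complex.I)

/-- `f` has (total) differential at `z` with partial derivatives `a` and `b`. -/
def HasPD (f : ℂ → ℝ) (a b : ℝ) (z : ℂ) : Prop :=
  HasFDerivAt f (a • Complex.reCLM + b • Complex.imCLM) z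

namespace HasPD
variable {f g : ℂ → ℝ} {a b c d : ℝ} {z : ℂ}

theorem add (hf : HasPD f a b z) (hg : HasPD g c d z) :
    HasPD (fun w => f w + g w) (a + c) (b + d) z := by
  unfold HasPD at *
  convert! HasFDerivAt.add hf hg using 1
  ext; simp; ring

theorem sub (hf : HasPD f a b z) (hg : HasPD g c d z) :
    HasPD (fun w => f w - g w) (a - c) (b - d) z := by
  unfold HasPD at *
  convert! HasFDerivAt.sub hf hg using 1
  ext; simp; ring

theorem mul (hf : HasPD f a b z) (hg : HasPD g c d z) :
    HasPD (fun w => f w * g w) (a * g z + f z * c) (b * g z + f z * d) z := by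
  unfold HasPD at *
  convert! HasFDerivAt.mul hf hg using 1
  ext; simp; ring

theorem const_mul (k : ℝ) (hf : HasPD f a b z) :
    HasPD (fun w => k * f w) (k * a) (k * b) z := by
  unfold HasPD at *
  convert! HasFDerivAt.const_mul hf k using 1
  ext; simp; ring

theorem comp {φ : ℝ → ℝ} {k : ℝ} (hf : HasPD f a b z) (hφ : HasDerivAt φ k (f z)) :
    HasPD (fun w => φ (f w)) (k * a) (k * b) z := by
  unfold HasPD at *
  convert! hφ.comp_hasFDerivAt z hf using 1
  ext; simp; ring

theorem exp (hf : HasPD f a b z) :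
    HasPD (fun w => Real.exp (f w)) (Real.exp (f z) * a) (Real.exp (f z) * b) z :=
  hf.comp (Real.hasDerivAt_exp _)

theorem re {F : ℂ → ℂ} {F' : ℂ} (hF : HasDerivAt F F' z) :
    HasPD (fun w => (F w).re) F'.re (-F'.im) z := by
  unfold HasPD
  have h := Complex.reCLM.hasFDerivAt.comp z hF.complexToReal_fderiv
  convert! h using 1
  ext; simp; ring

theorem im {F : ℂ → ℂ} {F' : ℂ} (hF : HasDerivAt F F' z) :
    HasPD (fun w => (F w).im) F'.im F'.re z := by
  unfold HasPD
  have h := Complex.imCLM.hasFDerivAt.comp z hF.complexToReal_fderiv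
  convert! h using 1
  ext; simp; ring

theorem of_differentiableAt (hf : DifferentiableAt ℝ f z) :
    HasPD f (fderiv ℝ f z 1) (fderiv ℝ f z Complex.I) z := by
  unfold HasPD
  refine hf.hasFDerivAt.congr_fderiv ?_
  ext x
  have hx : x = x.re • (1 : ℂ) + x.im • Complex.I := by
    apply Complex.ext <;> simp
  conv_lhs => rw [hx, map_add, map_smul, map_smul]
  simp [mul_comm]

theorem continuousAt (hf : HasPD f a b z) : ContinuousAt f z := HasFDerivAt.continuousAt hf

theorem comp_hasDerivAt {γ : ℝ → ℂ} {γ' : ℂ} {t : ℝ} (hf : HasPD f a b (γ t))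
    (hγ : HasDerivAt γ γ' t) : HasDerivAt (fun s => f (γ s)) (a * γ'.re + b * γ'.im) t := by
  unfold HasPD at hf
  convert! hf.comp_hasDerivAt t hγ using 1

end HasPD

theorem hasDerivAt_circ (p : ℂ) (θ : ℝ) :
    HasDerivAt (circ p) (Complex.I * circ p θ) θ := by
  unfold circ
  have h : HasDerivAt (fun t : ℝ => ((t : ℂ) * Complex.I)) (1 * Complex.I) θ :=
    (Complex.ofRealCLM.hasDerivAt (x := θ)).mul_const _
  convert! (h.cexp).const_mul p using 1
  ring

theorem continuous_circ (p : ℂ) : Continuous (circ p) :=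
  continuous_iff_continuousAt.2 fun θ => (hasDerivAt_circ p θ).continuousAt

theorem circ_periodic (p : ℂ) : Function.Periodic (circ p) (2 * Real.pi) := by
  intro θ
  simp only [circ]
  push_cast
  rw [add_mul, Complex.exp_add, Complex.exp_two_pi_mul_I, mul_one]

theorem norm_circ {p : ℂ} (hp : ‖p‖ = 1) (θ : ℝ) : ‖circ p θ‖ = 1 := by
  simp [circ, hp, Complex.norm_exp_ofReal_mul_I]

theorem circ_mem {p : ℂ} (hp : ‖p‖ = 1) (θ : ℝ) : circ p θ ∈ unitCircle := by
  simp [unitCircle, norm_circ hp]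

theorem circ_mem_closed {p : ℂ} (hp : ‖p‖ = 1) (θ : ℝ) : circ p θ ∈ unitClosedDisk := by
  simp [unitClosedDisk, norm_circ hp]

theorem circ_surj {p z : ℂ} (hp : ‖p‖ = 1) (hz : ‖z‖ = 1) :
    ∃ θ ∈ Set.Ioc (-Real.pi) Real.pi, circ p θ = z := by
  have hp0 : p ≠ 0 := by rw [← norm_ne_zero_iff, hp]; norm_num
  refine ⟨Complex.arg (z / p), Complex.arg_mem_Ioc _, ?_⟩
  have h := Complex.norm_mul_exp_arg_mul_I (z / p)
  rw [norm_div, hz, hp] at h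
  simp only [div_one, Complex.ofReal_one, one_mul] at h
  rw [circ, h]
  field_simp

theorem integral_circ_eq {E : Type*} [NormedAddCommGroup E] [NormedSpace ℝ E] {p q : ℂ}
    (hp : ‖p‖ = 1) (hq : ‖q‖ = 1) (f : ℂ → E) :
    ∫ θ in (-Real.pi)..Real.pi, f (circ p θ) = ∫ θ in (-Real.pi)..Real.pi, f (circ q θ) := by
  obtain ⟨t, -, ht⟩ := circ_surj hp hq
  have h1 : ∀ θ, circ q θ = circ p (t + θ) := by
    intro θ
    rw [← ht]; simp only [circ]; push_cast
    rw [add_mul, Complex.exp_add]; ring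
  simp_rw [h1]
  rw [intervalIntegral.integral_comp_add_left (fun θ => f (circ p θ)) t]
  have hper : Function.Periodic (fun θ => f (circ p θ)) (2 * Real.pi) := by
    intro θ; simp only [circ_periodic p θ]
  have := hper.intervalIntegral_add_eq (-Real.pi) (t + -Real.pi)
  convert this using 2 <;> ring

theorem integral_disk_polar {f : ℂ → ℝ} (hf : ContinuousOn f unitClosedDisk) :
    ∫ z in unitDisk, f z =
      ∫ r in (0 : ℝ)..1, ∫ θ in (-Real.pi)..Real.pi, r * f (r * circ 1 θ) := by
  have hc : ∀ q : ℝ × ℝ, Complex.polarCoord.symm q = q.1 * circ 1 q.2 := by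
    intro q
    rw [Complex.polarCoord_symm_apply, circ, one_mul, Complex.exp_mul_I]; push_cast; rfl
  have hm : MeasurableSet unitDisk := Metric.isOpen_ball.measurableSet
  have key : ∀ q ∈ polarCoord.target,
      q.1 • unitDisk.indicator f (Complex.polarCoord.symm q) =
      (Set.Ioo (0 : ℝ) 1 ×ˢ Set.Ioo (-Real.pi) Real.pi).indicator
        (fun q : ℝ × ℝ => q.1 * f (q.1 * circ 1 q.2)) q := by
    intro q hq
    rw [hc]
    obtain ⟨hq1, hq2⟩ := hq
    have hq1' : 0 < q.1 := hq1
    have hnorm : ‖(q.1 : ℂ) * circ 1 q.2‖ = q.1 := by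
      rw [norm_mul, norm_circ (by simp), mul_one, Complex.norm_real, Real.norm_of_nonneg hq1'.le]
    by_cases h : q.1 < 1
    · rw [Set.indicator_of_mem, Set.indicator_of_mem]
      · simp
      · exact ⟨⟨hq1, h⟩, hq2⟩
      · simp only [unitDisk, Metric.mem_ball, dist_zero_right, hnorm]; exact h
    · rw [Set.indicator_of_notMem, Set.indicator_of_notMem]
      · simp
      · rintro ⟨⟨_, h2⟩, _⟩; exact h h2
      · simp only [unitDisk, Metric.mem_ball, dist_zero_right, hnorm]; exact h
  rw [← integral_indicator hm, ← Complex.integral_comp_polarCoord_symm,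
    setIntegral_congr_fun polarCoord.open_target.measurableSet key,
    setIntegral_indicator (measurableSet_Ioo.prod measurableSet_Ioo)]
  have hsub : polarCoord.target ∩ (Set.Ioo (0 : ℝ) 1 ×ˢ Set.Ioo (-Real.pi) Real.pi) =
      (Set.Ioo (0 : ℝ) 1 ×ˢ Set.Ioo (-Real.pi) Real.pi) := by
    apply Set.inter_eq_right.2
    rintro q ⟨h1, h2⟩
    exact ⟨h1.1, h2⟩
  have hcont : ContinuousOn (fun q : ℝ × ℝ => q.1 * f (q.1 * circ 1 q.2))
      (Set.Icc (0 : ℝ) 1 ×ˢ Set.Icc (-Real.pi) Real.pi) := by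
    apply ContinuousOn.mul continuous_fst.continuousOn
    apply hf.comp
    · exact (Continuous.mul (Complex.continuous_ofReal.comp continuous_fst)
        ((continuous_circ 1).comp continuous_snd)).continuousOn
    · rintro q ⟨⟨h1, h2⟩, _⟩
      simp only [unitClosedDisk, Metric.mem_closedBall, dist_zero_right]
      rw [norm_mul, norm_circ (by simp), mul_one, Complex.norm_real, Real.norm_of_nonneg h1]
      exact h2
  have h_int : IntegrableOn (fun q : ℝ × ℝ => q.1 * f (q.1 * circ 1 q.2))
      (Set.Ioo (0 : ℝ) 1 ×ˢ Set.Ioo (-Real.pi) Real.pi) :=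
    (hcont.integrableOn_compact (isCompact_Icc.prod isCompact_Icc)).mono_set
      (Set.prod_mono Set.Ioo_subset_Icc_self Set.Ioo_subset_Icc_self)
  rw [hsub, Measure.volume_eq_prod, setIntegral_prod _ h_int,
    intervalIntegral.integral_of_le zero_le_one, integral_Ioc_eq_integral_Ioo]
  congr 1
  ext r
  rw [intervalIntegral.integral_of_le (by linarith [Real.pi_pos]), integral_Ioc_eq_integral_Ioo]

theorem integral_div_disk {A B ax ay bx bY d : ℂ → ℝ} {p : ℂ} (hp : ‖p‖ = 1)
    (hA : ∀ z ∈ unitClosedDisk, HasPD A (ax z) (ay z) z)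
    (hB : ∀ z ∈ unitClosedDisk, HasPD B (bx z) (bY z) z)
    (hd : ∀ z ∈ unitClosedDisk, ax z + bY z = d z)
    (hdc : ContinuousOn d unitClosedDisk) :
    ∫ z in unitDisk, d z = ∫ θ in (-Real.pi)..Real.pi,
      (A (circ p θ) * (circ p θ).re + B (circ p θ) * (circ p θ).im) := by
  rw [integral_circ_eq hp (q := 1) (by simp) (fun z => A z * z.re + B z * z.im),
    integral_disk_polar hdc]
  set f : ℝ × ℝ → ℝ := fun q => q.1 * (A (q.1 * circ 1 q.2) * (circ 1 q.2).re +
    B (q.1 * circ 1 q.2) * (circ 1 q.2).im) with hf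
  set g : ℝ × ℝ → ℝ := fun q => -A (q.1 * circ 1 q.2) * (circ 1 q.2).im +
    B (q.1 * circ 1 q.2) * (circ 1 q.2).re with hg
  have hpt : ∀ q ∈ Set.Icc (0 : ℝ) 1 ×ˢ Set.Icc (-Real.pi) Real.pi,
      (q.1 * circ 1 q.2 : ℂ) ∈ unitClosedDisk := by
    rintro q ⟨⟨h1, h2⟩, _⟩
    simp only [unitClosedDisk, Metric.mem_closedBall, dist_zero_right]
    rw [norm_mul, norm_circ (by simp), mul_one, Complex.norm_real, Real.norm_of_nonneg h1]
    exact h2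
  set e : ℝ × ℝ → ℂ := fun q => circ 1 q.2 with he
  let zm : ℝ × ℝ → ℂ := fun q => q.1 * circ 1 q.2
  have hed : ∀ q, HasFDerivAt e ((ContinuousLinearMap.snd ℝ ℝ ℝ).smulRight
      (Complex.I * circ 1 q.2)) q := by
    intro q
    have := (hasDerivAt_circ 1 q.2).hasFDerivAt.comp q (hasFDerivAt_snd (𝕜 := ℝ) (p := q))
    convert! this using 1
  have hzd : ∀ q, HasFDerivAt zm ((ContinuousLinearMap.fst ℝ ℝ ℝ).smulRight (circ 1 q.2) +
      (ContinuousLinearMap.snd ℝ ℝ ℝ).smulRight (q.1 * (Complex.I * circ 1 q.2))) q := by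
    intro q
    have h1 := (Complex.ofRealCLM.hasFDerivAt.comp q (hasFDerivAt_fst (𝕜 := ℝ) (p := q))).mul
      (hed q)
    convert! h1 using 1
    ext <;> simp [he]
  have hre : ∀ q, HasFDerivAt (fun q => (e q).re) (Complex.reCLM.comp
      ((ContinuousLinearMap.snd ℝ ℝ ℝ).smulRight (Complex.I * circ 1 q.2))) q :=
    fun q => Complex.reCLM.hasFDerivAt.comp q (hed q)
  have him : ∀ q, HasFDerivAt (fun q => (e q).im) (Complex.imCLM.comp
      ((ContinuousLinearMap.snd ℝ ℝ ℝ).smulRight (Complex.I * circ 1 q.2))) q :=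
    fun q => Complex.imCLM.hasFDerivAt.comp q (hed q)
  have hAd : ∀ q ∈ Set.Icc (0 : ℝ) 1 ×ˢ Set.Icc (-Real.pi) Real.pi,
      HasFDerivAt (fun q => A (zm q)) _ q := fun q hq =>
    HasFDerivAt.comp q (hA (zm q) (hpt q hq)) (hzd q)
  have hBd : ∀ q ∈ Set.Icc (0 : ℝ) 1 ×ˢ Set.Icc (-Real.pi) Real.pi,
      HasFDerivAt (fun q => B (zm q)) _ q := fun q hq =>
    HasFDerivAt.comp q (hB (zm q) (hpt q hq)) (hzd q)
  have hfd := fun q hq => (hasFDerivAt_fst (𝕜 := ℝ) (p := q)).mul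
    (((hAd q hq).mul (hre q)).add ((hBd q hq).mul (him q)))
  have hgd := fun q hq => ((hAd q hq).neg.mul (him q)).add ((hBd q hq).mul (hre q))
  have hpi : (-Real.pi) ≤ Real.pi := by linarith [Real.pi_pos]
  have hdiv : ∀ q ∈ Set.Icc (0 : ℝ) 1 ×ˢ Set.Icc (-Real.pi) Real.pi,
      fderiv ℝ f q (1, 0) + fderiv ℝ g q (0, 1) = q.1 * d (q.1 * circ 1 q.2) := by
    intro q hq
    have h1 : fderiv ℝ f q = _ := (hfd q hq).fderiv
    have h2 : fderiv ℝ g q = _ := (hgd q hq).fderiv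
    rw [h1, h2, ← hd _ (hpt q hq)]
    have hcs : (circ 1 q.2).re ^ 2 + (circ 1 q.2).im ^ 2 = 1 := by
      simp only [circ, one_mul, Complex.exp_ofReal_mul_I_re, Complex.exp_ofReal_mul_I_im]
      exact Real.cos_sq_add_sin_sq q.2
    simp [he, zm]
    linear_combination (q.1 * ax (q.1 * circ 1 q.2) + q.1 * bY (q.1 * circ 1 q.2)) * hcs
  have hinterior : ∀ x ∈ Set.Ioo (min (0 : ℝ) 1) (max 0 1) ×ˢ
      Set.Ioo (min (-Real.pi) Real.pi) (max (-Real.pi) Real.pi) \ (∅ : Set (ℝ × ℝ)),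
      x ∈ Set.Icc (0 : ℝ) 1 ×ˢ Set.Icc (-Real.pi) Real.pi := by
    rintro x ⟨⟨h1, h2⟩, _⟩
    rw [min_eq_left zero_le_one, max_eq_right zero_le_one] at h1
    rw [min_eq_left hpi, max_eq_right hpi] at h2
    exact ⟨Set.Ioo_subset_Icc_self h1, Set.Ioo_subset_Icc_self h2⟩
  have main := integral2_divergence_prod_of_hasFDerivAt_off_countable f g (fderiv ℝ f)
    (fderiv ℝ g) 0 (-Real.pi) 1 Real.pi ∅ Set.countable_empty
    (by
      rw [Set.uIcc_of_le zero_le_one, Set.uIcc_of_le hpi]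
      exact fun q hq => (hfd q hq).continuousAt.continuousWithinAt)
    (by
      rw [Set.uIcc_of_le zero_le_one, Set.uIcc_of_le hpi]
      exact fun q hq => (hgd q hq).continuousAt.continuousWithinAt)
    (fun x hx => (hfd x (hinterior x hx)).differentiableAt.hasFDerivAt)
    (fun x hx => (hgd x (hinterior x hx)).differentiableAt.hasFDerivAt)
    (by
      rw [Set.uIcc_of_le zero_le_one, Set.uIcc_of_le hpi]
      have hc2 : ContinuousOn (fun q : ℝ × ℝ => q.1 * d (q.1 * circ 1 q.2))
          (Set.Icc (0 : ℝ) 1 ×ˢ Set.Icc (-Real.pi) Real.pi) := by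
        apply ContinuousOn.mul continuous_fst.continuousOn
        apply hdc.comp _ hpt
        exact (Continuous.mul (Complex.continuous_ofReal.comp continuous_fst)
          ((continuous_circ 1).comp continuous_snd)).continuousOn
      exact (hc2.integrableOn_compact (isCompact_Icc.prod isCompact_Icc)).congr_fun
        (fun q hq => (hdiv q hq).symm) (measurableSet_Icc.prod measurableSet_Icc))
  have hper : ∀ x : ℝ, g (x, Real.pi) = g (x, -Real.pi) := by
    intro x
    have := circ_periodic 1 (-Real.pi)
    rw [show -Real.pi + 2 * Real.pi = Real.pi by ring] at this
    simp only [hg, this]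
  simp only [hper, sub_self, zero_add] at main
  have hf0 : ∀ y, f (0, y) = 0 := by intro y; simp [hf]
  have hf1 : ∀ y, f (1, y) = A (circ 1 y) * (circ 1 y).re + B (circ 1 y) * (circ 1 y).im := by
    intro y; simp [hf]
  simp only [hf0, hf1, intervalIntegral.integral_zero, sub_zero] at main
  rw [← main]
  apply intervalIntegral.integral_congr
  intro r hr
  rw [Set.uIcc_of_le zero_le_one] at hr
  apply intervalIntegral.integral_congr
  intro θ hθ
  rw [Set.uIcc_of_le hpi] at hθ
  exact (hdiv (r, θ) ⟨hr, hθ⟩).symm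

section Regularity
variable {u : ℂ → ℝ}

theorem dirDeriv_contDiff {n m : WithTop ℕ∞} (hu : ContDiff ℝ n u) (hmn : m + 1 ≤ n) (v : ℂ) :
    ContDiff ℝ m (dirDeriv v u) :=
  (hu.fderiv_right hmn).clm_apply contDiff_const

theorem continuous_dirDeriv (hu : ContDiff ℝ 1 u) (v : ℂ) : Continuous (dirDeriv v u) :=
  (dirDeriv_contDiff (m := 0) hu (by norm_num) v).continuous

theorem fderiv_eq_dirDeriv (u : ℂ → ℝ) (z x : ℂ) :
    fderiv ℝ u z x = dirDeriv 1 u z * x.re + dirDeriv Complex.I u z * x.im := by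
  have hx : x = x.re • (1 : ℂ) + x.im • Complex.I := by
    apply Complex.ext <;> simp
  conv_lhs => rw [hx, map_add, map_smul, map_smul]
  simp [dirDeriv, mul_comm]

theorem normalDeriv_eq (u : ℂ → ℝ) (z : ℂ) :
    normalDeriv u z = dirDeriv 1 u z * z.re + dirDeriv Complex.I u z * z.im :=
  fderiv_eq_dirDeriv u z z

theorem tangentialDeriv_eq (u : ℂ → ℝ) (z : ℂ) :
    tangentialDeriv u z = -(dirDeriv 1 u z * z.im) + dirDeriv Complex.I u z * z.re := by
  rw [tangentialDeriv, fderiv_eq_dirDeriv]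
  simp

theorem continuous_tangentialDeriv (hu : ContDiff ℝ 1 u) : Continuous (tangentialDeriv u) := by
  have h1 := continuous_dirDeriv hu 1
  have h2 := continuous_dirDeriv hu Complex.I
  rw [funext (tangentialDeriv_eq u)]
  exact ((h1.mul Complex.continuous_im).neg).add (h2.mul Complex.continuous_re)

theorem continuous_normalDeriv (hu : ContDiff ℝ 1 u) : Continuous (normalDeriv u) := by
  have h1 := continuous_dirDeriv hu 1
  have h2 := continuous_dirDeriv hu Complex.I
  rw [funext (normalDeriv_eq u)]
  exact (h1.mul Complex.continuous_re).add (h2.mul Complex.continuous_im)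

theorem hasPD_self (hu : ContDiff ℝ 1 u) (z : ℂ) :
    HasPD u (dirDeriv 1 u z) (dirDeriv Complex.I u z) z :=
  HasPD.of_differentiableAt (hu.differentiable one_ne_zero z)

theorem hasPD_dirDeriv (hu : ContDiff ℝ 2 u) (v z : ℂ) :
    HasPD (dirDeriv v u) (dirDeriv 1 (dirDeriv v u) z) (dirDeriv Complex.I (dirDeriv v u) z) z :=
  hasPD_self (dirDeriv_contDiff hu (by norm_num) v) z

theorem dirDeriv_comm (hu : ContDiff ℝ 2 u) (v w z : ℂ) :
    dirDeriv v (dirDeriv w u) z = dirDeriv w (dirDeriv v u) z := by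
  have hs : IsSymmSndFDerivAt ℝ u z := by
    apply hu.contDiffAt.isSymmSndFDerivAt
    simp
  have hd : DifferentiableAt ℝ (fderiv ℝ u) z :=
    (hu.fderiv_right (m := 1) (by norm_num)).differentiable one_ne_zero z
  have key : ∀ a b : ℂ, dirDeriv a (dirDeriv b u) z = fderiv ℝ (fderiv ℝ u) z a b := by
    intro a b
    have h1 : HasFDerivAt (dirDeriv b u) _ z :=
      hd.hasFDerivAt.clm_apply (hasFDerivAt_const b z)
    rw [dirDeriv, h1.fderiv]
    simp
  rw [key, key]
  exact hs v w

theorem continuous_lap (hu : ContDiff ℝ 2 u) : Continuous (lap u) :=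
  (continuous_dirDeriv (dirDeriv_contDiff hu (by norm_num) 1) 1).add
    (continuous_dirDeriv (dirDeriv_contDiff hu (by norm_num) Complex.I) Complex.I)

theorem eqOn_unitClosedDisk {f g : ℂ → ℝ} (hf : Continuous f) (hg : Continuous g)
    (h : ∀ z ∈ unitDisk, f z = g z) : ∀ z ∈ unitClosedDisk, f z = g z := by
  intro z hz
  have hcl : closure unitDisk = unitClosedDisk := closure_ball 0 one_ne_zero
  have hc : IsClosed {w | f w = g w} := isClosed_eq hf hg
  exact (closure_minimal h hc) (hcl ▸ hz)

theorem hasDerivAt_comp_circ (hu : ContDiff ℝ 1 u) (p : ℂ) (θ : ℝ) :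
    HasDerivAt (fun t => u (circ p t)) (tangentialDeriv u (circ p θ)) θ := by
  rw [tangentialDeriv_eq]
  convert! (hasPD_self hu (circ p θ)).comp_hasDerivAt (hasDerivAt_circ p θ) using 1
  simp

end Regularity

theorem norm_eq_one_of_mem {z : ℂ} (hz : z ∈ unitCircle) : z.re ^ 2 + z.im ^ 2 = 1 := by
  have : ‖z‖ = 1 := by simpa [unitCircle] using hz
  have h2 := Complex.sq_norm z
  rw [this, Complex.normSq_apply] at h2
  linarith

theorem integral_periodic_deriv_eq_zero {f f' : ℝ → ℝ} (hf : ∀ θ, HasDerivAt f (f' θ) θ)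
    (hc : Continuous f') (hper : f Real.pi = f (-Real.pi)) :
    ∫ θ in (-Real.pi)..Real.pi, f' θ = 0 := by
  rw [intervalIntegral.integral_eq_sub_of_hasDerivAt (fun x _ => hf x) (hc.intervalIntegrable _ _),
    hper, sub_self]

theorem circ_pi (p : ℂ) : circ p Real.pi = circ p (-Real.pi) := by
  have := circ_periodic p (-Real.pi)
  rwa [show -Real.pi + 2 * Real.pi = Real.pi by ring] at this

/-- Green's identity against a harmonic function. -/
theorem green_holomorphic {u : ℂ → ℝ} (hu : ContDiff ℝ 2 u) {F : ℂ → ℂ} (hF : Differentiable ℂ F)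
    {p : ℂ} (hp : ‖p‖ = 1) :
    ∫ z in unitDisk, (F z).re * lap u z = ∫ θ in (-Real.pi)..Real.pi,
      ((F (circ p θ)).re * normalDeriv u (circ p θ)
        - u (circ p θ) * (circ p θ * deriv F (circ p θ)).re) := by
  have hu1 : ContDiff ℝ 1 u := hu.of_le (by norm_num)
  have hF1 : Differentiable ℂ (deriv F) := hF.deriv
  rw [integral_div_disk hp
    (A := fun z => (F z).re * dirDeriv 1 u z - u z * (deriv F z).re)
    (B := fun z => (F z).re * dirDeriv Complex.I u z + u z * (deriv F z).im)
    (fun z _ => ((HasPD.re (hF z).hasDerivAt).mul (hasPD_dirDeriv hu 1 z)).sub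
      ((hasPD_self hu1 z).mul (HasPD.re (hF1 z).hasDerivAt)))
    (fun z _ => ((HasPD.re (hF z).hasDerivAt).mul (hasPD_dirDeriv hu Complex.I z)).add
      ((hasPD_self hu1 z).mul (HasPD.im (hF1 z).hasDerivAt)))
    (fun z _ => by simp only [lap]; ring)
    (d := fun z => (F z).re * lap u z)
    ((Complex.continuous_re.comp hF.continuous).mul (continuous_lap hu)).continuousOn]
  congr 1
  ext θ
  rw [normalDeriv_eq, Complex.mul_re]
  ring

/-- Gauss–Bonnet identity. -/
theorem gauss_bonnet {u K h : ℂ → ℝ} (hu : ContDiff ℝ 2 u) (hh : Continuous h)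
    (hs : SolvesLiouville K h u) {p : ℂ} (hp : ‖p‖ = 1) :
    (∫ z in unitDisk, K z * Real.exp (u z)) +
      ∫ θ in (-Real.pi)..Real.pi, h (circ p θ) * Real.exp (u (circ p θ) / 2) = 2 * Real.pi := by
  have hg := green_holomorphic hu (F := fun _ => 1) (differentiable_const _) hp
  simp only [Complex.one_re, one_mul, deriv_const, mul_zero, Complex.zero_re, sub_zero] at hg
  have h1 : ∫ z in unitDisk, lap u z = -2 * ∫ z in unitDisk, K z * Real.exp (u z) := by
    rw [← integral_const_mul]
    apply setIntegral_congr_fun Metric.isOpen_ball.measurableSet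
    intro z hz
    have := hs.1 z hz
    show lap u z = -2 * (K z * Real.exp (u z))
    linarith
  have h2 : ∫ θ in (-Real.pi)..Real.pi, normalDeriv u (circ p θ) =
      2 * (∫ θ in (-Real.pi)..Real.pi, h (circ p θ) * Real.exp (u (circ p θ) / 2))
        - 4 * Real.pi := by
    have hcong : ∀ θ, normalDeriv u (circ p θ) =
        2 * (h (circ p θ) * Real.exp (u (circ p θ) / 2)) - 2 := by
      intro θ
      have := hs.2 _ (circ_mem hp θ)
      linarith
    simp_rw [hcong]
    rw [intervalIntegral.integral_sub _ (by simp), intervalIntegral.integral_const_mul,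
      intervalIntegral.integral_const]
    · simp; ring
    · apply Continuous.intervalIntegrable
      have := continuous_circ p
      have := hu.continuous
      fun_prop
  linarith

/-- Pohozaev identity for the conformal field `z F(z)`. -/
theorem pohozaev {u K h : ℂ → ℝ} (hu : ContDiff ℝ 2 u) (hK : ContDiff ℝ 1 K) (hh : ContDiff ℝ 1 h)
    (hs : SolvesLiouville K h u) {F : ℂ → ℂ} (hF : Differentiable ℂ F)
    {p : ℂ} (hp : ‖p‖ = 1) :
    ∫ θ in (-Real.pi)..Real.pi,
      ((F (circ p θ)).re * (2 * (h (circ p θ) ^ 2 + K (circ p θ)) * Real.exp (u (circ p θ))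
          - 1 / 2 * tangentialDeriv u (circ p θ) ^ 2 - 2)
        + 2 * (circ p θ * deriv F (circ p θ)).im * tangentialDeriv u (circ p θ)
        - 4 * tangentialDeriv h (circ p θ) * (F (circ p θ)).im * Real.exp (u (circ p θ) / 2)) =
    2 * ∫ z in unitDisk, Real.exp (u z) *
      (dirDeriv 1 K z * (z * F z).re + dirDeriv Complex.I K z * (z * F z).im) := by
  have hu1 : ContDiff ℝ 1 u := hu.of_le (by norm_num)
  have hF1 : Differentiable ℂ (deriv F) := hF.deriv
  have hF2 : Differentiable ℂ (deriv (deriv F)) := hF1.deriv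
  have hX : ∀ z, HasDerivAt (fun w => w * F w) (F z + z * deriv F z) z := by
    intro z
    convert! (hasDerivAt_id z).mul (hF z).hasDerivAt using 1
    simp
  have hX1 : ∀ z, HasDerivAt (fun w => F w + w * deriv F w)
      (2 * deriv F z + z * deriv (deriv F) z) z := by
    intro z
    convert! (hF z).hasDerivAt.add ((hasDerivAt_id z).mul (hF1 z).hasDerivAt) using 1
    simp; ring
  have hX2 : ∀ z, HasDerivAt (fun w => 2 * deriv F w + w * deriv (deriv F) w)
      (3 * deriv (deriv F) z + z * deriv (deriv (deriv F)) z) z := by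
    intro z
    convert! ((hF1 z).hasDerivAt.const_mul 2).add
      ((hasDerivAt_id z).mul (hF2 z).hasDerivAt) using 1
    simp; ring
  have hcu := hu.continuous
  have hcF := hF.continuous
  have hcF1 := hF1.continuous
  have hcF2 := hF2.continuous
  have hcc := continuous_circ p
  have hlap : ∀ z ∈ unitClosedDisk, lap u z = -(2 * K z * Real.exp (u z)) := by
    apply eqOn_unitClosedDisk (continuous_lap hu)
    · have := hK.continuous
      fun_prop
    · intro z hz
      have := hs.1 z hz
      linarith
  have hdK1 := continuous_dirDeriv hK 1
  have hdKI := continuous_dirDeriv hK Complex.I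
  rw [← integral_const_mul]
  have hux := hasPD_dirDeriv hu 1
  have huy := hasPD_dirDeriv hu Complex.I
  have hW := fun z => ((HasPD.re (hX z)).mul (hux z)).add ((HasPD.im (hX z)).mul (huy z))
  have hq := fun z => ((hux z).mul (hux z)).add ((huy z).mul (huy z))
  have hKe := fun z => (hasPD_self hK z).mul (hasPD_self hu1 z).exp
  rw [integral_div_disk hp
    (fun z _ => ((((hW z).mul (hux z)).sub (((hq z).mul (HasPD.re (hX z))).const_mul (1 / 2))).add
      (((hKe z).mul (HasPD.re (hX z))).const_mul 2)).add
      ((((HasPD.re (hX1 z)).mul (hux z)).sub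
        ((hasPD_self hu1 z).mul (HasPD.re (hX2 z)))).const_mul 2))
    (fun z _ => ((((hW z).mul (huy z)).sub (((hq z).mul (HasPD.im (hX z))).const_mul (1 / 2))).add
      (((hKe z).mul (HasPD.im (hX z))).const_mul 2)).add
      ((((HasPD.re (hX1 z)).mul (huy z)).add
        ((hasPD_self hu1 z).mul (HasPD.im (hX2 z)))).const_mul 2))
    (fun z hz => by
      have h1 := hlap z hz
      have h2 := dirDeriv_comm hu 1 Complex.I z
      simp only [lap] at h1
      rw [h2]
      linear_combination ((z * F z).re * dirDeriv 1 u z + (z * F z).im * dirDeriv Complex.I u z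
        + 2 * (F z + z * deriv F z).re) * h1)
    (by fun_prop)]
  have hT : ∀ θ, HasDerivAt (fun t => 4 * (h (circ p t) * Real.exp (u (circ p t) / 2)
        * (F (circ p t)).im) - 2 * (u (circ p t) * (F (circ p t)).im)
        - 2 * (u (circ p t) * (circ p t * deriv F (circ p t)).im) - 4 * (F (circ p t)).im)
      (4 * ((tangentialDeriv h (circ p θ) * Real.exp (u (circ p θ) / 2) + h (circ p θ) *
        (Real.exp (u (circ p θ) / 2) * (tangentialDeriv u (circ p θ) / 2))) * (F (circ p θ)).im
        + h (circ p θ) * Real.exp (u (circ p θ) / 2) * (circ p θ * deriv F (circ p θ)).re)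
        - 2 * (tangentialDeriv u (circ p θ) * (F (circ p θ)).im +
          u (circ p θ) * (circ p θ * deriv F (circ p θ)).re)
        - 2 * (tangentialDeriv u (circ p θ) * (circ p θ * deriv F (circ p θ)).im + u (circ p θ) *
          (circ p θ * (deriv F (circ p θ) + circ p θ * deriv (deriv F) (circ p θ))).re)
        - 4 * (circ p θ * deriv F (circ p θ)).re) θ := by
    intro θ
    have hu' := hasDerivAt_comp_circ hu1 p θ
    have hh' := hasDerivAt_comp_circ hh p θ
    have hF' : HasDerivAt (fun t => (F (circ p t)).im) (circ p θ * deriv F (circ p θ)).re θ := by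
      convert! (HasPD.im (hF (circ p θ)).hasDerivAt).comp_hasDerivAt (hasDerivAt_circ p θ) using 1
      simp; ring
    have hG : HasDerivAt (fun w => w * deriv F w) (deriv F (circ p θ) +
        circ p θ * deriv (deriv F) (circ p θ)) (circ p θ) := by
      convert! (hasDerivAt_id (circ p θ)).mul (hF1 (circ p θ)).hasDerivAt using 1
      simp
    have hG' : HasDerivAt (fun t => (circ p t * deriv F (circ p t)).im) (circ p θ *
        (deriv F (circ p θ) + circ p θ * deriv (deriv F) (circ p θ))).re θ := by
      convert! (HasPD.im hG).comp_hasDerivAt (hasDerivAt_circ p θ) using 1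
      simp; ring
    exact (((((hh'.mul (hu'.div_const 2).exp).mul hF').const_mul 4).sub
      ((hu'.mul hF').const_mul 2)).sub ((hu'.mul hG').const_mul 2)).sub (hF'.const_mul 4)
  have htu := continuous_tangentialDeriv hu1
  have hth := continuous_tangentialDeriv hh
  have hch := hh.continuous
  have hcK := hK.continuous
  have hnull := integral_periodic_deriv_eq_zero hT (by fun_prop) (by simp only [circ_pi])
  rw [← sub_eq_zero, ← intervalIntegral.integral_sub, ← neg_eq_zero, ← hnull,
    ← intervalIntegral.integral_neg]
  · apply intervalIntegral.integral_congr
    intro θ _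
    have hn := hs.2 _ (circ_mem hp θ)
    have hz := norm_eq_one_of_mem (circ_mem hp θ)
    have he : Real.exp (u (circ p θ)) = Real.exp (u (circ p θ) / 2) ^ 2 := by
      rw [← Real.exp_nat_mul]; congr 1; push_cast; ring
    simp only [normalDeriv_eq] at hn
    simp only [tangentialDeriv_eq, he]
    generalize circ p θ = z at *
    generalize Real.exp (u z / 2) = E at *
    generalize dirDeriv 1 u z = ux at *
    generalize dirDeriv Complex.I u z = uy at *
    generalize dirDeriv 1 h z = hx at *
    generalize dirDeriv Complex.I h z = hy at *
    generalize deriv (deriv F) z = f2 at *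
    generalize deriv F z = f1 at *
    generalize F z = f at *
    generalize u z = w at *
    generalize K z = k at *
    generalize h z = hz0 at *
    simp only [Complex.mul_re, Complex.mul_im, Complex.add_re, Complex.add_im, Complex.re_ofNat,
      Complex.im_ofNat]
    generalize z.re = x at *
    generalize z.im = y at *
    linear_combination (1 / 2 * f.re * (ux * x + uy * y + 2 * hz0 * E - 2)
      + f.im * (-(ux * y) + uy * x) + 2 * (f.re + (x * f1.re - y * f1.im))) * hn
      + (2 * k * E ^ 2 * f.re) * hz
  · exact Continuous.intervalIntegrable (by fun_prop) _ _
  · have h1 := (dirDeriv_contDiff (m := 1) hu (by norm_num) 1).continuous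
    have h2 := (dirDeriv_contDiff (m := 1) hu (by norm_num) Complex.I).continuous
    have hr : Continuous fun θ => (circ p θ).re := Complex.continuous_re.comp hcc
    have hi : Continuous fun θ => (circ p θ).im := Complex.continuous_im.comp hcc
    apply Continuous.intervalIntegrable
    fun_prop

theorem exists_entire_primitive {P : ℂ → ℂ} (hP : Differentiable ℂ P) :
    ∃ G : ℂ → ℂ, ∀ z, HasDerivAt G (P z) z := by
  obtain ⟨G, hG⟩ := hP.isExactOn_univ
  exact ⟨G, fun z => hG z (Set.mem_univ z)⟩

theorem exists_log_primitive {P : ℂ → ℂ} (hP : Differentiable ℂ P) (h0 : P 0 = 0) :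
    ∃ G : ℂ → ℂ, Differentiable ℂ G ∧ ∀ z, z * deriv G z = -Complex.I * P z := by
  have hd : Differentiable ℂ (dslope P 0) := by
    rw [← differentiableOn_univ] at hP ⊢
    exact (Complex.differentiableOn_dslope univ_mem).2 hP
  obtain ⟨G, hG⟩ := exists_entire_primitive (hd.const_mul (-Complex.I))
  refine ⟨G, fun z => (hG z).differentiableAt, fun z => ?_⟩
  rw [(hG z).deriv]
  have := sub_smul_dslope P 0 z
  rw [h0, sub_zero, sub_zero, smul_eq_mul] at this
  linear_combination (-Complex.I) * this

theorem hasDerivAt_entire_circ {G : ℂ → ℂ} (hG : Differentiable ℂ G) (p : ℂ) (θ : ℝ) :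
    HasDerivAt (fun t => G (circ p t)) (Complex.I * (circ p θ * deriv G (circ p θ))) θ := by
  convert! (hG (circ p θ)).hasDerivAt.comp θ (hasDerivAt_circ p θ) using 1
  ring

theorem integral_entire_circ {F : ℂ → ℂ} (hF : Differentiable ℂ F) (p : ℂ) :
    ∫ θ in (-Real.pi)..Real.pi, F (circ p θ) = 2 * Real.pi * F 0 := by
  obtain ⟨G, hG, hGe⟩ := exists_log_primitive (P := fun z => F z - F 0) (by fun_prop) (by simp)
  have hc := continuous_circ p
  have hFc := hF.continuous
  have h1 : ∫ θ in (-Real.pi)..Real.pi, (F (circ p θ) - F 0) = 0 := by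
    have hd : ∀ θ, HasDerivAt (fun t => G (circ p t)) (F (circ p θ) - F 0) θ := by
      intro θ
      convert! hasDerivAt_entire_circ hG p θ using 1
      rw [hGe]
      linear_combination (F (circ p θ) - F 0) * Complex.I_mul_I
    rw [intervalIntegral.integral_eq_sub_of_hasDerivAt (fun x _ => hd x)
      (Continuous.intervalIntegrable (by fun_prop) _ _), circ_pi, sub_self]
  rw [intervalIntegral.integral_sub (Continuous.intervalIntegrable (by fun_prop) _ _) (by simp),
    intervalIntegral.integral_const, sub_eq_zero] at h1
  rw [h1, Complex.real_smul]
  push_cast; ring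

theorem integral_re_entire_circ {F : ℂ → ℂ} (hF : Differentiable ℂ F) (p : ℂ) :
    ∫ θ in (-Real.pi)..Real.pi, (F (circ p θ)).re = 2 * Real.pi * (F 0).re := by
  have hc := continuous_circ p
  have hFc := hF.continuous
  have h := Complex.reCLM.intervalIntegral_comp_comm (μ := volume) (a := -Real.pi) (b := Real.pi)
    (f := fun θ => F (circ p θ)) (Continuous.intervalIntegrable (by fun_prop) _ _)
  simp only [Complex.reCLM_apply] at h
  rw [h, integral_entire_circ hF]
  simp [Complex.mul_re]

theorem integral_re_sq_eq_im_sq {P : ℂ → ℂ} (hP : Differentiable ℂ P) (h0 : P 0 = 0) (p : ℂ) :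
    ∫ θ in (-Real.pi)..Real.pi, (P (circ p θ)).re ^ 2 =
      ∫ θ in (-Real.pi)..Real.pi, (P (circ p θ)).im ^ 2 := by
  have hc := continuous_circ p
  have hPc := hP.continuous
  have h := integral_re_entire_circ (F := fun z => P z * P z) (by fun_prop) p
  simp only [Complex.mul_re, h0, Complex.zero_re, mul_zero] at h
  rw [← sub_eq_zero, ← intervalIntegral.integral_sub, ← h]
  · congr 1; ext θ; ring
  · exact Continuous.intervalIntegrable (by fun_prop) _ _
  · exact Continuous.intervalIntegrable (by fun_prop) _ _

theorem norm_le_of_circ {F : ℂ → ℂ} (hF : Differentiable ℂ F) {p : ℂ} (hp : ‖p‖ = 1) {C : ℝ}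
    (h : ∀ θ ∈ Set.Icc (-Real.pi) Real.pi, ‖F (circ p θ)‖ ≤ C) :
    ∀ z ∈ unitClosedDisk, ‖F z‖ ≤ C := by
  intro z hz
  have hcl : closure unitDisk = unitClosedDisk := closure_ball 0 one_ne_zero
  refine Complex.norm_le_of_forall_mem_frontier_norm_le (U := unitDisk) Metric.isBounded_ball
    hF.diffContOnCl ?_ (hcl ▸ hz)
  intro w hw
  rw [unitDisk, frontier_ball (0 : ℂ) one_ne_zero] at hw
  obtain ⟨θ, hθ, rfl⟩ := circ_surj hp (by simpa using hw)
  exact h θ (Set.Ioc_subset_Icc_self hθ)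

/-- Cauchy–Schwarz on an interval. -/
theorem integral_mul_sq_le {a b : ℝ} (hab : a ≤ b) {f g : ℝ → ℝ}
    (hf : ContinuousOn f (Set.Icc a b)) (hg : ContinuousOn g (Set.Icc a b)) :
    (∫ x in a..b, f x * g x) ^ 2 ≤ (∫ x in a..b, f x ^ 2) * ∫ x in a..b, g x ^ 2 := by
  have hI : ∀ k : ℝ → ℝ, ContinuousOn k (Set.Icc a b) → IntervalIntegrable k volume a b := by
    intro k hk
    exact ContinuousOn.intervalIntegrable (by rwa [Set.uIcc_of_le hab])
  have key : ∀ t : ℝ, 0 ≤ (∫ x in a..b, g x ^ 2) * (t * t) +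
      (2 * ∫ x in a..b, f x * g x) * t + ∫ x in a..b, f x ^ 2 := by
    intro t
    have h0 : 0 ≤ ∫ x in a..b, (t * g x + f x) ^ 2 :=
      intervalIntegral.integral_nonneg hab fun x _ => sq_nonneg _
    have h1 : ∫ x in a..b, (t * g x + f x) ^ 2 =
        ∫ x in a..b, (t * t) * g x ^ 2 + (2 * t) * (f x * g x) + f x ^ 2 := by
      congr 1; ext x; ring
    rw [h1, intervalIntegral.integral_add ((hI _ (by fun_prop))) (hI _ (by fun_prop)),
      intervalIntegral.integral_add (hI _ (by fun_prop)) (hI _ (by fun_prop)),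
      intervalIntegral.integral_const_mul, intervalIntegral.integral_const_mul] at h0
    linarith
  have := discrim_le_zero key
  rw [discrim] at this
  nlinarith

theorem integral_sq_le {a b : ℝ} (hab : a ≤ b) {f : ℝ → ℝ}
    (hf : ContinuousOn f (Set.Icc a b)) :
    (∫ x in a..b, f x) ^ 2 ≤ (b - a) * ∫ x in a..b, f x ^ 2 := by
  have := integral_mul_sq_le hab hf (continuousOn_const (c := (1 : ℝ)))
  simp only [mul_one, one_pow, intervalIntegral.integral_const, smul_eq_mul] at this
  linarith

/-- Morrey-type bound for an entire function in terms of the derivative of its real part along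
the circle. -/
theorem norm_sub_le_sqrt {F : ℂ → ℂ} (hF : Differentiable ℂ F) {p : ℂ} (hp : ‖p‖ = 1) :
    ∀ z ∈ unitClosedDisk, ‖F z - F 0‖ ≤ Real.sqrt (4 * Real.pi *
      ∫ θ in (-Real.pi)..Real.pi, (circ p θ * deriv F (circ p θ)).im ^ 2) := by
  have hpi := Real.pi_pos
  have hpp : -Real.pi ≤ Real.pi := by linarith
  have hc := continuous_circ p
  have hFc := hF.continuous
  have hF1 := hF.deriv.continuous
  set Q : ℝ → ℂ := fun θ => circ p θ * deriv F (circ p θ) with hQ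
  have hQc : Continuous Q := by fun_prop
  have hsq : ∫ θ in (-Real.pi)..Real.pi, ‖Q θ‖ ^ 2 =
      2 * ∫ θ in (-Real.pi)..Real.pi, (Q θ).im ^ 2 := by
    have h := integral_re_sq_eq_im_sq (P := fun z => z * deriv F z)
      (differentiable_id.mul hF.deriv) (by simp) p
    have : ∀ θ, ‖Q θ‖ ^ 2 = (Q θ).re ^ 2 + (Q θ).im ^ 2 := by
      intro θ; rw [Complex.sq_norm, Complex.normSq_apply]; ring
    simp_rw [this]
    rw [intervalIntegral.integral_add, h]
    · ring
    · exact Continuous.intervalIntegrable (by fun_prop) _ _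
    · exact Continuous.intervalIntegrable (by fun_prop) _ _
  have hL : ∫ θ in (-Real.pi)..Real.pi, ‖Q θ‖ ≤ Real.sqrt (4 * Real.pi *
      ∫ θ in (-Real.pi)..Real.pi, (Q θ).im ^ 2) := by
    apply Real.le_sqrt_of_sq_le
    have := integral_sq_le hpp (f := fun θ => ‖Q θ‖) (by fun_prop)
    rw [hsq] at this
    linarith
  have hdiff : ∀ s ∈ Set.Icc (-Real.pi) Real.pi, ∀ t ∈ Set.Icc (-Real.pi) Real.pi,
      ‖F (circ p s) - F (circ p t)‖ ≤ ∫ θ in (-Real.pi)..Real.pi, ‖Q θ‖ := by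
    have aux : ∀ s ∈ Set.Icc (-Real.pi) Real.pi, ∀ t ∈ Set.Icc (-Real.pi) Real.pi, t ≤ s →
        ‖F (circ p s) - F (circ p t)‖ ≤ ∫ θ in (-Real.pi)..Real.pi, ‖Q θ‖ := by
      intro s hs t ht hts
      rw [← intervalIntegral.integral_eq_sub_of_hasDerivAt
        (fun x _ => hasDerivAt_entire_circ hF p x)
        (Continuous.intervalIntegrable (by fun_prop) _ _)]
      refine (intervalIntegral.norm_integral_le_integral_norm hts).trans ?_
      simp only [norm_mul, Complex.norm_I, one_mul]
      have : ∫ θ in t..s, ‖Q θ‖ ≤ ∫ θ in (-Real.pi)..Real.pi, ‖Q θ‖ :=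
        intervalIntegral.integral_mono_interval ht.1 hts hs.2
          (Eventually.of_forall fun x => norm_nonneg _)
          (Continuous.intervalIntegrable (by fun_prop) _ _)
      simpa [hQ] using this
    intro s hs t ht
    rcases le_total t s with h | h
    · exact aux s hs t ht h
    · rw [norm_sub_rev]; exact aux t ht s hs h
  refine norm_le_of_circ (F := fun z => F z - F 0) (by fun_prop) hp ?_
  intro s hs
  have hm := integral_entire_circ hF p
  have h1 : (2 * Real.pi : ℂ) * (F (circ p s) - F 0) =
      ∫ θ in (-Real.pi)..Real.pi, (F (circ p s) - F (circ p θ)) := by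
    rw [intervalIntegral.integral_sub (by simp) (Continuous.intervalIntegrable (by fun_prop) _ _),
      hm, intervalIntegral.integral_const, Complex.real_smul]
    push_cast; ring
  have h2 := intervalIntegral.norm_integral_le_of_norm_le_const (a := -Real.pi) (b := Real.pi)
    (f := fun θ => F (circ p s) - F (circ p θ)) (C := ∫ θ in (-Real.pi)..Real.pi, ‖Q θ‖)
    (fun t ht => hdiff s hs t (Set.Ioc_subset_Icc_self (by rwa [Set.uIoc_of_le hpp] at ht)))
  rw [← h1, norm_mul] at h2
  have h3 : ‖(2 * Real.pi : ℂ)‖ = 2 * Real.pi := by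
    rw [norm_mul, Complex.norm_real, Real.norm_of_nonneg hpi.le]; simp
  rw [h3, show |Real.pi - -Real.pi| = 2 * Real.pi by rw [abs_of_pos] <;> linarith] at h2
  have : ‖F (circ p s) - F 0‖ ≤ ∫ θ in (-Real.pi)..Real.pi, ‖Q θ‖ := by
    have h4 : (0 : ℝ) < 2 * Real.pi := by linarith
    nlinarith
  exact this.trans hL

instance : Fact (0 < 2 * Real.pi) := ⟨Real.two_pi_pos⟩

theorem fourier_span_eq_entire (g : C(AddCircle (2 * Real.pi), ℂ))
    (hg : g ∈ Submodule.span ℂ (Set.range (@fourier (2 * Real.pi)))) :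
    ∃ P Q : ℂ → ℂ, Differentiable ℂ P ∧ Differentiable ℂ Q ∧ ∀ θ : ℝ,
      g (θ : AddCircle (2 * Real.pi)) =
        P (circ 1 θ) + (starRingEnd ℂ) (Q (circ 1 θ)) := by
  induction hg using Submodule.span_induction with
  | mem x hx =>
    obtain ⟨n, rfl⟩ := hx
    have hexp : ∀ θ : ℝ, Complex.exp (2 * Real.pi * Complex.I * n * θ / (2 * Real.pi : ℝ)) =
        Complex.exp (n * (θ * Complex.I)) := by
      intro θ
      congr 1
      have : (Real.pi : ℂ) ≠ 0 := by exact_mod_cast Real.pi_ne_zero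
      push_cast
      field_simp
    rcases Int.eq_nat_or_neg n with ⟨m, rfl | rfl⟩
    · refine ⟨fun z => z ^ m, fun _ => 0, by fun_prop, by fun_prop, fun θ => ?_⟩
      rw [fourier_coe_apply, hexp]
      simp [circ, ← Complex.exp_nat_mul]
    · refine ⟨fun _ => 0, fun z => z ^ m, by fun_prop, by fun_prop, fun θ => ?_⟩
      rw [fourier_coe_apply, hexp]
      simp [circ, ← Complex.exp_nat_mul, ← Complex.exp_conj]
  | zero => exact ⟨fun _ => 0, fun _ => 0, by fun_prop, by fun_prop, fun θ => by simp⟩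
  | add x y _ _ hx hy =>
    obtain ⟨P, Q, hP, hQ, h⟩ := hx
    obtain ⟨P', Q', hP', hQ', h'⟩ := hy
    refine ⟨fun z => P z + P' z, fun z => Q z + Q' z, by fun_prop, by fun_prop, fun θ => ?_⟩
    simp only [ContinuousMap.add_apply, h, h', map_add]
    ring
  | smul a x _ hx =>
    obtain ⟨P, Q, hP, hQ, h⟩ := hx
    refine ⟨fun z => a * P z, fun z => (starRingEnd ℂ) a * Q z, by fun_prop, by fun_prop,
      fun θ => ?_⟩
    simp only [ContinuousMap.smul_apply, h, smul_eq_mul, map_mul, Complex.conj_conj]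
    ring

/-- A continuous function on the circle is uniformly approximated by real parts of entire
functions. -/
theorem exists_entire_approx {V : ℝ → ℝ} (hV : ContinuousOn V (Set.Icc (-Real.pi) Real.pi))
    (hper : V (-Real.pi) = V Real.pi) {p : ℂ} (hp : ‖p‖ = 1) {ε : ℝ} (hε : 0 < ε) :
    ∃ P : ℂ → ℂ, Differentiable ℂ P ∧ ∀ θ ∈ Set.Icc (-Real.pi) Real.pi,
      |(P (circ p θ)).re - V θ| ≤ ε := by
  have hpi := Real.pi_pos
  have hend : -Real.pi + 2 * Real.pi = Real.pi := by ring
  let f : C(AddCircle (2 * Real.pi), ℂ) :=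
    ⟨AddCircle.liftIco (2 * Real.pi) (-Real.pi) (fun θ => (V θ : ℂ)),
      AddCircle.liftIco_continuous (by rw [hend, hper])
        (by rw [hend]; exact Complex.continuous_ofReal.comp_continuousOn hV)⟩
  have hf : ∀ θ ∈ Set.Icc (-Real.pi) Real.pi, f (θ : AddCircle (2 * Real.pi)) = V θ := by
    have h1 : ∀ θ ∈ Set.Ico (-Real.pi) Real.pi, f (θ : AddCircle (2 * Real.pi)) = V θ := by
      intro θ hθ
      exact AddCircle.liftIco_coe_apply (f := fun θ => (V θ : ℂ)) (by rwa [hend])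
    intro θ hθ
    rcases eq_or_lt_of_le hθ.2 with h | h
    · have : ((Real.pi : ℝ) : AddCircle (2 * Real.pi)) = ((-Real.pi : ℝ) : AddCircle _) := by
        rw [← AddCircle.coe_add_period (2 * Real.pi) (-Real.pi), hend]
      rw [h, this, h1 _ ⟨le_refl _, by linarith⟩, hper]
    · exact h1 θ ⟨hθ.1, h⟩
  have hmem : f ∈ (Submodule.span ℂ (Set.range (@fourier (2 * Real.pi)))).topologicalClosure := by
    rw [span_fourier_closure_eq_top]; trivial
  obtain ⟨g, hg, hfg⟩ := Metric.mem_closure_iff.1 hmem ε hε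
  obtain ⟨P, Q, hP, hQ, h⟩ := fourier_span_eq_entire g hg
  have hp0 : p ≠ 0 := by rw [← norm_ne_zero_iff, hp]; norm_num
  refine ⟨fun z => P (z / p) + Q (z / p), by fun_prop, fun θ hθ => ?_⟩
  have hcp : circ p θ / p = circ 1 θ := by
    simp only [circ]; field_simp
  have hb : ‖f θ - g θ‖ ≤ ε := by
    rw [← dist_eq_norm]
    exact (ContinuousMap.dist_apply_le_dist _).trans hfg.le
  rw [hf θ hθ, h] at hb
  have h3 := (Complex.abs_re_le_norm _).trans hb
  rw [abs_sub_comm]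
  simpa [hcp] using h3

theorem exists_entire_C1_approx {η η' : ℝ → ℝ}
    (hd : ∀ θ ∈ Set.Icc (-Real.pi) Real.pi, HasDerivAt η (η' θ) θ)
    (hc : ContinuousOn η' (Set.Icc (-Real.pi) Real.pi))
    (hper : η (-Real.pi) = η Real.pi) (hper' : η' (-Real.pi) = η' Real.pi)
    {p : ℂ} (hp : ‖p‖ = 1) {ε : ℝ} (hε : 0 < ε) :
    ∃ G : ℂ → ℂ, Differentiable ℂ G ∧ (G 0).im = 0 ∧ ∀ θ ∈ Set.Icc (-Real.pi) Real.pi,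
      |(G (circ p θ)).re - η θ| ≤ ε ∧ |-(circ p θ * deriv G (circ p θ)).im - η' θ| ≤ ε := by
  have hpi := Real.pi_pos
  have hpp : -Real.pi ≤ Real.pi := by linarith
  have hcc := continuous_circ p
  set ε₁ := ε / (4 * Real.pi + 2) with hε₁
  have hε₁0 : 0 < ε₁ := by positivity
  have hε₁m : ε₁ * (4 * Real.pi + 2) = ε := by rw [hε₁]; field_simp
  obtain ⟨P, hP, hPV⟩ := exists_entire_approx hc hper' hp hε₁0
  have hPc := hP.continuous
  have hint0 : ∫ θ in (-Real.pi)..Real.pi, η' θ = 0 := by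
    rw [intervalIntegral.integral_eq_sub_of_hasDerivAt (f := η)
      (fun x hx => hd x (by rwa [Set.uIcc_of_le hpp] at hx))
      (ContinuousOn.intervalIntegrable (by rwa [Set.uIcc_of_le hpp])), hper, sub_self]
  have hP0 : |(P 0).re| ≤ ε₁ := by
    have h1 := integral_re_entire_circ hP p
    have h2 : ∫ θ in (-Real.pi)..Real.pi, ((P (circ p θ)).re - η' θ) =
        2 * Real.pi * (P 0).re := by
      rw [intervalIntegral.integral_sub (Continuous.intervalIntegrable (by fun_prop) _ _)
        (ContinuousOn.intervalIntegrable (by rwa [Set.uIcc_of_le hpp])), h1, hint0, sub_zero]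
    have h3 := intervalIntegral.norm_integral_le_of_norm_le_const (a := -Real.pi) (b := Real.pi)
      (f := fun θ => (P (circ p θ)).re - η' θ) (C := ε₁)
      (fun t ht => hPV t (Set.Ioc_subset_Icc_self (by rwa [Set.uIoc_of_le hpp] at ht)))
    rw [h2, Real.norm_eq_abs, abs_mul, abs_of_pos (by linarith : 0 < 2 * Real.pi),
      show |Real.pi - -Real.pi| = 2 * Real.pi by rw [abs_of_pos] <;> linarith] at h3
    nlinarith
  obtain ⟨G, hG, hGe⟩ := exists_log_primitive (P := fun z => P z - P 0) (by fun_prop) (by simp)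
  set c : ℂ := ((η (-Real.pi) - (G (circ p (-Real.pi))).re : ℝ) : ℂ) - (G 0).im * Complex.I with hcdef
  have hder : ∀ z, deriv (fun z => G z + c) z = deriv G z := fun z => deriv_add_const c
  have hderiv : ∀ θ ∈ Set.Icc (-Real.pi) Real.pi,
      |-(circ p θ * deriv G (circ p θ)).im - η' θ| ≤ 2 * ε₁ := by
    intro θ hθ
    rw [hGe]
    have h1 := abs_le.1 (hPV θ hθ)
    have h2 := abs_le.1 hP0
    simp only [Complex.neg_im, neg_mul, neg_neg, Complex.mul_im, Complex.I_re, Complex.I_im, zero_mul,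
      one_mul, zero_add, Complex.sub_re]
    rw [abs_le]
    constructor <;> linarith [h1.1, h1.2, h2.1, h2.2]
  refine ⟨fun z => G z + c, by fun_prop, ?_, fun θ hθ => ⟨?_, ?_⟩⟩
  · simp [hcdef]
  · have hE : ∀ x ∈ Set.uIcc (-Real.pi) θ, HasDerivAt
        (fun t => (G (circ p t) + c).re - η t) (-(circ p x * deriv G (circ p x)).im - η' x) x := by
      intro x hx
      rw [Set.uIcc_of_le hθ.1] at hx
      have h1 := Complex.reCLM.hasFDerivAt.comp_hasDerivAt x
        ((hasDerivAt_entire_circ hG p x).add_const c)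
      refine (HasDerivAt.congr_deriv h1 ?_).sub (hd x ⟨hx.1, hx.2.trans hθ.2⟩)
      simp
    have hi : IntervalIntegrable (fun x => -(circ p x * deriv G (circ p x)).im - η' x)
        volume (-Real.pi) θ := by
      apply ContinuousOn.intervalIntegrable
      rw [Set.uIcc_of_le hθ.1]
      have hG1 := hG.deriv.continuous
      have : Continuous fun x => -(circ p x * deriv G (circ p x)).im := by fun_prop
      exact this.continuousOn.sub (hc.mono (Set.Icc_subset_Icc_right hθ.2))
    have h2 := intervalIntegral.integral_eq_sub_of_hasDerivAt hE hi
    have h3 := intervalIntegral.norm_integral_le_of_norm_le_const (a := -Real.pi) (b := θ)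
      (f := fun x => -(circ p x * deriv G (circ p x)).im - η' x) (C := 2 * ε₁)
      (fun t ht => hderiv t (by
        rw [Set.uIoc_of_le hθ.1] at ht
        exact ⟨ht.1.le, ht.2.trans hθ.2⟩))
    have h4 : (G (circ p (-Real.pi)) + c).re - η (-Real.pi) = 0 := by simp [hcdef]
    rw [h2, h4, sub_zero, Real.norm_eq_abs, abs_of_nonneg (by linarith [hθ.1] : 0 ≤ θ - -Real.pi)]
      at h3
    refine h3.trans ?_
    have := hθ.2
    nlinarith
  · rw [hder]
    refine (hderiv θ hθ).trans ?_
    nlinarith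

/-- A first order linear functional on the circle that is bounded by the sup norm on real parts
of entire functions is bounded by the mean and the `L²` norm of the derivative. -/
theorem abs_functional_le {a b : ℝ → ℝ} (ha : Continuous a) (hb : Continuous b) {M : ℝ}
    {p : ℂ} (hp : ‖p‖ = 1)
    (hE : ∀ F : ℂ → ℂ, Differentiable ℂ F → ∀ S : ℝ, (∀ z ∈ unitClosedDisk, ‖F z‖ ≤ S) →
      |∫ θ in (-Real.pi)..Real.pi, ((F (circ p θ)).re * a θ +
        -(circ p θ * deriv F (circ p θ)).im * b θ)| ≤ M * S)
    {η η' : ℝ → ℝ} (hd : ∀ θ ∈ Set.Icc (-Real.pi) Real.pi, HasDerivAt η (η' θ) θ)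
    (hc : ContinuousOn η' (Set.Icc (-Real.pi) Real.pi))
    (hper : η (-Real.pi) = η Real.pi) (hper' : η' (-Real.pi) = η' Real.pi) :
    |∫ θ in (-Real.pi)..Real.pi, (η θ * a θ + η' θ * b θ)| ≤
      M * (|(∫ θ in (-Real.pi)..Real.pi, η θ) / (2 * Real.pi)| +
        Real.sqrt (4 * Real.pi * ∫ θ in (-Real.pi)..Real.pi, η' θ ^ 2)) := by
  have hpi := Real.pi_pos
  have hpp : -Real.pi ≤ Real.pi := by linarith
  have hcc := continuous_circ p
  have hηc : ContinuousOn η (Set.Icc (-Real.pi) Real.pi) :=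
    fun x hx => (hd x hx).continuousAt.continuousWithinAt
  have hI : ∀ k : ℝ → ℝ, ContinuousOn k (Set.Icc (-Real.pi) Real.pi) →
      IntervalIntegrable k volume (-Real.pi) Real.pi := by
    intro k hk
    exact ContinuousOn.intervalIntegrable (by rwa [Set.uIcc_of_le hpp])
  have hac := ha.continuousOn (s := Set.Icc (-Real.pi) Real.pi)
  have hbc := hb.continuousOn (s := Set.Icc (-Real.pi) Real.pi)
  set J := ∫ θ in (-Real.pi)..Real.pi, η' θ ^ 2 with hJ
  set m := (∫ θ in (-Real.pi)..Real.pi, η θ) / (2 * Real.pi) with hm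
  set Z := ∫ θ in (-Real.pi)..Real.pi, (|a θ| + |b θ|) with hZ
  have key : ∀ ε : ℝ, 0 < ε → |∫ θ in (-Real.pi)..Real.pi, (η θ * a θ + η' θ * b θ)| ≤
      M * (|m| + ε + Real.sqrt (4 * Real.pi * ((1 + ε) * J + (ε + ε ^ 2) * (2 * Real.pi))))
        + ε * Z := by
    intro ε hε
    obtain ⟨G, hG, hG0, hGa⟩ := exists_entire_C1_approx hd hc hper hper' hp hε
    have hGc := hG.continuous
    have hG1 := hG.deriv.continuous
    set g : ℝ → ℝ := fun θ => (G (circ p θ)).re with hg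
    set g' : ℝ → ℝ := fun θ => -(circ p θ * deriv G (circ p θ)).im with hg'
    have hgc : Continuous g := by fun_prop
    have hgc' : Continuous g' := by fun_prop
    have hgcc := hgc.continuousOn (s := Set.Icc (-Real.pi) Real.pi)
    have hgcc' := hgc'.continuousOn (s := Set.Icc (-Real.pi) Real.pi)
    have h1 : |(∫ θ in (-Real.pi)..Real.pi, (η θ * a θ + η' θ * b θ)) -
        ∫ θ in (-Real.pi)..Real.pi, (g θ * a θ + g' θ * b θ)| ≤ ε * Z := by
      rw [← intervalIntegral.integral_sub (hI _ (by fun_prop)) (hI _ (by fun_prop)), hZ,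
        ← intervalIntegral.integral_const_mul]
      refine (intervalIntegral.abs_integral_le_integral_abs hpp).trans ?_
      apply intervalIntegral.integral_mono_on hpp (hI _ (by fun_prop)) (hI _ (by fun_prop))
      intro θ hθ
      obtain ⟨h2, h3⟩ := hGa θ hθ
      rw [abs_sub_comm] at h2 h3
      have : η θ * a θ + η' θ * b θ - (g θ * a θ + g' θ * b θ) =
          (η θ - g θ) * a θ + (η' θ - g' θ) * b θ := by ring
      rw [this]
      refine (abs_add_le _ _).trans ?_
      rw [abs_mul, abs_mul]
      have h4 := mul_le_mul_of_nonneg_right h2 (abs_nonneg (a θ))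
      have h5 := mul_le_mul_of_nonneg_right h3 (abs_nonneg (b θ))
      linarith
    have hsq : ∫ θ in (-Real.pi)..Real.pi, g' θ ^ 2 ≤
        (1 + ε) * J + (ε + ε ^ 2) * (2 * Real.pi) := by
      have h2 : (1 + ε) * J + (ε + ε ^ 2) * (2 * Real.pi) =
          ∫ θ in (-Real.pi)..Real.pi, ((1 + ε) * η' θ ^ 2 + (ε + ε ^ 2)) := by
        rw [intervalIntegral.integral_add (hI _ (by fun_prop)) (by simp),
          intervalIntegral.integral_const_mul, intervalIntegral.integral_const]
        simp; ring
      rw [h2]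
      apply intervalIntegral.integral_mono_on hpp (hI _ (by fun_prop)) (hI _ (by fun_prop))
      intro θ hθ
      have h3 := abs_le.1 (hGa θ hθ).2
      have h4 : (g' θ - η' θ) ^ 2 ≤ ε ^ 2 := sq_le_sq' h3.1 h3.2
      nlinarith [mul_nonneg hε.le (sq_nonneg (η' θ - 1)), mul_nonneg hε.le (sq_nonneg (η' θ + 1)),
        mul_nonneg (sub_nonneg.2 h3.1) hε.le, sq_nonneg (η' θ),
        show g' θ ^ 2 = η' θ ^ 2 + 2 * (η' θ * (g' θ - η' θ)) + (g' θ - η' θ) ^ 2 by ring,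
        show 2 * (η' θ * (g' θ - η' θ)) ≤ ε * η' θ ^ 2 + ε by
          rcases le_total 0 (η' θ) with h | h
          · nlinarith [mul_nonneg h (sub_nonneg.2 h3.2), mul_nonneg hε.le (sq_nonneg (η' θ - 1))]
          · nlinarith [mul_nonneg (neg_nonneg.2 h) (sub_nonneg.2 h3.1),
              mul_nonneg hε.le (sq_nonneg (η' θ + 1))]]
    have hmean : |(G 0).re - m| ≤ ε := by
      have h2 := integral_re_entire_circ hG p
      have h3 : ∫ θ in (-Real.pi)..Real.pi, (g θ - η θ) = 2 * Real.pi * ((G 0).re - m) := by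
        rw [intervalIntegral.integral_sub (hI _ (by fun_prop)) (hI _ (by fun_prop)), hg, h2, hm]
        field_simp
      have h4 := intervalIntegral.norm_integral_le_of_norm_le_const (a := -Real.pi) (b := Real.pi)
        (f := fun θ => g θ - η θ) (C := ε)
        (fun t ht => (hGa t (Set.Ioc_subset_Icc_self (by rwa [Set.uIoc_of_le hpp] at ht))).1)
      rw [h3, Real.norm_eq_abs, abs_mul, abs_of_pos (by linarith : 0 < 2 * Real.pi),
        show |Real.pi - -Real.pi| = 2 * Real.pi by rw [abs_of_pos] <;> linarith] at h4
      nlinarith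
    have hG0n : ‖G 0‖ ≤ |m| + ε := by
      have : G 0 = ((G 0).re : ℂ) := by apply Complex.ext <;> simp [hG0]
      rw [this, Complex.norm_real, Real.norm_eq_abs]
      have := abs_le.1 hmean
      have h2 := neg_abs_le m
      have h3 := le_abs_self m
      rw [abs_le]; constructor <;> linarith
    have h6 := hE G hG (|m| + ε + Real.sqrt (4 * Real.pi *
        ((1 + ε) * J + (ε + ε ^ 2) * (2 * Real.pi)))) (by
      intro z hz
      have h7 := norm_sub_le_sqrt hG hp z hz
      have h8 : ‖G z‖ ≤ ‖G 0‖ + ‖G z - G 0‖ := by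
        have := norm_add_le (G 0) (G z - G 0)
        simpa using this
      have h9 : Real.sqrt (4 * Real.pi *
          ∫ θ in (-Real.pi)..Real.pi, (circ p θ * deriv G (circ p θ)).im ^ 2) ≤
          Real.sqrt (4 * Real.pi * ((1 + ε) * J + (ε + ε ^ 2) * (2 * Real.pi))) := by
        apply Real.sqrt_le_sqrt
        apply mul_le_mul_of_nonneg_left _ (by linarith)
        simpa only [hg', neg_sq] using hsq
      linarith)
    have h10 := abs_sub_abs_le_abs_sub (∫ θ in (-Real.pi)..Real.pi, (η θ * a θ + η' θ * b θ))
      (∫ θ in (-Real.pi)..Real.pi, (g θ * a θ + g' θ * b θ))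
    linarith
  have hlim : Tendsto (fun ε : ℝ => M * (|m| + ε + Real.sqrt (4 * Real.pi *
      ((1 + ε) * J + (ε + ε ^ 2) * (2 * Real.pi)))) + ε * Z) (nhdsWithin 0 (Set.Ioi 0))
      (nhds (M * (|m| + Real.sqrt (4 * Real.pi * J)))) := by
    have : Continuous (fun ε : ℝ => M * (|m| + ε + Real.sqrt (4 * Real.pi *
      ((1 + ε) * J + (ε + ε ^ 2) * (2 * Real.pi)))) + ε * Z) := by fun_prop
    have h2 := (this.tendsto 0).mono_left (nhdsWithin_le_nhds (s := Set.Ioi 0))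
    simpa using h2
  exact ge_of_tendsto hlim (eventually_nhdsWithin_of_forall fun ε hε => key ε hε)

/-- The quadratic form of the Pohozaev identity along the circle. -/
def bInt (U U' D η η' : ℝ → ℝ) : ℝ :=
  ∫ θ in (-Real.pi)..Real.pi,
    (η θ * (1 / 2 * U' θ ^ 2 + 2 - 2 * D θ * Real.exp (U θ)) + η' θ * (2 * U' θ))

section OneDim
variable {U U' D : ℝ → ℝ}

theorem bInt_cos_lower (hU : Continuous U) (hU' : Continuous U') (hD : Continuous D) {t : ℝ}
    (ht : 0 < t) (ht1 : t ≤ 1) :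
    16 * t / 5 - 2 * ∫ θ in (-Real.pi)..Real.pi,
        D θ * Real.exp (U θ) * (1 / 2 + t ^ 2 - 1 / 2 * Real.cos θ) ≤
      bInt U U' D (fun θ => 1 / 2 + t ^ 2 - 1 / 2 * Real.cos θ) (fun θ => 1 / 2 * Real.sin θ) := by
  have hpi := Real.pi_gt_three
  have hpp : -Real.pi ≤ Real.pi := by linarith
  set η : ℝ → ℝ := fun θ => 1 / 2 + t ^ 2 - 1 / 2 * Real.cos θ with hη
  have hηc : Continuous η := by fun_prop
  have hηpos : ∀ θ, 0 < η θ := by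
    intro θ
    have := Real.cos_le_one θ
    have : 0 < t ^ 2 := by positivity
    simp only [hη]; linarith
  have hinvc : Continuous fun θ => (η θ)⁻¹ := hηc.inv₀ fun θ => (hηpos θ).ne'
  have hpt : ∀ θ, -2 * Real.cos θ + 2 * t ^ 2 * (η θ)⁻¹ - 2 * (D θ * Real.exp (U θ) * η θ) ≤
      η θ * (1 / 2 * U' θ ^ 2 + 2 - 2 * D θ * Real.exp (U θ)) +
        1 / 2 * Real.sin θ * (2 * U' θ) := by
    intro θ
    have h0 := hηpos θ
    have hi : η θ * (η θ)⁻¹ = 1 := mul_inv_cancel₀ h0.ne'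
    have hi0 : 0 < (η θ)⁻¹ := inv_pos.2 h0
    have h1 : 0 ≤ 1 / 2 * (η θ)⁻¹ * (η θ * U' θ + Real.sin θ) ^ 2 := by positivity
    have h2 : 1 / 2 * (η θ)⁻¹ * (η θ * U' θ + Real.sin θ) ^ 2 =
        1 / 2 * η θ * U' θ ^ 2 + Real.sin θ * U' θ + 1 / 2 * (η θ)⁻¹ * Real.sin θ ^ 2 := by
      linear_combination (1 / 2 * η θ * U' θ ^ 2 + Real.sin θ * U' θ) * hi
    have h3 : 2 * η θ - 1 / 2 * (η θ)⁻¹ * Real.sin θ ^ 2 =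
        -2 * Real.cos θ + 2 * (t ^ 2 + t ^ 4) * (η θ)⁻¹ := by
      have hsc := Real.sin_sq_add_cos_sq θ
      have hc : Real.cos θ = 1 + 2 * t ^ 2 - 2 * η θ := by simp only [hη]; ring
      rw [hc] at hsc ⊢
      linear_combination (-(1 / 2) * (η θ)⁻¹) * hsc + (2 * η θ - 2 - 4 * t ^ 2) * hi
    have h4 : 0 ≤ t ^ 4 * (η θ)⁻¹ := by positivity
    nlinarith
  have hlow : 8 / (5 * t) ≤ ∫ θ in (-Real.pi)..Real.pi, (η θ)⁻¹ := by
    have h1 : ∫ θ in (-t)..t, (η θ)⁻¹ ≤ ∫ θ in (-Real.pi)..Real.pi, (η θ)⁻¹ :=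
      intervalIntegral.integral_mono_interval (by linarith) (by linarith) (by linarith)
        (Eventually.of_forall fun x => (inv_pos.2 (hηpos x)).le)
        (hinvc.intervalIntegrable _ _)
    have h2 : ∫ _ in (-t)..t, (4 / (5 * t ^ 2)) ≤ ∫ θ in (-t)..t, (η θ)⁻¹ := by
      apply intervalIntegral.integral_mono_on (by linarith) (by simp)
        (hinvc.intervalIntegrable _ _)
      intro θ hθ
      have h3 : η θ ≤ 5 * t ^ 2 / 4 := by
        have := Real.one_sub_sq_div_two_le_cos (x := θ)
        have h4 : θ ^ 2 ≤ t ^ 2 := sq_le_sq' hθ.1 hθ.2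
        simp only [hη]; linarith
      rw [show 4 / (5 * t ^ 2) = (5 * t ^ 2 / 4)⁻¹ by rw [inv_div]]
      exact inv_anti₀ (hηpos θ) h3
    rw [intervalIntegral.integral_const] at h2
    have h5 : (t - -t) • (4 / (5 * t ^ 2)) = 8 / (5 * t) := by
      rw [smul_eq_mul]; field_simp; ring
    linarith
  have hmono : ∫ θ in (-Real.pi)..Real.pi,
      (-2 * Real.cos θ + 2 * t ^ 2 * (η θ)⁻¹ - 2 * (D θ * Real.exp (U θ) * η θ)) ≤
      bInt U U' D η (fun θ => 1 / 2 * Real.sin θ) := by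
    apply intervalIntegral.integral_mono_on hpp
    · exact Continuous.intervalIntegrable (by fun_prop) _ _
    · exact Continuous.intervalIntegrable (by fun_prop) _ _
    · exact fun θ _ => hpt θ
  rw [intervalIntegral.integral_sub (Continuous.intervalIntegrable (by fun_prop) _ _)
      (Continuous.intervalIntegrable (by fun_prop) _ _),
    intervalIntegral.integral_add (Continuous.intervalIntegrable (by fun_prop) _ _)
      (Continuous.intervalIntegrable (by fun_prop) _ _),
    intervalIntegral.integral_const_mul, intervalIntegral.integral_const_mul,
    intervalIntegral.integral_const_mul, integral_cos] at hmono
  have h6 : 2 * t ^ 2 * (8 / (5 * t)) = 16 * t / 5 := by field_simp; ring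
  have h7 := mul_le_mul_of_nonneg_left hlow (by positivity : 0 ≤ 2 * t ^ 2)
  simp only [Real.sin_pi, Real.sin_neg, neg_zero, sub_zero, mul_zero] at hmono
  linarith

/-- `G = e^{-U/4} g'` for `g = cos(θ/2) e^{U/4}`. -/
def halfG (U' : ℝ → ℝ) (θ : ℝ) : ℝ := 1 / 4 * (Real.cos (θ / 2) * U' θ - 2 * Real.sin (θ / 2))

theorem continuous_halfG (hU' : Continuous U') : Continuous (halfG U') := by
  unfold halfG; fun_prop

theorem hasDerivAt_halfG (hd : ∀ θ, HasDerivAt U (U' θ) θ) (θ : ℝ) :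
    HasDerivAt (fun x => Real.cos (x / 2) * Real.exp (U x / 4))
      (Real.exp (U θ / 4) * halfG U' θ) θ := by
  have h1 := ((hasDerivAt_id θ).div_const 2).cos
  have h2 := ((hd θ).div_const 4).exp
  convert! h1.mul h2 using 1
  simp only [halfG, id]; ring

theorem bInt_half_angle (hU : Continuous U) (hU' : Continuous U') (hD : Continuous D) :
    bInt U U' D (fun θ => Real.cos (θ / 2) ^ 2) (fun θ => -(Real.cos (θ / 2) * Real.sin (θ / 2))) =
      8 * (∫ θ in (-Real.pi)..Real.pi, halfG U' θ ^ 2) -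
        2 * ∫ θ in (-Real.pi)..Real.pi, D θ * Real.exp (U θ) * Real.cos (θ / 2) ^ 2 := by
  have hG := continuous_halfG hU'
  have hcos : ∫ θ in (-Real.pi)..Real.pi, 2 * Real.cos θ = 0 := by
    rw [intervalIntegral.integral_const_mul, integral_cos]; simp
  rw [bInt, ← intervalIntegral.integral_const_mul, ← intervalIntegral.integral_const_mul,
    ← intervalIntegral.integral_sub (Continuous.intervalIntegrable (by fun_prop) _ _)
      (Continuous.intervalIntegrable (by fun_prop) _ _), ← sub_eq_zero,
    ← intervalIntegral.integral_sub (Continuous.intervalIntegrable (by fun_prop) _ _)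
      (Continuous.intervalIntegrable (by fun_prop) _ _), ← hcos]
  congr 1
  ext θ
  have h1 := Real.cos_two_mul (θ / 2)
  have h2 := Real.sin_sq_add_cos_sq (θ / 2)
  rw [show 2 * (θ / 2) = θ by ring] at h1
  simp only [halfG]
  rw [h1]
  linear_combination (-2) * h2

theorem exp_half_le_mass_mul (hd : ∀ θ, HasDerivAt U (U' θ) θ) (hU' : Continuous U') :
    Real.exp (U 0 / 2) ≤ (∫ θ in (-Real.pi)..Real.pi, Real.exp (U θ / 2)) *
      ∫ θ in (-Real.pi)..Real.pi, halfG U' θ ^ 2 := by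
  have hpi := Real.pi_pos
  have hU : Continuous U := continuous_iff_continuousAt.2 fun θ => (hd θ).continuousAt
  have hG := continuous_halfG hU'
  have h1 := intervalIntegral.integral_eq_sub_of_hasDerivAt
    (a := -Real.pi) (b := 0) (fun x _ => hasDerivAt_halfG hd x)
    (Continuous.intervalIntegrable (by fun_prop) _ _)
  have hz : Real.cos (-Real.pi / 2) = 0 := by rw [neg_div, Real.cos_neg, Real.cos_pi_div_two]
  simp only [hz, zero_div, Real.cos_zero, one_mul, zero_mul, sub_zero] at h1
  have h2 := integral_mul_sq_le (a := -Real.pi) (b := 0) (by linarith)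
    (f := fun θ => Real.exp (U θ / 4)) (g := halfG U') (by fun_prop) (by fun_prop)
  have h3 : ∀ x, Real.exp (U x / 4) ^ 2 = Real.exp (U x / 2) := by
    intro x; rw [← Real.exp_nat_mul]; congr 1; push_cast; ring
  rw [h1] at h2
  simp only [h3] at h2
  refine h2.trans ?_
  have h4 : ∫ θ in (-Real.pi)..0, Real.exp (U θ / 2) ≤
      ∫ θ in (-Real.pi)..Real.pi, Real.exp (U θ / 2) :=
    intervalIntegral.integral_mono_interval (le_refl _) (by linarith) (by linarith)
      (Eventually.of_forall fun x => (Real.exp_pos _).le)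
      (Continuous.intervalIntegrable (by fun_prop) _ _)
  have h5 : ∫ θ in (-Real.pi)..0, halfG U' θ ^ 2 ≤
      ∫ θ in (-Real.pi)..Real.pi, halfG U' θ ^ 2 :=
    intervalIntegral.integral_mono_interval (le_refl _) (by linarith) (by linarith)
      (Eventually.of_forall fun x => sq_nonneg _)
      (Continuous.intervalIntegrable (by fun_prop) _ _)
  apply mul_le_mul h4 h5
  · exact intervalIntegral.integral_nonneg (by linarith) fun x _ => sq_nonneg _
  · exact intervalIntegral.integral_nonneg (by linarith) fun x _ => (Real.exp_pos _).le

/-- Weighted Wirtinger inequality. -/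
theorem wirtinger_halfG (hd : ∀ θ, HasDerivAt U (U' θ) θ) (hU' : Continuous U') {k : ℝ}
    (hk : 0 < k) (hkb : k * (∫ θ in (-Real.pi)..Real.pi, Real.exp (U θ / 2)) < Real.pi) :
    k ^ 2 * (∫ θ in (-Real.pi)..Real.pi, Real.exp (U θ) * Real.cos (θ / 2) ^ 2) ≤
      ∫ θ in (-Real.pi)..Real.pi, halfG U' θ ^ 2 := by
  have hpi := Real.pi_pos
  have hpp : -Real.pi ≤ Real.pi := by linarith
  have hU : Continuous U := continuous_iff_continuousAt.2 fun θ => (hd θ).continuousAt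
  have hG := continuous_halfG hU'
  set β := ∫ θ in (-Real.pi)..Real.pi, Real.exp (U θ / 2) with hβ
  have hw : Continuous fun θ => Real.exp (U θ / 2) := by fun_prop
  set s : ℝ → ℝ := fun θ => (∫ x in (-Real.pi)..θ, Real.exp (U x / 2)) - β / 2 with hs
  have hsd : ∀ θ, HasDerivAt s (Real.exp (U θ / 2)) θ := by
    intro θ
    exact (intervalIntegral.integral_hasDerivAt_right (hw.intervalIntegrable _ _)
      (hw.stronglyMeasurableAtFilter _ _) hw.continuousAt).sub_const _
  have hscont : Continuous s := continuous_iff_continuousAt.2 fun θ => (hsd θ).continuousAt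
  have hsb : ∀ θ ∈ Set.Icc (-Real.pi) Real.pi, k * s θ ∈ Set.Ioo (-(Real.pi / 2)) (Real.pi / 2) := by
    intro θ hθ
    have h1 : 0 ≤ ∫ x in (-Real.pi)..θ, Real.exp (U x / 2) :=
      intervalIntegral.integral_nonneg hθ.1 fun x _ => (Real.exp_pos _).le
    have h2 : ∫ x in (-Real.pi)..θ, Real.exp (U x / 2) ≤ β :=
      intervalIntegral.integral_mono_interval (le_refl _) hθ.1 hθ.2
        (Eventually.of_forall fun x => (Real.exp_pos _).le) (hw.intervalIntegrable _ _)
    simp only [hs]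
    constructor <;> nlinarith
  have hcosne : ∀ θ ∈ Set.Icc (-Real.pi) Real.pi, Real.cos (k * s θ) ≠ 0 := fun θ hθ =>
    (Real.cos_pos_of_mem_Ioo (hsb θ hθ)).ne'
  set T : ℝ → ℝ := fun θ => k * Real.tan (k * s θ) with hT
  have hTd : ∀ θ ∈ Set.Icc (-Real.pi) Real.pi,
      HasDerivAt T ((k ^ 2 + T θ ^ 2) * Real.exp (U θ / 2)) θ := by
    intro θ hθ
    have h1 := ((Real.hasDerivAt_tan (hcosne θ hθ)).comp θ ((hsd θ).const_mul k)).const_mul k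
    convert! h1 using 1
    have h2 : 1 / Real.cos (k * s θ) ^ 2 = 1 + Real.tan (k * s θ) ^ 2 := by
      rw [← Real.inv_one_add_tan_sq (hcosne θ hθ)]
      simp
    rw [h2]; simp only [hT]; ring
  have hTc : ContinuousOn T (Set.Icc (-Real.pi) Real.pi) :=
    fun θ hθ => (hTd θ hθ).continuousAt.continuousWithinAt
  have hFd : ∀ θ ∈ Set.Icc (-Real.pi) Real.pi, HasDerivAt
      (fun θ => (Real.cos (θ / 2) * Real.exp (U θ / 4)) ^ 2 * T θ)
      (2 * Real.cos (θ / 2) * Real.exp (U θ / 2) * halfG U' θ * T θ +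
        Real.exp (U θ) * Real.cos (θ / 2) ^ 2 * (k ^ 2 + T θ ^ 2)) θ := by
    intro θ hθ
    convert! ((hasDerivAt_halfG hd θ).pow 2).mul (hTd θ hθ) using 1
    have h1 : Real.exp (U θ / 2) = Real.exp (U θ / 4) ^ 2 := by
      rw [← Real.exp_nat_mul]; congr 1; push_cast; ring
    have h2 : Real.exp (U θ) = Real.exp (U θ / 4) ^ 4 := by
      rw [← Real.exp_nat_mul]; congr 1; push_cast; ring
    rw [h1, h2]
    simp; ring
  have hI : ∀ k : ℝ → ℝ, ContinuousOn k (Set.Icc (-Real.pi) Real.pi) →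
      IntervalIntegrable k volume (-Real.pi) Real.pi := by
    intro k hk
    exact ContinuousOn.intervalIntegrable (by rwa [Set.uIcc_of_le hpp])
  have hUc := hU.continuousOn (s := Set.Icc (-Real.pi) Real.pi)
  have hGc := hG.continuousOn (s := Set.Icc (-Real.pi) Real.pi)
  have hz := intervalIntegral.integral_eq_sub_of_hasDerivAt (a := -Real.pi) (b := Real.pi)
    (fun θ hθ => hFd θ (by rwa [Set.uIcc_of_le hpp] at hθ)) (hI _ (by fun_prop))
  have hz1 : Real.cos (-Real.pi / 2) = 0 := by rw [neg_div, Real.cos_neg, Real.cos_pi_div_two]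
  simp only [hz1, Real.cos_pi_div_two, zero_mul, sub_zero, ne_eq, OfNat.ofNat_ne_zero,
    not_false_eq_true, zero_pow] at hz
  rw [← intervalIntegral.integral_const_mul, ← add_zero
    (∫ θ in (-Real.pi)..Real.pi, halfG U' θ ^ 2), ← hz,
    ← intervalIntegral.integral_add (hI _ (by fun_prop)) (hI _ (by fun_prop))]
  apply intervalIntegral.integral_mono_on hpp (hI _ (by fun_prop)) (hI _ (by fun_prop))
  intro θ _
  have h2 : Real.exp (U θ) = Real.exp (U θ / 2) ^ 2 := by
    rw [← Real.exp_nat_mul]; congr 1; push_cast; ring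
  simp only [h2]
  have := sq_nonneg (halfG U' θ + Real.cos (θ / 2) * Real.exp (U θ / 2) * T θ)
  nlinarith

end OneDim

theorem integral_eq_of_eq_zero_off {f : ℝ → ℝ} (hf : Continuous f) {a b c d : ℝ}
    (hac : a ≤ c) (hdb : d ≤ b) (h1 : ∀ x ∈ Set.Icc a c, f x = 0)
    (h2 : ∀ x ∈ Set.Icc d b, f x = 0) : ∫ x in a..b, f x = ∫ x in c..d, f x := by
  have hI : ∀ x y, IntervalIntegrable f volume x y := fun x y => hf.intervalIntegrable x y
  rw [← intervalIntegral.integral_add_adjacent_intervals (hI a c) (hI c b),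
    ← intervalIntegral.integral_add_adjacent_intervals (hI c d) (hI d b),
    intervalIntegral.integral_congr (g := fun _ => 0) (a := a) (b := c)
      (fun x hx => h1 x (by rwa [Set.uIcc_of_le hac] at hx)),
    intervalIntegral.integral_congr (g := fun _ => 0) (a := d) (b := b)
      (fun x hx => h2 x (by rwa [Set.uIcc_of_le hdb] at hx))]
  simp

/-- The clamp of `s` to `[0, π / k]`. -/
def clampArc (k s : ℝ) : ℝ := max 0 (min s (Real.pi / k))

theorem continuous_clampArc (k : ℝ) : Continuous (clampArc k) := by
  unfold clampArc; fun_prop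

/-- The `C¹` bump equal to `sin² (k s)` on `[0, π / k]` and zero elsewhere. -/
def sinBump (k s : ℝ) : ℝ := ∫ x in (0 : ℝ)..s, k * Real.sin (2 * (k * clampArc k x))

theorem hasDerivAt_sinBump (k s : ℝ) :
    HasDerivAt (sinBump k) (k * Real.sin (2 * (k * clampArc k s))) s := by
  have hc : Continuous fun x => k * Real.sin (2 * (k * clampArc k x)) := by
    have := continuous_clampArc k
    fun_prop
  exact intervalIntegral.integral_hasDerivAt_right (hc.intervalIntegrable _ _)
    (hc.stronglyMeasurableAtFilter _ _) hc.continuousAt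

theorem clampArc_of_mem {k s : ℝ} (h : s ∈ Set.Icc 0 (Real.pi / k)) : clampArc k s = s := by
  rw [clampArc, min_eq_left h.2, max_eq_right h.1]

theorem clampArc_of_nonpos {k s : ℝ} (h : s ≤ 0) : clampArc k s = 0 := by
  rw [clampArc, max_eq_left ((min_le_left _ _).trans h)]

theorem clampArc_of_ge {k s : ℝ} (hk : 0 < k) (h : Real.pi / k ≤ s) :
    clampArc k s = Real.pi / k := by
  rw [clampArc, min_eq_right h, max_eq_right (by positivity)]

theorem sinBump_of_mem {k s : ℝ} (h : s ∈ Set.Icc 0 (Real.pi / k)) :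
    sinBump k s = Real.sin (k * s) ^ 2 := by
  have hd : ∀ x ∈ Set.uIcc 0 s, HasDerivAt (fun x => Real.sin (k * x) ^ 2)
      (k * Real.sin (2 * (k * clampArc k x))) x := by
    intro x hx
    rw [Set.uIcc_of_le h.1] at hx
    rw [clampArc_of_mem ⟨hx.1, hx.2.trans h.2⟩, Real.sin_two_mul]
    convert! (((hasDerivAt_id x).const_mul k).sin).pow 2 using 1
    simp; ring
  have hc : Continuous fun x => k * Real.sin (2 * (k * clampArc k x)) := by
    have := continuous_clampArc k
    fun_prop
  rw [sinBump, intervalIntegral.integral_eq_sub_of_hasDerivAt hd (hc.intervalIntegrable _ _)]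
  simp

theorem sinBump_of_nonpos {k s : ℝ} (h : s ≤ 0) : sinBump k s = 0 := by
  rw [sinBump, intervalIntegral.integral_congr (g := fun _ => 0)]
  · simp
  · intro x hx
    rw [Set.uIcc_of_ge h] at hx
    simp [clampArc_of_nonpos hx.2]

theorem sinBump_of_ge {k s : ℝ} (hk : 0 < k) (h : Real.pi / k ≤ s) : sinBump k s = 0 := by
  have hc : Continuous fun x => k * Real.sin (2 * (k * clampArc k x)) := by
    have := continuous_clampArc k
    fun_prop
  rw [sinBump, ← intervalIntegral.integral_add_adjacent_intervals (b := Real.pi / k)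
    (hc.intervalIntegrable _ _) (hc.intervalIntegrable _ _)]
  change sinBump k (Real.pi / k) + _ = 0
  rw [sinBump_of_mem ⟨by positivity, le_rfl⟩, intervalIntegral.integral_congr (g := fun _ => 0)]
  · simp [mul_div_cancel₀ _ hk.ne']
  · intro x hx
    rw [Set.uIcc_of_le h] at hx
    simp [clampArc_of_ge hk hx.1, mul_div_cancel₀ _ hk.ne']

theorem abs_le_of_integral_deriv_sq {ψ ψ' : ℝ → ℝ} {a b : ℝ} (hab : a ≤ b)
    (hd : ∀ x, HasDerivAt ψ (ψ' x) x) (hc : Continuous ψ') (h0 : ψ a = 0) {x : ℝ}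
    (hx : x ∈ Set.Icc a b) : ψ x ^ 2 ≤ (b - a) * ∫ y in a..b, ψ' y ^ 2 := by
  have h1 : ∫ y in a..x, ψ' y = ψ x := by
    rw [intervalIntegral.integral_eq_sub_of_hasDerivAt (fun y _ => hd y)
      (hc.intervalIntegrable _ _), h0, sub_zero]
  have h2 := integral_sq_le hx.1 (hc.continuousOn (s := Set.Icc a x))
  have h3 : ∫ y in a..x, ψ' y ^ 2 ≤ ∫ y in a..b, ψ' y ^ 2 :=
    intervalIntegral.integral_mono_interval le_rfl hx.1 hx.2
      (Eventually.of_forall fun y => sq_nonneg _) ((hc.pow 2).intervalIntegrable _ _)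
  have h4 : 0 ≤ ∫ y in a..b, ψ' y ^ 2 :=
    intervalIntegral.integral_nonneg hab fun y _ => sq_nonneg _
  rw [h1] at h2
  refine h2.trans (mul_le_mul (by linarith [hx.2]) h3 ?_ (by linarith))
  exact intervalIntegral.integral_nonneg hx.1 fun y _ => sq_nonneg _

theorem arc_mass_le {U U' D : ℝ → ℝ} (hd : ∀ θ, HasDerivAt U (U' θ) θ) (hU' : Continuous U')
    (hD : Continuous D) {k D₁ r M : ℝ} (hk : 0 < k) (hr : 0 < r) (hr1 : r ≤ 1)
    (hDr : ∀ θ ∈ Set.Icc (-r) r, D₁ ≤ D θ) (hD₁ : 4 * k ^ 2 < D₁)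
    (hM : 0 ≤ M)
    (hB : ∀ η η' : ℝ → ℝ, (∀ θ, HasDerivAt η (η' θ) θ) → Continuous η' →
      η (-Real.pi) = η Real.pi → η' (-Real.pi) = η' Real.pi →
      |bInt U U' D η η'| ≤ M * (|(∫ θ in (-Real.pi)..Real.pi, η θ) / (2 * Real.pi)| +
        √(4 * Real.pi * ∫ θ in (-Real.pi)..Real.pi, η' θ ^ 2)))
    (hsmall : M * (r ^ 2 + √(32 * Real.pi * r)) + 8 * r ^ 2 ≤ 8) :
    ∫ θ in (-r)..r, Real.exp (U θ / 2) ≤ Real.pi / k := by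
  by_contra! hcon
  have hpi := Real.pi_gt_three
  have hU : Continuous U := continuous_iff_continuousAt.2 fun θ => (hd θ).continuousAt
  have hw : Continuous fun θ => Real.exp (U θ / 2) := by fun_prop
  set σ : ℝ → ℝ := fun θ => ∫ x in (-r)..θ, Real.exp (U x / 2) with hσ
  have hσd : ∀ θ, HasDerivAt σ (Real.exp (U θ / 2)) θ := fun θ =>
    intervalIntegral.integral_hasDerivAt_right (hw.intervalIntegrable _ _)
      (hw.stronglyMeasurableAtFilter _ _) hw.continuousAt
  have hσc : Continuous σ := continuous_iff_continuousAt.2 fun θ => (hσd θ).continuousAt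
  have hσm : Monotone σ := monotone_of_hasDerivAt_nonneg hσd fun θ => (Real.exp_pos _).le
  have hσr : σ (-r) = 0 := by simp [hσ]
  have hpk : 0 < Real.pi / k := by positivity
  obtain ⟨t, ⟨ht1, ht2⟩, ht⟩ : ∃ t ∈ Set.Icc (-r) r, σ t = Real.pi / k :=
    intermediate_value_Icc (by linarith) hσc.continuousOn ⟨by rw [hσr]; exact hpk.le, hcon.le⟩
  have hσmem : ∀ θ ∈ Set.Icc (-r) t, σ θ ∈ Set.Icc 0 (Real.pi / k) := fun θ hθ =>
    ⟨hσr ▸ hσm hθ.1, ht ▸ hσm hθ.2⟩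
  set χ' : ℝ → ℝ := fun s => k * Real.sin (2 * (k * clampArc k s)) with hχ'
  set η : ℝ → ℝ := fun θ => Real.exp (-U θ / 2) * sinBump k (σ θ) with hη
  set η' : ℝ → ℝ := fun θ => -(1 / 2) * U' θ * η θ + χ' (σ θ) with hη'
  have hηd : ∀ θ, HasDerivAt η (η' θ) θ := by
    intro θ
    convert! ((((hd θ).neg).div_const 2).exp).mul ((hasDerivAt_sinBump k (σ θ)).comp θ (hσd θ))
      using 1
    have h1 : Real.exp (-U θ / 2) * Real.exp (U θ / 2) = 1 := by
      rw [← Real.exp_add]; ring_nf; exact Real.exp_zero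
    simp only [hη', hη, hχ', Function.comp]
    simp only [Pi.neg_apply]
    linear_combination (-(k * Real.sin (2 * (k * clampArc k (σ θ))))) * h1
  have hηc : Continuous η := continuous_iff_continuousAt.2 fun θ => (hηd θ).continuousAt
  have hη'c : Continuous η' := by
    have := continuous_clampArc k
    simp only [hη', hχ']; fun_prop
  have hleft : ∀ θ ≤ -r, η θ = 0 ∧ η' θ = 0 := by
    intro θ hθ
    have h1 : σ θ ≤ 0 := hσr ▸ hσm hθ
    have h2 : η θ = 0 := by simp [hη, sinBump_of_nonpos h1]
    exact ⟨h2, by simp [hη', h2, hχ', clampArc_of_nonpos h1]⟩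
  have hright : ∀ θ, t ≤ θ → η θ = 0 ∧ η' θ = 0 := by
    intro θ hθ
    have h1 : Real.pi / k ≤ σ θ := ht ▸ hσm hθ
    have h2 : η θ = 0 := by simp [hη, sinBump_of_ge hk h1]
    exact ⟨h2, by simp [hη', h2, hχ', clampArc_of_ge hk h1, mul_div_cancel₀ _ hk.ne']⟩
  set ψ : ℝ → ℝ := fun θ => Real.exp (-U θ / 4) * Real.sin (k * σ θ) with hψ
  set ψ' : ℝ → ℝ := fun θ => -(1 / 4) * U' θ * ψ θ +
    k * Real.exp (U θ / 4) * Real.cos (k * σ θ) with hψ'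
  have e1 : ∀ θ, Real.exp (-U θ / 4) * Real.exp (U θ / 4) = 1 := fun θ => by
    rw [← Real.exp_add]; ring_nf; exact Real.exp_zero
  have e2 : ∀ θ, Real.exp (U θ / 2) = Real.exp (U θ / 4) ^ 2 := fun θ => by
    rw [← Real.exp_nat_mul]; congr 1; push_cast; ring
  have e3 : ∀ θ, Real.exp (U θ) = Real.exp (U θ / 4) ^ 4 := fun θ => by
    rw [← Real.exp_nat_mul]; congr 1; push_cast; ring
  have e4 : ∀ θ, Real.exp (-U θ / 2) = Real.exp (-U θ / 4) ^ 2 := fun θ => by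
    rw [← Real.exp_nat_mul]; congr 1; push_cast; ring
  have hψd : ∀ θ, HasDerivAt ψ (ψ' θ) θ := by
    intro θ
    convert! ((((hd θ).neg).div_const 4).exp).mul (((hσd θ).const_mul k).sin) using 1
    simp only [hψ', hψ, Pi.neg_apply, e2]
    linear_combination (-(k * Real.exp (U θ / 4) * Real.cos (k * σ θ))) * e1 θ
  have hψc : Continuous ψ := continuous_iff_continuousAt.2 fun θ => (hψd θ).continuousAt
  have hψ'c : Continuous ψ' := by simp only [hψ']; fun_prop
  have hηψ : ∀ θ ∈ Set.Icc (-r) t, η θ = ψ θ ^ 2 := by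
    intro θ hθ
    simp only [hη, hψ, sinBump_of_mem (hσmem θ hθ), e4]; ring
  have hη'ψ : ∀ θ ∈ Set.Icc (-r) t, η' θ = 2 * ψ θ * ψ' θ := by
    intro θ hθ
    have h1 := e1 θ
    simp only [hη', hηψ θ hθ, hχ', clampArc_of_mem (hσmem θ hθ), Real.sin_two_mul, hψ']
    simp only [hψ]
    linear_combination (-(2 * k * Real.cos (k * σ θ) * Real.sin (k * σ θ))) * h1
  set Z := ∫ θ in (-r)..t, ψ' θ ^ 2 with hZ
  have hZ0 : 0 ≤ Z := intervalIntegral.integral_nonneg ht1 fun _ _ => sq_nonneg _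
  have hψsup : ∀ θ ∈ Set.Icc (-r) t, ψ θ ^ 2 ≤ 2 * r * Z := by
    intro θ hθ
    have := abs_le_of_integral_deriv_sq ht1 hψd hψ'c (by simp [hψ, hσr]) hθ
    refine this.trans (mul_le_mul_of_nonneg_right (by linarith) hZ0)
  have hψint : ∫ θ in (-r)..t, ψ θ ^ 2 ≤ 4 * r ^ 2 * Z := by
    have h1 : ∫ θ in (-r)..t, ψ θ ^ 2 ≤ ∫ θ in (-r)..t, 2 * r * Z :=
      intervalIntegral.integral_mono_on ht1 ((hψc.pow 2).intervalIntegrable _ _)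
        (continuous_const.intervalIntegrable _ _) hψsup
    rw [intervalIntegral.integral_const, smul_eq_mul] at h1
    have h2 : 0 ≤ 2 * r * Z := by positivity
    nlinarith
  have hψ0 : 0 ≤ ∫ θ in (-r)..t, ψ θ ^ 2 :=
    intervalIntegral.integral_nonneg ht1 fun _ _ => sq_nonneg _
  have hηint : ∫ θ in (-Real.pi)..Real.pi, η θ = ∫ θ in (-r)..t, ψ θ ^ 2 := by
    rw [integral_eq_of_eq_zero_off hηc (c := -r) (d := t) (by linarith) (by linarith)
      (fun x hx => (hleft x hx.2).1) (fun x hx => (hright x hx.1).1)]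
    exact intervalIntegral.integral_congr fun x hx => hηψ x (by rwa [Set.uIcc_of_le ht1] at hx)
  have hη'int : ∫ θ in (-Real.pi)..Real.pi, η' θ ^ 2 ≤ 8 * r * Z ^ 2 := by
    rw [integral_eq_of_eq_zero_off (f := fun θ => η' θ ^ 2) (hη'c.pow 2) (c := -r) (d := t)
      (by linarith) (by linarith) (fun x hx => by simp [(hleft x hx.2).2]) (fun x hx => by simp [(hright x hx.1).2])]
    have h1 : ∫ θ in (-r)..t, η' θ ^ 2 ≤ ∫ θ in (-r)..t, 8 * r * Z * ψ' θ ^ 2 := by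
      refine intervalIntegral.integral_mono_on ht1 ((hη'c.pow 2).intervalIntegrable _ _)
        ((continuous_const.mul (hψ'c.pow 2)).intervalIntegrable _ _) fun θ hθ => ?_
      rw [hη'ψ θ hθ]
      nlinarith [mul_le_mul_of_nonneg_right (hψsup θ hθ) (sq_nonneg (ψ' θ))]
    rw [intervalIntegral.integral_const_mul, ← hZ] at h1
    linarith
  have hBval : bInt U U' D η η' = ∫ θ in (-r)..t,
      (8 * k ^ 2 * (Real.exp (U θ / 2) * Real.cos (k * σ θ) ^ 2) - 8 * ψ' θ ^ 2 + 2 * ψ θ ^ 2 -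
        2 * (D θ * (Real.exp (U θ / 2) * Real.sin (k * σ θ) ^ 2))) := by
    rw [bInt, integral_eq_of_eq_zero_off (c := -r) (d := t) (by fun_prop) (by linarith)
      (by linarith)
      (fun x hx => by simp [(hleft x hx.2).2, (hleft x hx.2).1])
      (fun x hx => by simp [(hright x hx.1).2, (hright x hx.1).1])]
    refine intervalIntegral.integral_congr fun θ hθ => ?_
    rw [Set.uIcc_of_le ht1] at hθ
    have h1 := e1 θ
    simp only [hηψ θ hθ, hη'ψ θ hθ, hψ', e3, e2]
    simp only [hψ]
    generalize Real.exp (-U θ / 4) = a at *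
    generalize Real.exp (U θ / 4) = b at *
    linear_combination (-2 * D θ * b ^ 2 * Real.sin (k * σ θ) ^ 2 * (a * b + 1)) * h1
  have hsd : ∀ θ, HasDerivAt (fun θ => σ θ / 2 - Real.sin (2 * (k * σ θ)) / (4 * k))
      (Real.exp (U θ / 2) * Real.sin (k * σ θ) ^ 2) θ := by
    intro θ
    convert! ((hσd θ).div_const 2).sub
      (((((hσd θ).const_mul k).const_mul 2).sin).div_const (4 * k)) using 1
    rw [Real.cos_two_mul]
    have := Real.sin_sq_add_cos_sq (k * σ θ)
    field_simp
    linear_combination (8 : ℝ) * this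
  have hsint : ∫ θ in (-r)..t, Real.exp (U θ / 2) * Real.sin (k * σ θ) ^ 2 =
      Real.pi / k / 2 := by
    rw [intervalIntegral.integral_eq_sub_of_hasDerivAt (fun θ _ => hsd θ)
      (Continuous.intervalIntegrable (by fun_prop) _ _), hσr, ht, mul_div_cancel₀ _ hk.ne']
    simp
  have hcint : ∫ θ in (-r)..t, Real.exp (U θ / 2) * Real.cos (k * σ θ) ^ 2 =
      Real.pi / k / 2 := by
    have h1 : ∫ θ in (-r)..t, Real.exp (U θ / 2) = Real.pi / k := ht
    have h2 : ∀ θ, Real.exp (U θ / 2) * Real.cos (k * σ θ) ^ 2 =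
        Real.exp (U θ / 2) - Real.exp (U θ / 2) * Real.sin (k * σ θ) ^ 2 := fun θ => by
      rw [Real.cos_sq']; ring
    simp_rw [h2]
    rw [intervalIntegral.integral_sub (hw.intervalIntegrable _ _)
      (Continuous.intervalIntegrable (by fun_prop) _ _), hsint, h1]
    ring
  have hDint : D₁ * (Real.pi / k / 2) ≤
      ∫ θ in (-r)..t, D θ * (Real.exp (U θ / 2) * Real.sin (k * σ θ) ^ 2) := by
    rw [← hsint, ← intervalIntegral.integral_const_mul]
    refine intervalIntegral.integral_mono_on ht1 (Continuous.intervalIntegrable (by fun_prop) _ _)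
      (Continuous.intervalIntegrable (by fun_prop) _ _) fun θ hθ => ?_
    exact mul_le_mul_of_nonneg_right (hDr θ ⟨hθ.1, hθ.2.trans ht2⟩) (by positivity)
  have hbd := (abs_le.1 (hB η η' hηd hη'c
    (by rw [(hleft _ (by linarith)).1, (hright _ (by linarith)).1])
    (by rw [(hleft _ (by linarith)).2, (hright _ (by linarith)).2]))).1
  rw [hBval, intervalIntegral.integral_sub (Continuous.intervalIntegrable (by fun_prop) _ _)
      (Continuous.intervalIntegrable (by fun_prop) _ _),
    intervalIntegral.integral_add (Continuous.intervalIntegrable (by fun_prop) _ _)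
      (Continuous.intervalIntegrable (by fun_prop) _ _),
    intervalIntegral.integral_sub (Continuous.intervalIntegrable (by fun_prop) _ _)
      (Continuous.intervalIntegrable (by fun_prop) _ _),
    intervalIntegral.integral_const_mul, intervalIntegral.integral_const_mul,
    intervalIntegral.integral_const_mul, intervalIntegral.integral_const_mul, hcint, ← hZ,
    hηint] at hbd
  have hsq : √(4 * Real.pi * ∫ θ in (-Real.pi)..Real.pi, η' θ ^ 2) ≤
      Z * √(32 * Real.pi * r) := by
    apply Real.sqrt_le_iff.2
    refine ⟨by positivity, ?_⟩
    rw [mul_pow, Real.sq_sqrt (by positivity)]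
    nlinarith
  have hmean : |(∫ θ in (-r)..t, ψ θ ^ 2) / (2 * Real.pi)| ≤ Z * r ^ 2 := by
    rw [abs_of_nonneg (by positivity), div_le_iff₀ (by positivity)]
    have : 0 ≤ Z * r ^ 2 := by positivity
    nlinarith
  have h1 := mul_le_mul_of_nonneg_left (add_le_add hmean hsq) hM
  have h2 := mul_le_mul_of_nonneg_right hsmall hZ0
  have h3 : 4 * k ^ 2 * (Real.pi / k / 2) < D₁ * (Real.pi / k / 2) :=
    mul_lt_mul_of_pos_right hD₁ (by positivity)
  nlinarith

theorem norm_circ_sub {p : ℂ} (hp : ‖p‖ = 1) (x y : ℝ) :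
    ‖circ p x - circ p y‖ = |2 * Real.sin ((x - y) / 2)| := by
  have h : circ p x - circ p y =
      circ p y * (Complex.exp (Complex.I * ((x - y : ℝ) : ℂ)) - 1) := by
    simp only [circ, mul_sub, mul_assoc, ← Complex.exp_add]
    push_cast
    ring_nf
  rw [h, norm_mul, norm_circ hp, one_mul, Complex.norm_exp_I_mul_ofReal_sub_one, Real.norm_eq_abs]

theorem norm_circ_sub_le {p : ℂ} (hp : ‖p‖ = 1) (x y : ℝ) :
    ‖circ p x - circ p y‖ ≤ |x - y| := by
  rw [norm_circ_sub hp, abs_mul, abs_two]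
  have := Real.abs_sin_le_abs (x := (x - y) / 2)
  rw [abs_div, abs_two] at this
  linarith

theorem abs_sub_le_norm_circ {p : ℂ} (hp : ‖p‖ = 1) {x y : ℝ} (h : |x - y| ≤ Real.pi) :
    2 / Real.pi * |x - y| ≤ ‖circ p x - circ p y‖ := by
  have h1 : |(x - y) / 2| ≤ Real.pi / 2 := by
    rw [abs_div, abs_two]; linarith
  have := Real.mul_abs_le_abs_sin h1
  rw [norm_circ_sub hp, abs_mul, abs_two]
  rw [abs_div, abs_two] at this
  linarith

theorem arcMeasure_circle_lt_top : arcMeasure unitCircle < ⊤ := by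
  have hL : LipschitzWith 1 (circ 1) := LipschitzWith.of_dist_le_mul fun x y => by
    rw [dist_eq_norm, Real.dist_eq, NNReal.coe_one, one_mul]
    exact norm_circ_sub_le (by simp) x y
  have h1 : unitCircle ⊆ circ 1 '' Set.Icc (-Real.pi) Real.pi := by
    intro z hz
    obtain ⟨t, ht, rfl⟩ := circ_surj (p := 1) (by simp) (show ‖z‖ = 1 by simpa [unitCircle] using hz)
    exact ⟨t, ⟨ht.1.le, ht.2⟩, rfl⟩
  refine (measure_mono h1).trans_lt
    ((hL.hausdorffMeasure_image_le zero_le_one _).trans_lt ?_)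
  rw [hausdorffMeasure_real, Real.volume_Icc]
  simp

theorem volume_preimage_circ_le {p : ℂ} (hp : ‖p‖ = 1) {a b : ℝ} (hab : b - a ≤ Real.pi)
    (A : Set ℂ) :
    volume (Set.Icc a b ∩ circ p ⁻¹' A) ≤ ENNReal.ofReal (Real.pi / 2) *
      arcMeasure (A ∩ unitCircle) := by
  have hpi := Real.pi_pos
  set f : Set.Icc a b → ℂ := fun x => circ p x with hf
  have hA : AntilipschitzWith (Real.toNNReal (Real.pi / 2)) f :=
    AntilipschitzWith.of_le_mul_dist fun x y => by
      rw [Real.coe_toNNReal _ (by positivity), dist_eq_norm, Subtype.dist_eq, Real.dist_eq]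
      have h1 : |(x : ℝ) - y| ≤ Real.pi := by
        rw [abs_le]; constructor <;> linarith [x.2.1, x.2.2, y.2.1, y.2.2]
      have h2 := abs_sub_le_norm_circ hp h1
      calc |(x : ℝ) - y| = Real.pi / 2 * (2 / Real.pi * |(x : ℝ) - y|) := by field_simp
        _ ≤ _ := mul_le_mul_of_nonneg_left h2 (by positivity)
  have h1 := hA.le_hausdorffMeasure_image zero_le_one (f ⁻¹' A)
  have h2 : (Subtype.val : Set.Icc a b → ℝ) '' (f ⁻¹' A) = Set.Icc a b ∩ circ p ⁻¹' A := by
    ext x; simp [hf, and_comm]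
  rw [← (isometry_subtype_coe (s := Set.Icc a b)).hausdorffMeasure_image (Or.inl zero_le_one), h2,
    hausdorffMeasure_real, ENNReal.rpow_one] at h1
  refine h1.trans (mul_le_mul_right (measure_mono ?_) _)
  rintro _ ⟨x, hx, rfl⟩
  exact ⟨hx, circ_mem hp x⟩

theorem integral_circ_le_arc {p : ℂ} (hp : ‖p‖ = 1) {f : ℂ → ℝ} (hf : Continuous f)
    (h0 : ∀ z, 0 ≤ f z) :
    ∫ θ in (-Real.pi)..Real.pi, f (circ p θ) ≤
      Real.pi * ∫ z in unitCircle, f z ∂arcMeasure := by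
  have hpi := Real.pi_pos
  have hc := continuous_circ p
  set ν : Measure ℂ := Measure.map (circ p) (volume.restrict (Set.Ioc (-Real.pi) Real.pi)) with hν
  have hle : ν ≤ ENNReal.ofReal Real.pi • arcMeasure.restrict unitCircle := by
    refine Measure.le_iff.2 fun A hA => ?_
    rw [hν, Measure.map_apply hc.measurable hA, Measure.restrict_apply (hc.measurable hA),
      Measure.smul_apply, Measure.restrict_apply hA, smul_eq_mul]
    have h1 : circ p ⁻¹' A ∩ Set.Ioc (-Real.pi) Real.pi ⊆
        (Set.Icc (-Real.pi) 0 ∩ circ p ⁻¹' A) ∪ (Set.Icc 0 Real.pi ∩ circ p ⁻¹' A) := by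
      rintro x ⟨hx, hx1, hx2⟩
      rcases le_total x 0 with h | h
      · exact Or.inl ⟨⟨hx1.le, h⟩, hx⟩
      · exact Or.inr ⟨⟨h, hx2⟩, hx⟩
    refine (measure_mono h1).trans ((measure_union_le _ _).trans
      ((add_le_add (volume_preimage_circ_le hp (by linarith) A)
        (volume_preimage_circ_le hp (by linarith) A)).trans ?_))
    rw [← add_mul, ← ENNReal.ofReal_add (by positivity) (by positivity), add_halves]
  have h_int : Integrable f (arcMeasure.restrict unitCircle) := by
    have : IsFiniteMeasure (arcMeasure.restrict unitCircle) :=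
      ⟨by rw [Measure.restrict_apply_univ]; exact arcMeasure_circle_lt_top⟩
    obtain ⟨B, hB⟩ := (isCompact_sphere (0 : ℂ) 1).exists_bound_of_continuousOn hf.continuousOn
    refine Integrable.of_bound hf.aestronglyMeasurable B ?_
    exact (ae_restrict_iff' Metric.isClosed_sphere.measurableSet).2
      (Eventually.of_forall fun z hz => hB z hz)
  have h1 := integral_mono_measure hle (Eventually.of_forall h0)
    (h_int.smul_measure ENNReal.ofReal_ne_top)
  rw [integral_smul_measure, ENNReal.toReal_ofReal hpi.le, smul_eq_mul, hν,
    integral_map hc.aemeasurable hf.aestronglyMeasurable] at h1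
  rwa [intervalIntegral.integral_of_le (by linarith)]

/-- Integrals against a family of densities concentrating at a point. -/
theorem tendsto_concentrate {X : Type*} [PseudoMetricSpace X] [MeasurableSpace X] {μ : Measure X}
    {S : Set X} (hS : MeasurableSet S) (hSf : μ S ≠ ⊤) {p : X} {w a : ℕ → X → ℝ} {a₀ A B : ℝ}
    (hw : ∀ n x, 0 ≤ w n x) (hwi : ∀ n, IntegrableOn (w n) S μ)
    (hA : ∀ n, ∫ x in S, w n x ∂μ ≤ A)
    (hoff : ∀ r > 0, ∀ ε > 0, ∀ᶠ n in atTop, ∀ x ∈ S, r ≤ dist x p → w n x ≤ ε)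
    (ha : ∀ ε > 0, ∃ r > 0, ∀ᶠ n in atTop, ∀ x ∈ S, dist x p < r → |a n x - a₀| ≤ ε)
    (hB : ∀ᶠ n in atTop, ∀ x ∈ S, |a n x| ≤ B)
    (hai : ∀ n, IntegrableOn (fun x => a n x * w n x) S μ) :
    Tendsto (fun n => (∫ x in S, a n x * w n x ∂μ) - a₀ * ∫ x in S, w n x ∂μ) atTop (nhds 0) := by
  rw [Metric.tendsto_nhds]
  intro ε hε
  set m := (μ S).toReal with hm
  have hm0 : 0 ≤ m := ENNReal.toReal_nonneg
  set B' := |B| + |a₀| with hB'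
  have hB0 : 0 ≤ B' := by positivity
  set ε₁ := ε / (4 * (|A| + 1)) with hε₁
  set ε₂ := ε / (4 * (B' + 1) * (m + 1)) with hε₂
  have h1pos : 0 < ε₁ := by positivity
  have h2pos : 0 < ε₂ := by positivity
  obtain ⟨r, hr, har⟩ := ha ε₁ h1pos
  filter_upwards [har, hB, hoff r hr ε₂ h2pos] with n h1 h2 h3
  have hsplit : (∫ x in S, a n x * w n x ∂μ) - a₀ * ∫ x in S, w n x ∂μ =
      ∫ x in S, (a n x - a₀) * w n x ∂μ := by
    rw [← integral_const_mul, ← integral_sub (hai n) ((hwi n).const_mul _)]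
    simp only [sub_mul]
  have hci : IntegrableOn (fun _ : X => B' * ε₂) S μ := integrableOn_const hSf
  have hbd : ‖∫ x in S, (a n x - a₀) * w n x ∂μ‖ ≤ ∫ x in S, (ε₁ * w n x + B' * ε₂) ∂μ := by
    refine norm_integral_le_of_norm_le (((hwi n).const_mul _).add hci) ?_
    refine (ae_restrict_iff' hS).2 (Eventually.of_forall fun x hx => ?_)
    rw [norm_mul, Real.norm_eq_abs, Real.norm_of_nonneg (hw n x)]
    have hw0 := hw n x
    rcases lt_or_ge (dist x p) r with h | h
    · have := mul_le_mul_of_nonneg_right (h1 x hx h) hw0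
      have : 0 ≤ B' * ε₂ := by positivity
      linarith
    · have h4 : |a n x - a₀| ≤ B' := by
        refine (abs_sub _ _).trans ?_
        have := (h2 x hx).trans (le_abs_self B)
        linarith
      have h5 := mul_le_mul h4 (h3 x hx h) hw0 hB0
      have : 0 ≤ ε₁ * w n x := by positivity
      linarith
  rw [integral_add ((hwi n).const_mul _) hci, integral_const_mul, setIntegral_const,
    smul_eq_mul] at hbd
  rw [hsplit, dist_zero_right]
  have e1 : ε₁ * ∫ x in S, w n x ∂μ ≤ ε / 4 := by
    calc ε₁ * ∫ x in S, w n x ∂μ ≤ ε₁ * (|A| + 1) :=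
          mul_le_mul_of_nonneg_left (by linarith [hA n, le_abs_self A]) h1pos.le
      _ = ε / 4 := by rw [hε₁]; field_simp
  have e2 : m * (B' * ε₂) ≤ ε / 4 := by
    calc m * (B' * ε₂) ≤ (m + 1) * ((B' + 1) * ε₂) := by gcongr <;> linarith
      _ = ε / 4 := by rw [hε₂]; field_simp
  have e3 : μ.real S = m := rfl
  rw [e3] at hbd
  linarith

theorem bInt_circ_le {u K h : ℂ → ℝ} (hu : ContDiff ℝ 2 u) (hK : ContDiff ℝ 1 K)
    (hh : ContDiff ℝ 1 h) (hs : SolvesLiouville K h u) {L : ℝ}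
    (hKx : ∀ z ∈ unitClosedDisk, |dirDeriv 1 K z| ≤ L)
    (hKy : ∀ z ∈ unitClosedDisk, |dirDeriv Complex.I K z| ≤ L)
    (hht : ∀ z ∈ unitCircle, |tangentialDeriv h z| ≤ L)
    {F : ℂ → ℂ} (hF : Differentiable ℂ F) {p : ℂ} (hp : ‖p‖ = 1) :
    |bInt (fun θ => u (circ p θ)) (fun θ => tangentialDeriv u (circ p θ))
        (fun θ => h (circ p θ) ^ 2 + K (circ p θ)) (fun θ => (F (circ p θ)).re)
        (fun θ => -(circ p θ * deriv F (circ p θ)).im)| ≤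
      4 * L * ((∫ θ in (-Real.pi)..Real.pi, ‖F (circ p θ)‖ * Real.exp (u (circ p θ) / 2)) +
        ∫ z in unitDisk, ‖F z‖ * Real.exp (u z)) := by
  have hpi := Real.pi_pos
  have hP := pohozaev hu hK hh hs hF hp
  have hc := continuous_circ p
  have hFc : Continuous F := hF.continuous
  have hF'c : Continuous (deriv F) := hF.deriv.continuous
  have hu1 : ContDiff ℝ 1 u := hu.of_le (by norm_num)
  have huc := hu1.continuous
  have hKc := hK.continuous
  have hhc := hh.continuous
  have hutc := continuous_tangentialDeriv hu1
  have hhtc := continuous_tangentialDeriv hh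
  have hKxc := continuous_dirDeriv hK 1
  have hKyc := continuous_dirDeriv hK Complex.I
  set R : ℝ → ℝ := fun θ => tangentialDeriv h (circ p θ) *
    ((F (circ p θ)).im * Real.exp (u (circ p θ) / 2)) with hR
  have hRc : Continuous R := by simp only [hR]; fun_prop
  set B := bInt (fun θ => u (circ p θ)) (fun θ => tangentialDeriv u (circ p θ))
    (fun θ => h (circ p θ) ^ 2 + K (circ p θ)) (fun θ => (F (circ p θ)).re)
    (fun θ => -(circ p θ * deriv F (circ p θ)).im) with hB
  have h1 : B = -4 * (∫ θ in (-Real.pi)..Real.pi, R θ) - 2 * ∫ z in unitDisk, Real.exp (u z) *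
      (dirDeriv 1 K z * (z * F z).re + dirDeriv Complex.I K z * (z * F z).im) := by
    rw [← hP, hB, bInt, ← intervalIntegral.integral_const_mul,
      ← intervalIntegral.integral_sub (hRc.const_mul _ |>.intervalIntegrable _ _)
        (Continuous.intervalIntegrable (by fun_prop) _ _)]
    refine intervalIntegral.integral_congr fun θ _ => ?_
    simp only [hR]; ring
  have h2 : |∫ θ in (-Real.pi)..Real.pi, R θ| ≤
      L * ∫ θ in (-Real.pi)..Real.pi, ‖F (circ p θ)‖ * Real.exp (u (circ p θ) / 2) := by
    rw [← intervalIntegral.integral_const_mul, ← Real.norm_eq_abs]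
    refine intervalIntegral.norm_integral_le_of_norm_le (by linarith)
      (Eventually.of_forall fun θ _ => ?_) (Continuous.intervalIntegrable (by fun_prop) _ _)
    rw [hR, Real.norm_eq_abs, abs_mul, abs_mul, Real.abs_exp]
    have := hht _ (circ_mem hp θ)
    gcongr
    · exact (abs_nonneg _).trans this
    · exact Complex.abs_im_le_norm _
  have h_int : ∀ g : ℂ → ℝ, Continuous g → IntegrableOn g unitDisk := fun g hg =>
    (hg.continuousOn.integrableOn_compact (isCompact_closedBall (0 : ℂ) 1)).mono_set
      Metric.ball_subset_closedBall
  have h3 : |∫ z in unitDisk, Real.exp (u z) *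
      (dirDeriv 1 K z * (z * F z).re + dirDeriv Complex.I K z * (z * F z).im)| ≤
      2 * L * ∫ z in unitDisk, ‖F z‖ * Real.exp (u z) := by
    rw [← integral_const_mul, ← Real.norm_eq_abs]
    refine norm_integral_le_of_norm_le (h_int _ (by fun_prop)) ?_
    refine (ae_restrict_iff' Metric.isOpen_ball.measurableSet).2 (Eventually.of_forall fun z hz => ?_)
    have hz' : z ∈ unitClosedDisk := Metric.ball_subset_closedBall hz
    have hz1 : ‖z‖ ≤ 1 := by simpa [unitClosedDisk] using hz'
    have hzF : ‖z * F z‖ ≤ ‖F z‖ := by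
      rw [norm_mul]; exact mul_le_of_le_one_left (norm_nonneg _) hz1
    have a1 := hKx z hz'
    have a2 := hKy z hz'
    have a3 : |dirDeriv 1 K z * (z * F z).re| ≤ L * ‖F z‖ := by
      rw [abs_mul]
      exact mul_le_mul a1 ((Complex.abs_re_le_norm _).trans hzF) (abs_nonneg _)
        ((abs_nonneg _).trans a1)
    have a4 : |dirDeriv Complex.I K z * (z * F z).im| ≤ L * ‖F z‖ := by
      rw [abs_mul]
      exact mul_le_mul a2 ((Complex.abs_im_le_norm _).trans hzF) (abs_nonneg _)
        ((abs_nonneg _).trans a2)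
    rw [norm_mul, Real.norm_eq_abs, Real.norm_eq_abs, Real.abs_exp]
    calc Real.exp (u z) * |dirDeriv 1 K z * (z * F z).re + dirDeriv Complex.I K z * (z * F z).im|
        ≤ Real.exp (u z) * (L * ‖F z‖ + L * ‖F z‖) := by
          gcongr
          exact (abs_add_le _ _).trans (add_le_add a3 a4)
      _ = 2 * L * (‖F z‖ * Real.exp (u z)) := by ring
  rw [h1]
  rw [abs_le] at h2 h3 ⊢
  constructor <;> linarith [h2.1, h2.2, h3.1, h3.2]

/-- A family of solutions with bounded mass whose densities concentrate at `p`. -/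
structure ConcentratingFamily (u Kn hn : ℕ → ℂ → ℝ) (K h : ℂ → ℝ) (p : ℂ) (A L : ℝ) : Prop where
  contDiff_u : ∀ n, ContDiff ℝ 2 (u n)
  contDiff_Kn : ∀ n, ContDiff ℝ 1 (Kn n)
  contDiff_hn : ∀ n, ContDiff ℝ 1 (hn n)
  contDiff_K : ContDiff ℝ 1 K
  contDiff_h : ContDiff ℝ 1 h
  solves : ∀ n, SolvesLiouville (Kn n) (hn n) (u n)
  norm_p : ‖p‖ = 1
  area_le : ∀ n, ∫ z in unitDisk, Real.exp (u n z) ≤ A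
  length_le : ∀ n, ∫ θ in (-Real.pi)..Real.pi, Real.exp (u n (circ p θ) / 2) ≤ A
  bot : TendstoLocallyUniformlyBotOn u (unitClosedDisk \ {p})
  unif_K : TendstoUniformlyOn Kn K atTop unitClosedDisk
  unif_h : TendstoUniformlyOn hn h atTop unitCircle
  unif_Kx : TendstoUniformlyOn (fun n => dirDeriv 1 (Kn n)) (dirDeriv 1 K) atTop unitClosedDisk
  unif_Ky : TendstoUniformlyOn (fun n => dirDeriv Complex.I (Kn n)) (dirDeriv Complex.I K) atTop
    unitClosedDisk
  unif_ht : TendstoUniformlyOn (fun n => tangentialDeriv (hn n)) (tangentialDeriv h) atTop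
    unitCircle
  bounds : ∀ᶠ n in atTop, (∀ z ∈ unitClosedDisk, |Kn n z| ≤ L ∧ |dirDeriv 1 (Kn n) z| ≤ L ∧
    |dirDeriv Complex.I (Kn n) z| ≤ L) ∧
    ∀ z ∈ unitCircle, |hn n z| ≤ L ∧ |tangentialDeriv (hn n) z| ≤ L

theorem integrableOn_unitDisk {g : ℂ → ℝ} (hg : Continuous g) : IntegrableOn g unitDisk :=
  (hg.continuousOn.integrableOn_compact (isCompact_closedBall (0 : ℂ) 1)).mono_set
    Metric.ball_subset_closedBall

namespace ConcentratingFamily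

variable {u Kn hn : ℕ → ℂ → ℝ} {K h : ℂ → ℝ} {p : ℂ} {A L : ℝ}

theorem eventually_exp_le (H : ConcentratingFamily u Kn hn K h p A L) {c : ℝ} (hc : 0 < c) {r : ℝ}
    (hr : 0 < r) {ε : ℝ} (hε : 0 < ε) :
    ∀ᶠ n in atTop, ∀ z ∈ unitClosedDisk, r ≤ dist z p → Real.exp (c * u n z) ≤ ε := by
  have hcomp : IsCompact (unitClosedDisk \ Metric.ball p r) :=
    (isCompact_closedBall (0 : ℂ) 1).diff Metric.isOpen_ball
  have hsub : unitClosedDisk \ Metric.ball p r ⊆ unitClosedDisk \ {p} := by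
    rintro z ⟨hz, hzr⟩
    refine ⟨hz, ?_⟩
    rintro rfl
    exact hzr (Metric.mem_ball_self hr)
  filter_upwards [H.bot (Real.log ε / c) _ hcomp hsub] with n hn z hz hzr
  have h1 := hn z ⟨hz, by simpa using hzr⟩
  rw [lt_div_iff₀ hc] at h1
  rw [← Real.exp_log hε]
  exact Real.exp_le_exp.2 (by linarith)

theorem tendsto_disk (H : ConcentratingFamily u Kn hn K h p A L) {a : ℕ → ℂ → ℝ} {a₀ : ℂ → ℝ}
    (ha : ∀ n, Continuous (a n)) (ha₀ : Continuous a₀)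
    (hu : TendstoUniformlyOn a a₀ atTop unitClosedDisk) :
    Tendsto (fun n => (∫ z in unitDisk, a n z * Real.exp (u n z)) -
      a₀ p * ∫ z in unitDisk, Real.exp (u n z)) atTop (nhds 0) := by
  have huc : ∀ n, Continuous (u n) := fun n => (H.contDiff_u n).continuous
  obtain ⟨B, hB⟩ := (isCompact_closedBall (0 : ℂ) 1).exists_bound_of_continuousOn
    ha₀.continuousOn
  have hsub : unitDisk ⊆ unitClosedDisk := Metric.ball_subset_closedBall
  refine tendsto_concentrate (p := p) (B := B + 1) (A := A) Metric.isOpen_ball.measurableSet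
    measure_ball_lt_top.ne (fun n x => (Real.exp_pos _).le)
    (fun n => integrableOn_unitDisk (huc n).rexp) H.area_le
    (fun r hr ε hε => ?_) (fun ε hε => ?_) ?_
    (fun n => integrableOn_unitDisk ((ha n).mul (huc n).rexp))
  · filter_upwards [H.eventually_exp_le one_pos hr hε] with n hn x hx hxr
    simpa using hn x (hsub hx) hxr
  · obtain ⟨r, hr, hr'⟩ := Metric.continuousAt_iff.1 (ha₀.continuousAt (x := p)) (ε / 2) (half_pos hε)
    refine ⟨r, hr, ?_⟩
    filter_upwards [Metric.tendstoUniformlyOn_iff.1 hu (ε / 2) (half_pos hε)] with n hn x hx hxr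
    have h1 := hn x (hsub hx)
    have h2 := hr' hxr
    rw [dist_comm] at h1
    have := dist_triangle (a n x) (a₀ x) (a₀ p)
    rw [Real.dist_eq] at this
    linarith
  · filter_upwards [Metric.tendstoUniformlyOn_iff.1 hu 1 one_pos] with n hn x hx
    have h1 := hn x (hsub hx)
    have h2 := hB x (hsub hx)
    rw [Real.dist_eq, abs_sub_comm] at h1
    rw [Real.norm_eq_abs] at h2
    have := abs_sub_abs_le_abs_sub (a n x) (a₀ x)
    linarith

theorem tendsto_circle (H : ConcentratingFamily u Kn hn K h p A L) {a : ℕ → ℂ → ℝ} {a₀ : ℂ → ℝ}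
    (ha : ∀ n, Continuous (a n)) (ha₀ : Continuous a₀)
    (hu : TendstoUniformlyOn a a₀ atTop unitCircle) :
    Tendsto (fun n => (∫ θ in (-Real.pi)..Real.pi, a n (circ p θ) * Real.exp (u n (circ p θ) / 2)) -
      a₀ p * ∫ θ in (-Real.pi)..Real.pi, Real.exp (u n (circ p θ) / 2)) atTop (nhds 0) := by
  have hpi := Real.pi_pos
  have hpp : -Real.pi ≤ Real.pi := by linarith
  have hc := continuous_circ p
  have huc : ∀ n, Continuous (u n) := fun n => (H.contDiff_u n).continuous
  obtain ⟨B, hB⟩ := (isCompact_sphere (0 : ℂ) 1).exists_bound_of_continuousOn ha₀.continuousOn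
  have hI : ∀ g : ℝ → ℝ, Continuous g → IntegrableOn g (Set.Ioc (-Real.pi) Real.pi) := fun g hg =>
    (intervalIntegrable_iff_integrableOn_Ioc_of_le hpp).1 (hg.intervalIntegrable _ _)
  have hlen := H.length_le
  simp only [intervalIntegral.integral_of_le hpp] at hlen ⊢
  have hcp : circ p 0 = p := by simp [circ]
  refine tendsto_concentrate (p := 0) (B := B + 1) (A := A)
    (a := fun n θ => a n (circ p θ)) (w := fun n θ => Real.exp (u n (circ p θ) / 2))
    measurableSet_Ioc (by simp) (fun n x => (Real.exp_pos _).le)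
    (fun n => hI _ (by have := huc n; fun_prop)) hlen
    (fun r hr ε hε => ?_) (fun ε hε => ?_) ?_
    (fun n => hI _ (by have := huc n; have := ha n; fun_prop))
  · filter_upwards [H.eventually_exp_le (c := 1 / 2) (by norm_num)
      (show 0 < 2 / Real.pi * r by positivity) hε] with n hn x hx hxr
    have h1 := hn (circ p x) (circ_mem_closed H.norm_p x) (by
      rw [dist_zero_right, Real.norm_eq_abs] at hxr
      have h2 := abs_sub_le_norm_circ H.norm_p (x := x) (y := 0)
        (by rw [sub_zero, abs_le]; exact ⟨hx.1.le, hx.2⟩)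
      rw [hcp, sub_zero] at h2
      rw [dist_eq_norm]
      exact (mul_le_mul_of_nonneg_left hxr (by positivity)).trans h2)
    rwa [one_div_mul_eq_div] at h1
  · obtain ⟨r, hr, hr'⟩ := Metric.continuousAt_iff.1 (ha₀.continuousAt (x := p)) (ε / 2) (half_pos hε)
    refine ⟨r, hr, ?_⟩
    filter_upwards [Metric.tendstoUniformlyOn_iff.1 hu (ε / 2) (half_pos hε)] with n hn x hx hxr
    have h1 := hn _ (circ_mem H.norm_p x)
    have h2 := hr' (x := circ p x) (by
      have h3 := norm_circ_sub_le H.norm_p x 0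
      rw [hcp, sub_zero] at h3
      rw [dist_zero_right, Real.norm_eq_abs] at hxr
      rw [dist_eq_norm]; linarith)
    rw [dist_comm] at h1
    have := dist_triangle (a n (circ p x)) (a₀ (circ p x)) (a₀ p)
    rw [Real.dist_eq] at this
    linarith
  · filter_upwards [Metric.tendstoUniformlyOn_iff.1 hu 1 one_pos] with n hn x hx
    have h1 := hn _ (circ_mem H.norm_p x)
    have h2 := hB _ (circ_mem H.norm_p x)
    rw [Real.dist_eq, abs_sub_comm] at h1
    rw [Real.norm_eq_abs] at h2
    have := abs_sub_abs_le_abs_sub (a n (circ p x)) (a₀ (circ p x))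
    linarith

end ConcentratingFamily

theorem differentiable_affine (a b : ℂ) : Differentiable ℂ fun z : ℂ => a + b * z := by fun_prop

theorem deriv_affine (a b z : ℂ) : deriv (fun z : ℂ => a + b * z) z = b := by
  have : HasDerivAt (fun z : ℂ => a + b * z) b z := by
    simpa using ((hasDerivAt_id z).const_mul b).const_add a
  exact this.deriv

theorem conj_mul_circ {p : ℂ} (hp : ‖p‖ = 1) (θ : ℝ) :
    (starRingEnd ℂ) p * circ p θ = Complex.exp (θ * Complex.I) := by
  rw [circ, ← mul_assoc, ← Complex.normSq_eq_conj_mul_self, Complex.normSq_eq_norm_sq, hp]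
  simp

namespace ConcentratingFamily

variable {u Kn hn : ℕ → ℂ → ℝ} {K h : ℂ → ℝ} {p : ℂ} {A L : ℝ}

theorem A_nonneg (H : ConcentratingFamily u Kn hn K h p A L) : 0 ≤ A :=
  (integral_nonneg fun _ => (Real.exp_pos _).le).trans (H.area_le 0)

theorem L_nonneg (H : ConcentratingFamily u Kn hn K h p A L) : 0 ≤ L := by
  obtain ⟨n, -, hn⟩ := H.bounds.exists
  exact (abs_nonneg _).trans (hn p (by simp [unitCircle, H.norm_p])).1

theorem bInt_le (H : ConcentratingFamily u Kn hn K h p A L) :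
    ∀ᶠ n in atTop, ∀ q : ℂ, ‖q‖ = 1 → ∀ F : ℂ → ℂ, Differentiable ℂ F → ∀ S : ℝ,
      (∀ z ∈ unitClosedDisk, ‖F z‖ ≤ S) →
      |bInt (fun θ => u n (circ q θ)) (fun θ => tangentialDeriv (u n) (circ q θ))
        (fun θ => hn n (circ q θ) ^ 2 + Kn n (circ q θ)) (fun θ => (F (circ q θ)).re)
        (fun θ => -(circ q θ * deriv F (circ q θ)).im)| ≤ 8 * L * A * S := by
  filter_upwards [H.bounds] with n hb q hq F hF S hS
  have hpi := Real.pi_pos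
  have huc := (H.contDiff_u n).continuous
  have hFc := hF.continuous
  have hc := continuous_circ q
  have hL := H.L_nonneg
  have hS0 : 0 ≤ S := (norm_nonneg _).trans (hS 0 (by simp [unitClosedDisk]))
  refine (bInt_circ_le (H.contDiff_u n) (H.contDiff_Kn n) (H.contDiff_hn n) (H.solves n)
    (fun z hz => (hb.1 z hz).2.1) (fun z hz => (hb.1 z hz).2.2) (fun z hz => (hb.2 z hz).2)
    hF hq).trans ?_
  have h1 : ∫ θ in (-Real.pi)..Real.pi, ‖F (circ q θ)‖ * Real.exp (u n (circ q θ) / 2) ≤ S * A := by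
    refine le_trans ?_ (mul_le_mul_of_nonneg_left (H.length_le n) hS0)
    rw [integral_circ_eq H.norm_p hq (fun z => Real.exp (u n z / 2)),
      ← intervalIntegral.integral_const_mul]
    refine intervalIntegral.integral_mono_on (by linarith)
      (Continuous.intervalIntegrable (by fun_prop) _ _)
      (Continuous.intervalIntegrable (by fun_prop) _ _) fun θ _ => ?_
    exact mul_le_mul_of_nonneg_right (hS _ (circ_mem_closed hq θ)) (Real.exp_pos _).le
  have h2 : ∫ z in unitDisk, ‖F z‖ * Real.exp (u n z) ≤ S * A := by
    refine le_trans ?_ (mul_le_mul_of_nonneg_left (H.area_le n) hS0)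
    rw [← integral_const_mul]
    refine setIntegral_mono_on (integrableOn_unitDisk (by fun_prop))
      (integrableOn_unitDisk (by fun_prop)) Metric.isOpen_ball.measurableSet fun z hz => ?_
    exact mul_le_mul_of_nonneg_right (hS _ (Metric.ball_subset_closedBall hz)) (Real.exp_pos _).le
  calc _ ≤ 4 * L * (S * A + S * A) := by gcongr
    _ = _ := by ring

theorem bInt_le_at (H : ConcentratingFamily u Kn hn K h p A L) {F : ℂ → ℂ}
    (hF : Differentiable ℂ F) {ε : ℝ} (hε : 0 < ε) :
    ∀ᶠ n in atTop,
      |bInt (fun θ => u n (circ p θ)) (fun θ => tangentialDeriv (u n) (circ p θ))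
        (fun θ => hn n (circ p θ) ^ 2 + Kn n (circ p θ)) (fun θ => (F (circ p θ)).re)
        (fun θ => -(circ p θ * deriv F (circ p θ)).im)| ≤ 8 * L * A * ‖F p‖ + ε := by
  have hL := H.L_nonneg
  have hnc : Continuous fun z => ‖F z‖ := hF.continuous.norm
  have hconst : ∀ s : Set ℂ, TendstoUniformlyOn (fun (_ : ℕ) z => ‖F z‖) (fun z => ‖F z‖) atTop s :=
    fun s => Metric.tendstoUniformlyOn_iff.2 fun ε hε =>
      Eventually.of_forall fun n x _ => by simpa using hε
  have hδ : 0 < ε / (8 * L + 1) := by positivity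
  filter_upwards [H.bounds, (H.tendsto_disk (fun _ => hnc) hnc (hconst _)).eventually_lt_const hδ,
    (H.tendsto_circle (fun _ => hnc) hnc (hconst _)).eventually_lt_const hδ] with n hb h1 h2
  refine (bInt_circ_le (H.contDiff_u n) (H.contDiff_Kn n) (H.contDiff_hn n) (H.solves n)
    (fun z hz => (hb.1 z hz).2.1) (fun z hz => (hb.1 z hz).2.2) (fun z hz => (hb.2 z hz).2)
    hF H.norm_p).trans ?_
  have h3 := mul_le_mul_of_nonneg_left (H.length_le n) (norm_nonneg (F p))
  have h4 := mul_le_mul_of_nonneg_left (H.area_le n) (norm_nonneg (F p))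
  set δ := ε / (8 * L + 1)
  have h5 : 8 * L * δ ≤ ε := by
    have : (8 * L + 1) * δ = ε := by simp only [δ]; field_simp
    linarith
  calc _ ≤ 4 * L * ((‖F p‖ * A + δ) + (‖F p‖ * A + δ)) := by
        gcongr <;> linarith
    _ ≤ _ := by linarith

theorem abs_D_le {n : ℕ}
    (hb : (∀ z ∈ unitClosedDisk, |Kn n z| ≤ L ∧ |dirDeriv 1 (Kn n) z| ≤ L ∧
      |dirDeriv Complex.I (Kn n) z| ≤ L) ∧
      ∀ z ∈ unitCircle, |hn n z| ≤ L ∧ |tangentialDeriv (hn n) z| ≤ L) {q : ℂ} (hq : ‖q‖ = 1)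
    (θ : ℝ) : |hn n (circ q θ) ^ 2 + Kn n (circ q θ)| ≤ L ^ 2 + L := by
  refine (abs_add_le _ _).trans (add_le_add ?_ (hb.1 _ (circ_mem_closed hq θ)).1)
  rw [abs_pow]
  exact pow_le_pow_left₀ (abs_nonneg _) (hb.2 _ (circ_mem hq θ)).1 2

theorem circle_max (H : ConcentratingFamily u Kn hn K h p A L) (n : ℕ) :
    ∃ q : ℂ, ‖q‖ = 1 ∧ ∀ z ∈ unitCircle, u n z ≤ u n q := by
  obtain ⟨q, hq, hmax⟩ := (isCompact_sphere (0 : ℂ) 1).exists_isMaxOn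
    ⟨1, by simp⟩ (H.contDiff_u n).continuous.continuousOn
  exact ⟨q, by simpa using hq, hmax⟩

/-- The weighted curvature integral along the circle is controlled by the maximum. -/
theorem integral_D_exp_le (H : ConcentratingFamily u Kn hn K h p A L) {n : ℕ}
    (hb : (∀ z ∈ unitClosedDisk, |Kn n z| ≤ L ∧ |dirDeriv 1 (Kn n) z| ≤ L ∧
      |dirDeriv Complex.I (Kn n) z| ≤ L) ∧
      ∀ z ∈ unitCircle, |hn n z| ≤ L ∧ |tangentialDeriv (hn n) z| ≤ L)
    {q c : ℂ} (hmax : ∀ z ∈ unitCircle, u n z ≤ u n q) (hc : ‖c‖ = 1) {η : ℝ → ℝ}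
    (hη : Continuous η) {S : ℝ} (h0 : ∀ θ, 0 ≤ η θ) (h1 : ∀ θ, η θ ≤ S) :
    ∫ θ in (-Real.pi)..Real.pi, (hn n (circ c θ) ^ 2 + Kn n (circ c θ)) *
      Real.exp (u n (circ c θ)) * η θ ≤ (L ^ 2 + L) * S * Real.exp (u n q / 2) *
        ∫ θ in (-Real.pi)..Real.pi, Real.exp (u n (circ p θ) / 2) := by
  have hpi := Real.pi_pos
  have huc := (H.contDiff_u n).continuous
  have hKc := (H.contDiff_Kn n).continuous
  have hhc := (H.contDiff_hn n).continuous
  have hcc := continuous_circ c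
  rw [integral_circ_eq H.norm_p hc (fun z => Real.exp (u n z / 2)),
    ← intervalIntegral.integral_const_mul]
  refine intervalIntegral.integral_mono_on (by linarith)
    (Continuous.intervalIntegrable (by fun_prop) _ _)
    (Continuous.intervalIntegrable (by fun_prop) _ _) fun θ _ => ?_
  have hL := H.L_nonneg
  have e1 : Real.exp (u n (circ c θ)) =
      Real.exp (u n (circ c θ) / 2) * Real.exp (u n (circ c θ) / 2) := by
    rw [← Real.exp_add, add_halves]
  have e2 : Real.exp (u n (circ c θ) / 2) ≤ Real.exp (u n q / 2) :=
    Real.exp_le_exp.2 (by linarith [hmax _ (circ_mem hc θ)])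
  have e3 := (le_abs_self _).trans (abs_D_le hb hc θ)
  rw [e1]
  have h2 := h0 θ
  have h3 := h1 θ
  have hS0 : 0 ≤ S := h2.trans h3
  calc _ = (hn n (circ c θ) ^ 2 + Kn n (circ c θ)) * (η θ * Real.exp (u n (circ c θ) / 2) *
        Real.exp (u n (circ c θ) / 2)) := by ring
    _ ≤ (L ^ 2 + L) * (η θ * Real.exp (u n (circ c θ) / 2) * Real.exp (u n (circ c θ) / 2)) :=
        mul_le_mul_of_nonneg_right e3 (by positivity)
    _ ≤ (L ^ 2 + L) * (S * Real.exp (u n q / 2) * Real.exp (u n (circ c θ) / 2)) := by gcongr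
    _ = _ := by ring

theorem exists_max_lower (H : ConcentratingFamily u Kn hn K h p A L) :
    ∃ c > 0, ∀ᶠ n in atTop, ∀ q : ℂ, (∀ z ∈ unitCircle, u n z ≤ u n q) →
      c ≤ Real.exp (u n q / 2) := by
  have hL := H.L_nonneg
  have hA := H.A_nonneg
  set M := 8 * L * A with hM
  have hM0 : 0 ≤ M := by positivity
  set t := 1 / (M + 1) with ht
  have ht0 : 0 < t := by positivity
  have ht1 : t ≤ 1 := by rw [ht, div_le_one (by positivity)]; linarith
  have hMt : M * t ^ 2 ≤ t := by
    have : (M + 1) * t = 1 := by rw [ht]; field_simp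
    nlinarith
  set X := 4 * (L ^ 2 + L) * A with hX
  have hX0 : 0 ≤ X := by positivity
  refine ⟨t / (X + 1), by positivity, ?_⟩
  set F : ℂ → ℂ := fun z => (1 / 2 + t ^ 2 : ℝ) + (-(1 / 2 : ℝ) * (starRingEnd ℂ) p) * z with hF
  have hFd : Differentiable ℂ F := differentiable_affine _ _
  have hFp : ‖F p‖ = t ^ 2 := by
    have : F p = (t ^ 2 : ℝ) := by
      simp only [hF]
      rw [mul_assoc, ← Complex.normSq_eq_conj_mul_self, Complex.normSq_eq_norm_sq, H.norm_p]
      push_cast; ring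
    rw [this, Complex.norm_real, Real.norm_of_nonneg (by positivity)]
  have hFre : ∀ θ, (F (circ p θ)).re = 1 / 2 + t ^ 2 - 1 / 2 * Real.cos θ := by
    intro θ
    simp only [hF]
    rw [mul_assoc, conj_mul_circ H.norm_p, Complex.add_re, ← Complex.ofReal_neg,
      Complex.re_ofReal_mul, Complex.exp_ofReal_mul_I_re, Complex.ofReal_re]
    ring
  have hFim : ∀ θ, -(circ p θ * deriv F (circ p θ)).im = 1 / 2 * Real.sin θ := by
    intro θ
    simp only [hF, deriv_affine]
    rw [mul_comm, mul_assoc, conj_mul_circ H.norm_p, ← Complex.ofReal_neg,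
      Complex.im_ofReal_mul, Complex.exp_ofReal_mul_I_im]
    ring
  filter_upwards [H.bounds, H.bInt_le_at hFd ht0] with n hb hB q hmax
  simp only [hFre, hFim, hFp] at hB
  have huc := (H.contDiff_u n).continuous
  have hKc := (H.contDiff_Kn n).continuous
  have hhc := (H.contDiff_hn n).continuous
  have hc := continuous_circ p
  have hut := continuous_tangentialDeriv ((H.contDiff_u n).of_le (by norm_num : (1 : WithTop ℕ∞) ≤ 2))
  have h1 := bInt_cos_lower (U := fun θ => u n (circ p θ))
    (U' := fun θ => tangentialDeriv (u n) (circ p θ))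
    (D := fun θ => hn n (circ p θ) ^ 2 + Kn n (circ p θ))
    (by fun_prop) (by fun_prop) (by fun_prop) ht0 ht1
  have h2 := H.integral_D_exp_le hb hmax H.norm_p
    (η := fun θ => 1 / 2 + t ^ 2 - 1 / 2 * Real.cos θ) (by fun_prop) (S := 2)
    (fun θ => by nlinarith [Real.cos_le_one θ]) (fun θ => by nlinarith [Real.neg_one_le_cos θ])
  have h3 := (abs_le.1 hB).2
  have h4 : (L ^ 2 + L) * 2 * Real.exp (u n q / 2) *
      ∫ θ in (-Real.pi)..Real.pi, Real.exp (u n (circ p θ) / 2) ≤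
      (L ^ 2 + L) * 2 * Real.exp (u n q / 2) * A := by
    have := H.length_le n
    gcongr
  have h5 : t ≤ Real.exp (u n q / 2) * X := by
    have : (L ^ 2 + L) * 2 * Real.exp (u n q / 2) * A * 2 = Real.exp (u n q / 2) * X := by
      rw [hX]; ring
    rw [← hM] at h3
    linarith
  rw [div_le_iff₀ (by positivity)]
  have := Real.exp_pos (u n q / 2)
  nlinarith

theorem hasDerivAt_circ_u (H : ConcentratingFamily u Kn hn K h p A L) (n : ℕ) (q : ℂ) (θ : ℝ) :
    HasDerivAt (fun θ => u n (circ q θ)) (tangentialDeriv (u n) (circ q θ)) θ :=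
  hasDerivAt_comp_circ ((H.contDiff_u n).of_le (by norm_num)) q θ

/-- The half-angle energy estimate centred at an arbitrary boundary point. -/
theorem half_angle_le (H : ConcentratingFamily u Kn hn K h p A L) :
    ∀ᶠ n in atTop, ∀ q : ℂ, ‖q‖ = 1 →
      8 * (∫ θ in (-Real.pi)..Real.pi,
        halfG (fun θ => tangentialDeriv (u n) (circ q θ)) θ ^ 2) -
      2 * (∫ θ in (-Real.pi)..Real.pi, (hn n (circ q θ) ^ 2 + Kn n (circ q θ)) *
        Real.exp (u n (circ q θ)) * Real.cos (θ / 2) ^ 2) ≤ 8 * L * A := by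
  filter_upwards [H.bInt_le] with n hB q hq
  have huc := (H.contDiff_u n).continuous
  have hKc := (H.contDiff_Kn n).continuous
  have hhc := (H.contDiff_hn n).continuous
  have hc := continuous_circ q
  have hut := continuous_tangentialDeriv ((H.contDiff_u n).of_le (by norm_num : (1 : WithTop ℕ∞) ≤ 2))
  have h1 := bInt_half_angle (U := fun θ => u n (circ q θ))
    (U' := fun θ => tangentialDeriv (u n) (circ q θ))
    (D := fun θ => hn n (circ q θ) ^ 2 + Kn n (circ q θ))
    (by fun_prop) (by fun_prop) (by fun_prop)
  set F : ℂ → ℂ := fun z => (1 / 2 : ℝ) + ((1 / 2 : ℝ) * (starRingEnd ℂ) q) * z with hF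
  have hFd : Differentiable ℂ F := differentiable_affine _ _
  have hFre : ∀ θ, (F (circ q θ)).re = Real.cos (θ / 2) ^ 2 := by
    intro θ
    simp only [hF]
    rw [mul_assoc, conj_mul_circ hq, Complex.add_re,
      Complex.re_ofReal_mul, Complex.exp_ofReal_mul_I_re, Complex.ofReal_re, Real.cos_sq]
    ring_nf
  have hFim : ∀ θ, -(circ q θ * deriv F (circ q θ)).im =
      -(Real.cos (θ / 2) * Real.sin (θ / 2)) := by
    intro θ
    simp only [hF, deriv_affine]
    rw [mul_comm, mul_assoc, conj_mul_circ hq, Complex.im_ofReal_mul, Complex.exp_ofReal_mul_I_im]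
    have := Real.sin_two_mul (θ / 2)
    rw [mul_div_cancel₀ _ (two_ne_zero)] at this
    rw [this]; ring
  have h2 := hB q hq F hFd 1 (fun z hz => by
    have hz1 : ‖z‖ ≤ 1 := by simpa [unitClosedDisk] using hz
    simp only [hF]
    refine (norm_add_le _ _).trans ?_
    rw [norm_mul, norm_mul, Complex.norm_real, RCLike.norm_conj, hq]
    norm_num
    linarith)
  simp only [hFre, hFim, mul_one] at h2
  rw [h1] at h2
  exact (abs_le.1 h2).2

theorem exists_length_lower (H : ConcentratingFamily u Kn hn K h p A L) :
    ∃ c > 0, ∀ᶠ n in atTop,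
      c ≤ ∫ θ in (-Real.pi)..Real.pi, Real.exp (u n (circ p θ) / 2) := by
  obtain ⟨c, hc, hmaxl⟩ := H.exists_max_lower
  have hL := H.L_nonneg
  have hA := H.A_nonneg
  set M := 8 * L * A with hM
  have hM0 : 0 ≤ M := by positivity
  set X := M / c + 2 * (L ^ 2 + L) with hX
  have hX0 : 0 ≤ X := by positivity
  refine ⟨1 / (X + 1), by positivity, ?_⟩
  filter_upwards [H.bounds, H.half_angle_le, hmaxl] with n hb hha hml
  obtain ⟨q, hq, hmax⟩ := H.circle_max n
  have h1 := hha q hq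
  have h2 := hml q hmax
  have h3 := H.integral_D_exp_le hb hmax hq (η := fun θ => Real.cos (θ / 2) ^ 2)
    (by fun_prop) (S := 1) (fun θ => sq_nonneg _) (fun θ => Real.cos_sq_le_one _)
  have hut := continuous_tangentialDeriv ((H.contDiff_u n).of_le (by norm_num : (1 : WithTop ℕ∞) ≤ 2))
  have hcc := continuous_circ q
  have h4 := exp_half_le_mass_mul (H.hasDerivAt_circ_u n q) (by fun_prop)
  have hq0 : circ q 0 = q := by simp [circ]
  rw [hq0, ← integral_circ_eq H.norm_p hq (fun z => Real.exp (u n z / 2))] at h4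
  set β := ∫ θ in (-Real.pi)..Real.pi, Real.exp (u n (circ p θ) / 2) with hβ
  set W := ∫ θ in (-Real.pi)..Real.pi,
    halfG (fun θ => tangentialDeriv (u n) (circ q θ)) θ ^ 2 with hW
  have hβ0 : 0 ≤ β := intervalIntegral.integral_nonneg (by linarith [Real.pi_pos])
    fun _ _ => (Real.exp_pos _).le
  set S := Real.exp (u n q / 2) with hS
  have hS0 : 0 < S := Real.exp_pos _
  by_contra! hlt
  have hX1 : β * (X + 1) < 1 := by rwa [lt_div_iff₀ (by positivity)] at hlt
  have hβ1 : β ≤ 1 := hlt.le.trans (by rw [div_le_one (by positivity)]; linarith)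
  have h5 : 8 * W ≤ M + 2 * (L ^ 2 + L) * S * β := by rw [mul_one] at h3; linarith
  have h6 : M ≤ M / c * S := by
    rw [div_mul_eq_mul_div, le_div_iff₀ hc]
    exact mul_le_mul_of_nonneg_left h2 hM0
  have h7 : 2 * (L ^ 2 + L) * S * β ≤ 2 * (L ^ 2 + L) * S := mul_le_of_le_one_right (by positivity) hβ1
  have h8 : 8 * W ≤ X * S := by rw [hX, add_mul]; linarith
  have h9 : 8 * S ≤ β * (X * S) := by nlinarith
  have h10 : β * (X * S) ≤ S := by
    have : β * X ≤ 1 := by nlinarith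
    calc β * (X * S) = β * X * S := by ring
      _ ≤ 1 * S := by gcongr
      _ = S := one_mul _
  linarith

end ConcentratingFamily

namespace ConcentratingFamily

variable {u Kn hn : ℕ → ℂ → ℝ} {K h : ℂ → ℝ} {p : ℂ} {A L : ℝ}

theorem eventually_arc_exp_le (H : ConcentratingFamily u Kn hn K h p A L) {c : ℝ} (hc : 0 < c)
    {r : ℝ} (hr : 0 < r) {ε : ℝ} (hε : 0 < ε) :
    ∀ᶠ n in atTop, ∀ θ ∈ Set.Icc (-Real.pi) Real.pi, r ≤ |θ| →
      Real.exp (c * u n (circ p θ)) ≤ ε := by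
  have hpi := Real.pi_pos
  filter_upwards [H.eventually_exp_le hc (r := 2 / Real.pi * r) (by positivity) hε] with n hn θ hθ hrθ
  refine hn _ (circ_mem_closed H.norm_p θ) ?_
  have h1 := abs_sub_le_norm_circ H.norm_p (x := θ) (y := 0) (by
    rw [sub_zero]; exact abs_le.2 ⟨hθ.1, hθ.2⟩)
  have hcp : circ p 0 = p := by simp [circ]
  rw [hcp, sub_zero] at h1
  rw [dist_eq_norm]
  exact le_trans (by gcongr) h1

theorem eventually_length_le (H : ConcentratingFamily u Kn hn K h p A L) {r : ℝ} (hr : 0 < r)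
    (hr1 : r ≤ Real.pi) {ε : ℝ} (hε : 0 < ε) :
    ∀ᶠ n in atTop, ∫ θ in (-Real.pi)..Real.pi, Real.exp (u n (circ p θ) / 2) ≤
      (∫ θ in (-r)..r, Real.exp (u n (circ p θ) / 2)) + ε := by
  have hpi := Real.pi_pos
  filter_upwards [H.eventually_arc_exp_le (c := 1 / 2) (by norm_num) hr
    (ε := ε / (2 * Real.pi)) (by positivity)] with n hn
  have huc := (H.contDiff_u n).continuous
  have hc := continuous_circ p
  have hI : ∀ a b : ℝ, IntervalIntegrable (fun θ => Real.exp (u n (circ p θ) / 2)) volume a b :=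
    fun a b => Continuous.intervalIntegrable (by fun_prop) _ _
  rw [← intervalIntegral.integral_add_adjacent_intervals (hI (-Real.pi) r) (hI r Real.pi),
    ← intervalIntegral.integral_add_adjacent_intervals (hI (-Real.pi) (-r)) (hI (-r) r)]
  have hb : ∀ a b : ℝ, a ≤ b → (∀ θ ∈ Set.Icc a b, θ ∈ Set.Icc (-Real.pi) Real.pi ∧ r ≤ |θ|) →
      ∫ θ in a..b, Real.exp (u n (circ p θ) / 2) ≤ (b - a) * (ε / (2 * Real.pi)) := by
    intro a b hab hθ
    have := intervalIntegral.integral_mono_on hab (hI a b)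
      (intervalIntegrable_const (c := ε / (2 * Real.pi)) (μ := volume)) (fun θ h => by
        have := hn θ (hθ θ h).1 (hθ θ h).2
        rwa [one_div_mul_eq_div] at this)
    simpa only [intervalIntegral.integral_const, smul_eq_mul] using this
  have h1 := hb (-Real.pi) (-r) (by linarith) fun θ h => ⟨⟨h.1, by linarith [h.2]⟩, by
    rw [abs_of_nonpos (by linarith [h.2])]; linarith [h.2]⟩
  have h2 := hb r Real.pi hr1 fun θ h => ⟨⟨by linarith [h.1], h.2⟩, by
    rw [abs_of_nonneg (by linarith [h.1])]; linarith [h.1]⟩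
  have h3 : (-r - -Real.pi) * (ε / (2 * Real.pi)) + (Real.pi - r) * (ε / (2 * Real.pi)) ≤ ε := by
    have : (-r - -Real.pi) * (ε / (2 * Real.pi)) + (Real.pi - r) * (ε / (2 * Real.pi)) =
      ε - 2 * r * (ε / (2 * Real.pi)) := by field_simp; ring
    rw [this]
    have : 0 ≤ 2 * r * (ε / (2 * Real.pi)) := by positivity
    linarith
  linarith

theorem half_le_cos_half_sq {θ : ℝ} (h : |θ| ≤ 1) : 1 / 2 ≤ Real.cos (θ / 2) ^ 2 := by
  have hpi := Real.pi_gt_three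
  rw [Real.cos_sq, mul_div_cancel₀ _ two_ne_zero]
  have := Real.cos_nonneg_of_mem_Icc (x := θ)
    ⟨by linarith [neg_le_of_abs_le h], by linarith [le_of_abs_le h]⟩
  linarith

theorem eventually_le_weighted_mass (H : ConcentratingFamily u Kn hn K h p A L) {R : ℝ}
    (hR : 0 < R) :
    ∀ᶠ n in atTop, R ≤ ∫ θ in (-Real.pi)..Real.pi,
      Real.exp (u n (circ p θ)) * Real.cos (θ / 2) ^ 2 := by
  have hpi := Real.pi_gt_three
  obtain ⟨c, hc, hlow⟩ := H.exists_length_lower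
  set r := min 1 (c ^ 2 / (16 * R)) with hr
  have hr0 : 0 < r := by positivity
  have hr1 : r ≤ 1 := min_le_left _ _
  have hr2 : r * (16 * R) ≤ c ^ 2 := by
    rw [← le_div_iff₀ (by positivity)]; exact min_le_right _ _
  filter_upwards [hlow, H.eventually_length_le hr0 (by linarith) (half_pos hc)] with n h1 h2
  have huc := (H.contDiff_u n).continuous
  have hcc := continuous_circ p
  set X := ∫ θ in (-r)..r, Real.exp (u n (circ p θ) / 2) with hX
  have hX1 : c / 2 ≤ X := by linarith
  have h3 := integral_sq_le (a := -r) (b := r) (by linarith)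
    (f := fun θ => Real.exp (u n (circ p θ) / 2)) (by fun_prop)
  have h4 : ∀ θ, Real.exp (u n (circ p θ) / 2) ^ 2 = Real.exp (u n (circ p θ)) := by
    intro θ; rw [← Real.exp_nat_mul]; congr 1; push_cast; ring
  simp only [h4] at h3
  have h5 : ∫ θ in (-r)..r, Real.exp (u n (circ p θ)) ≤
      2 * ∫ θ in (-r)..r, Real.exp (u n (circ p θ)) * Real.cos (θ / 2) ^ 2 := by
    rw [← intervalIntegral.integral_const_mul]
    refine intervalIntegral.integral_mono_on (by linarith)
      (Continuous.intervalIntegrable (by fun_prop) _ _)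
      (Continuous.intervalIntegrable (by fun_prop) _ _) fun θ hθ => ?_
    have := half_le_cos_half_sq (θ := θ) (abs_le.2 ⟨by linarith [hθ.1], by linarith [hθ.2]⟩)
    nlinarith [Real.exp_pos (u n (circ p θ))]
  have h6 : ∫ θ in (-r)..r, Real.exp (u n (circ p θ)) * Real.cos (θ / 2) ^ 2 ≤
      ∫ θ in (-Real.pi)..Real.pi, Real.exp (u n (circ p θ)) * Real.cos (θ / 2) ^ 2 := by
    refine intervalIntegral.integral_mono_interval (by linarith) (by linarith) (by linarith)
      (Eventually.of_forall fun θ => by positivity) (Continuous.intervalIntegrable (by fun_prop) _ _)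
  refine le_trans ?_ h6
  set Y := ∫ θ in (-r)..r, Real.exp (u n (circ p θ)) * Real.cos (θ / 2) ^ 2
  have h7 : (c / 2) ^ 2 ≤ X ^ 2 := by gcongr
  have h8 : X ^ 2 ≤ 4 * r * Y := by nlinarith
  nlinarith

theorem tendsto_D_local (H : ConcentratingFamily u Kn hn K h p A L) {ε : ℝ} (hε : 0 < ε) :
    ∃ r > 0, ∀ᶠ n in atTop, ∀ θ, |θ| ≤ r →
      |(hn n (circ p θ) ^ 2 + Kn n (circ p θ)) - (h p ^ 2 + K p)| ≤ ε := by
  have hL := H.L_nonneg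
  set δ := ε / (2 * (2 * L + 3)) with hδ
  have hδ0 : 0 < δ := by positivity
  have hKc := H.contDiff_K.continuous
  have hhc := H.contDiff_h.continuous
  have hcc := continuous_circ p
  have hcp : circ p 0 = p := by simp [circ]
  have hmem : p ∈ unitCircle := by simp [unitCircle, H.norm_p]
  have hpL : |h p| ≤ L := by
    have h1 := (H.unif_h.tendsto_at hmem).abs
    refine le_of_tendsto h1 ?_
    filter_upwards [H.bounds] with n hb using (hb.2 p hmem).1
  have hcont : ∀ f : ℂ → ℝ, Continuous f → ∃ r > 0, ∀ θ, |θ| ≤ r → |f (circ p θ) - f p| ≤ δ := by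
    intro f hf
    obtain ⟨r, hr, hrr⟩ := Metric.continuousAt_iff.1 ((hf.comp hcc).continuousAt (x := 0)) δ hδ0
    refine ⟨r / 2, by positivity, fun θ hθ => ?_⟩
    have := hrr (x := θ) (by rw [Real.dist_eq, sub_zero]; linarith)
    simp only [Function.comp, hcp, Real.dist_eq] at this
    exact this.le
  obtain ⟨r₁, hr₁, h₁⟩ := hcont h hhc
  obtain ⟨r₂, hr₂, h₂⟩ := hcont K hKc
  refine ⟨min r₁ r₂, by positivity, ?_⟩
  filter_upwards [H.bounds, Metric.tendstoUniformlyOn_iff.1 H.unif_h δ hδ0,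
    Metric.tendstoUniformlyOn_iff.1 H.unif_K δ hδ0] with n hb hh hK θ hθ
  have a1 := h₁ θ (hθ.trans (min_le_left _ _))
  have a2 := h₂ θ (hθ.trans (min_le_right _ _))
  have a3 := (hh _ (circ_mem H.norm_p θ)).le
  have a4 := (hK _ (circ_mem_closed H.norm_p θ)).le
  have a5 := (hb.2 _ (circ_mem H.norm_p θ)).1
  rw [Real.dist_eq, abs_sub_comm] at a3 a4
  set x := hn n (circ p θ)
  have e1 : |x - h p| ≤ 2 * δ := by
    have := abs_sub_le x (h (circ p θ)) (h p); linarith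
  have e2 : |Kn n (circ p θ) - K p| ≤ 2 * δ := by
    have := abs_sub_le (Kn n (circ p θ)) (K (circ p θ)) (K p); linarith
  have e3 : |x + h p| ≤ 2 * L := (abs_add_le _ _).trans (by linarith)
  have e4 : |x ^ 2 - h p ^ 2| ≤ 2 * L * (2 * δ) := by
    rw [sq_sub_sq, abs_mul]; gcongr
  have e5 : x ^ 2 + Kn n (circ p θ) - (h p ^ 2 + K p) =
    (x ^ 2 - h p ^ 2) + (Kn n (circ p θ) - K p) := by ring
  rw [e5]
  refine (abs_add_le _ _).trans ?_
  have e6 : δ * (2 * (2 * L + 3)) = ε := by rw [hδ]; field_simp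
  nlinarith

theorem eventually_pi_le_length (H : ConcentratingFamily u Kn hn K h p A L) {k : ℝ} (hk : 0 < k)
    (hkD : h p ^ 2 + K p < 4 * k ^ 2) :
    ∀ᶠ n in atTop, Real.pi ≤ k * ∫ θ in (-Real.pi)..Real.pi, Real.exp (u n (circ p θ) / 2) := by
  have hpi := Real.pi_gt_three
  have hpp : -Real.pi ≤ Real.pi := by linarith
  have hL := H.L_nonneg
  have hA := H.A_nonneg
  set c₀ := 4 * k ^ 2 - (h p ^ 2 + K p) with hc₀
  have hc0 : 0 < c₀ := by linarith
  obtain ⟨r, hr, hloc⟩ := H.tendsto_D_local (half_pos hc0)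
  set ε := 1 / (c₀ + 2 * (L ^ 2 + L)) with hε
  have hε0 : 0 < ε := by positivity
  have hε1 : ε * (c₀ + 2 * (L ^ 2 + L)) = 1 := by rw [hε]; field_simp
  set R := (8 * L * A + 2 * Real.pi + 1) / c₀ with hR
  have hR0 : 0 < R := by positivity
  filter_upwards [hloc, H.bounds, H.half_angle_le, H.eventually_le_weighted_mass hR0,
    H.eventually_arc_exp_le one_pos hr hε0] with n h1 hb h2 h3 h4
  by_contra! hcon
  have huc := (H.contDiff_u n).continuous
  have hKc := (H.contDiff_Kn n).continuous
  have hhc := (H.contDiff_hn n).continuous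
  have hcc := continuous_circ p
  have hut := continuous_tangentialDeriv
    ((H.contDiff_u n).of_le (by norm_num : (1 : WithTop ℕ∞) ≤ 2))
  have h5 := wirtinger_halfG (H.hasDerivAt_circ_u n p) (by fun_prop) hk hcon
  have h6 := h2 p H.norm_p
  set X := ∫ θ in (-Real.pi)..Real.pi, Real.exp (u n (circ p θ)) * Real.cos (θ / 2) ^ 2 with hX
  have h7 : 2 * (∫ θ in (-Real.pi)..Real.pi, (hn n (circ p θ) ^ 2 + Kn n (circ p θ)) *
      Real.exp (u n (circ p θ)) * Real.cos (θ / 2) ^ 2) ≤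
      ∫ θ in (-Real.pi)..Real.pi,
        ((8 * k ^ 2 - c₀) * (Real.exp (u n (circ p θ)) * Real.cos (θ / 2) ^ 2) + 1) := by
    rw [← intervalIntegral.integral_const_mul]
    refine intervalIntegral.integral_mono_on hpp
      (Continuous.intervalIntegrable (by fun_prop) _ _)
      (Continuous.intervalIntegrable (by fun_prop) _ _) fun θ hθ => ?_
    set D := hn n (circ p θ) ^ 2 + Kn n (circ p θ) with hD
    have hw0 : 0 ≤ Real.exp (u n (circ p θ)) * Real.cos (θ / 2) ^ 2 := by positivity
    rcases le_total |θ| r with hθr | hθr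
    · have := (abs_le.1 (h1 θ hθr)).2
      have : 2 * D ≤ 8 * k ^ 2 - c₀ := by linarith
      nlinarith
    · have hw1 : Real.exp (u n (circ p θ)) * Real.cos (θ / 2) ^ 2 ≤ ε := by
        have := h4 θ hθ hθr
        rw [one_mul] at this
        have hcos := Real.cos_sq_le_one (θ / 2)
        nlinarith [Real.exp_pos (u n (circ p θ)), sq_nonneg (Real.cos (θ / 2))]
      have hDle := (le_abs_self _).trans (abs_D_le hb H.norm_p θ)
      rw [← hD] at hDle
      have : (2 * D - 8 * k ^ 2 + c₀) ≤ c₀ + 2 * (L ^ 2 + L) := by nlinarith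
      set w := Real.exp (u n (circ p θ)) * Real.cos (θ / 2) ^ 2
      have e1 : (2 * D - 8 * k ^ 2 + c₀) * w ≤ (c₀ + 2 * (L ^ 2 + L)) * w :=
        mul_le_mul_of_nonneg_right this hw0
      have e2 : (c₀ + 2 * (L ^ 2 + L)) * w ≤ (c₀ + 2 * (L ^ 2 + L)) * ε := by gcongr
      have e3 : 2 * (D * Real.exp (u n (circ p θ)) * Real.cos (θ / 2) ^ 2) = 2 * D * w := by ring
      rw [e3]; nlinarith
  rw [intervalIntegral.integral_add (Continuous.intervalIntegrable (by fun_prop) _ _)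
    intervalIntegrable_const, intervalIntegral.integral_const_mul,
    intervalIntegral.integral_const, smul_eq_mul, mul_one] at h7
  have h8 : R * c₀ = 8 * L * A + 2 * Real.pi + 1 := by rw [hR]; field_simp
  nlinarith

theorem eventually_length_le_pi_div (H : ConcentratingFamily u Kn hn K h p A L) {k : ℝ}
    (hk : 0 < k) (hkD : 4 * k ^ 2 < h p ^ 2 + K p) {ε : ℝ} (hε : 0 < ε) :
    ∀ᶠ n in atTop, ∫ θ in (-Real.pi)..Real.pi, Real.exp (u n (circ p θ) / 2) ≤
      Real.pi / k + ε := by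
  have hpi := Real.pi_gt_three
  have hL := H.L_nonneg
  have hA := H.A_nonneg
  set M := 8 * L * A with hM
  set c₀ := (h p ^ 2 + K p) - 4 * k ^ 2 with hc₀
  have hc0 : 0 < c₀ := by linarith
  obtain ⟨r₀, hr₀, hloc⟩ := H.tendsto_D_local (half_pos hc0)
  obtain ⟨r, hr, hr1, hrr, hsmall⟩ : ∃ r > 0, r ≤ 1 ∧ r ≤ r₀ ∧
      M * (r ^ 2 + √(32 * Real.pi * r)) + 8 * r ^ 2 ≤ 8 := by
    have hf : Continuous fun r : ℝ => M * (r ^ 2 + √(32 * Real.pi * r)) + 8 * r ^ 2 := by fun_prop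
    have h1 : ∀ᶠ r in nhds (0 : ℝ), M * (r ^ 2 + √(32 * Real.pi * r)) + 8 * r ^ 2 < 8 :=
      hf.continuousAt.eventually_lt_const (by simp)
    obtain ⟨δ, hδ, hδ1⟩ := Metric.eventually_nhds_iff.1 h1
    refine ⟨min (min 1 r₀) (δ / 2), by positivity, ?_, ?_, (hδ1 ?_).le⟩
    · exact (min_le_left _ _).trans (min_le_left _ _)
    · exact (min_le_left _ _).trans (min_le_right _ _)
    · rw [Real.dist_eq, sub_zero, abs_of_pos (by positivity)]
      exact (min_le_right _ _).trans_lt (by linarith)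
  filter_upwards [hloc, H.bInt_le, H.eventually_length_le hr (by linarith) hε] with n h1 hB h2
  refine h2.trans (add_le_add_left ?_ ε)
  have huc := (H.contDiff_u n).continuous
  have hKc := (H.contDiff_Kn n).continuous
  have hhc := (H.contDiff_hn n).continuous
  have hcc := continuous_circ p
  have hut := continuous_tangentialDeriv
    ((H.contDiff_u n).of_le (by norm_num : (1 : WithTop ℕ∞) ≤ 2))
  refine arc_mass_le (H.hasDerivAt_circ_u n p) (by fun_prop)
    (D := fun θ => hn n (circ p θ) ^ 2 + Kn n (circ p θ)) (by fun_prop)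
    (D₁ := 4 * k ^ 2 + c₀ / 2) hk hr hr1 (fun θ hθ => ?_) (by linarith)
    (M := M) (by positivity) (fun η η' hd hc hper hper' => ?_) hsmall
  · have := (abs_le.1 (h1 θ ((abs_le.2 ⟨hθ.1, hθ.2⟩).trans hrr))).1
    linarith
  · exact abs_functional_le (by fun_prop) (by fun_prop) H.norm_p
      (fun F hF S hS => hB p H.norm_p F hF S hS) (fun θ _ => hd θ) hc.continuousOn hper hper'

theorem D_pos (H : ConcentratingFamily u Kn hn K h p A L) : 0 < h p ^ 2 + K p := by
  by_contra! hcon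
  have hA := H.A_nonneg
  have hk : (0 : ℝ) < 1 / (A + 1) := by positivity
  obtain ⟨n, hn⟩ := (H.eventually_pi_le_length hk (by nlinarith [pow_pos hk 2])).exists
  have h1 := H.length_le n
  have h2 : 1 / (A + 1) * (∫ θ in (-Real.pi)..Real.pi, Real.exp (u n (circ p θ) / 2)) ≤ 1 := by
    rw [one_div_mul_eq_div, div_le_one (by positivity)]; linarith
  linarith [Real.pi_gt_three]

theorem tendsto_length (H : ConcentratingFamily u Kn hn K h p A L) :
    Tendsto (fun n => ∫ θ in (-Real.pi)..Real.pi, Real.exp (u n (circ p θ) / 2)) atTop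
      (nhds (2 * Real.pi / √(h p ^ 2 + K p))) := by
  have hpi := Real.pi_pos
  have hD := H.D_pos
  set d := √(h p ^ 2 + K p) with hd
  have hd0 : 0 < d := Real.sqrt_pos.2 hD
  have hd2 : d ^ 2 = h p ^ 2 + K p := Real.sq_sqrt hD.le
  have hcont : ContinuousAt (fun k => Real.pi / k) (d / 2) :=
    continuousAt_const.div continuousAt_id (by positivity)
  have hval : Real.pi / (d / 2) = 2 * Real.pi / d := by field_simp
  refine tendsto_order.2 ⟨fun a ha => ?_, fun a ha => ?_⟩
  · have h1 := hcont.eventually_const_lt (u := a) (by simpa only [hval] using ha)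
    obtain ⟨δ, hδ, hδ1⟩ := Metric.eventually_nhds_iff.1 h1
    have h2 := hδ1 (y := d / 2 + δ / 2) (by
      rw [Real.dist_eq, add_sub_cancel_left, abs_of_pos (by positivity)]; linarith)
    filter_upwards [H.eventually_pi_le_length (k := d / 2 + δ / 2) (by positivity)
      (by rw [← hd2]; nlinarith)] with n hn
    refine h2.trans_le ?_
    rw [div_le_iff₀ (by positivity)]; linarith
  · have h1 := hcont.eventually_lt_const (u := a) (by simpa only [hval] using ha)
    obtain ⟨δ, hδ, hδ1⟩ := Metric.eventually_nhds_iff.1 h1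
    set s := min δ d / 4 with hs
    have hs0 : 0 < s := by positivity
    have hs1 : s ≤ δ / 4 := by rw [hs]; gcongr; exact min_le_left _ _
    have hs2 : s ≤ d / 4 := by rw [hs]; gcongr; exact min_le_right _ _
    have h2 := hδ1 (y := d / 2 - s) (by
      rw [Real.dist_eq, sub_sub_cancel_left, abs_neg, abs_of_pos hs0]; linarith)
    filter_upwards [H.eventually_length_le_pi_div (k := d / 2 - s) (by linarith)
      (by rw [← hd2]; nlinarith) (half_pos (sub_pos.2 h2))] with n hn
    linarith

end ConcentratingFamily

namespace ConcentratingFamily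

variable {u Kn hn : ℕ → ℂ → ℝ} {K h : ℂ → ℝ} {p : ℂ} {A L : ℝ}

theorem tendsto_gauss_bonnet (H : ConcentratingFamily u Kn hn K h p A L) :
    Tendsto (fun n => K p * (∫ z in unitDisk, Real.exp (u n z)) +
      h p * ∫ θ in (-Real.pi)..Real.pi, Real.exp (u n (circ p θ) / 2)) atTop
      (nhds (2 * Real.pi)) := by
  have h1 := H.tendsto_disk (fun n => (H.contDiff_Kn n).continuous) H.contDiff_K.continuous H.unif_K
  have h2 := H.tendsto_circle (fun n => (H.contDiff_hn n).continuous) H.contDiff_h.continuous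
    H.unif_h
  have h3 := (tendsto_const_nhds (x := 2 * Real.pi)).sub (h1.add h2)
  rw [add_zero, sub_zero] at h3
  refine h3.congr fun n => ?_
  rw [← gauss_bonnet (H.contDiff_u n) (H.contDiff_hn n).continuous (H.solves n) H.norm_p]
  ring

/-- The Kazdan–Warner identity in the limit. -/
theorem tendsto_kazdan_warner (H : ConcentratingFamily u Kn hn K h p A L) :
    Tendsto (fun n => 2 * tangentialDeriv h p *
        (∫ θ in (-Real.pi)..Real.pi, Real.exp (u n (circ p θ) / 2)) +
      tangentialDeriv K p * ∫ z in unitDisk, Real.exp (u n z)) atTop (nhds 0) := by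
  have hX : ∀ n, Continuous (dirDeriv 1 (Kn n)) := fun n => continuous_dirDeriv (H.contDiff_Kn n) _
  have hY : ∀ n, Continuous (dirDeriv Complex.I (Kn n)) :=
    fun n => continuous_dirDeriv (H.contDiff_Kn n) _
  have hX0 := continuous_dirDeriv H.contDiff_K 1
  have hY0 := continuous_dirDeriv H.contDiff_K Complex.I
  have hunif : TendstoUniformlyOn
      (fun n z => dirDeriv 1 (Kn n) z * (z * Complex.I).re +
        dirDeriv Complex.I (Kn n) z * (z * Complex.I).im)
      (fun z => dirDeriv 1 K z * (z * Complex.I).re + dirDeriv Complex.I K z * (z * Complex.I).im)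
      atTop unitClosedDisk := by
    refine Metric.tendstoUniformlyOn_iff.2 fun ε hε => ?_
    filter_upwards [Metric.tendstoUniformlyOn_iff.1 H.unif_Kx (ε / 2) (by positivity),
      Metric.tendstoUniformlyOn_iff.1 H.unif_Ky (ε / 2) (by positivity)] with n h1 h2 z hz
    have hz1 : ‖z * Complex.I‖ ≤ 1 := by simpa [unitClosedDisk] using hz
    have a1 := h1 z hz
    have a2 := h2 z hz
    rw [Real.dist_eq] at a1 a2 ⊢
    have b1 := (Complex.abs_re_le_norm _).trans hz1
    have b2 := (Complex.abs_im_le_norm _).trans hz1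
    rw [add_sub_add_comm, ← sub_mul, ← sub_mul]
    refine (abs_add_le _ _).trans_lt ?_
    rw [abs_mul, abs_mul]
    have c1 := mul_le_mul_of_nonneg_left b1 (abs_nonneg (dirDeriv 1 K z - dirDeriv 1 (Kn n) z))
    have c2 := mul_le_mul_of_nonneg_left b2
      (abs_nonneg (dirDeriv Complex.I K z - dirDeriv Complex.I (Kn n) z))
    linarith
  have h1 := H.tendsto_disk (fun n => by have := hX n; have := hY n; fun_prop) (by fun_prop) hunif
  have h2 := H.tendsto_circle (fun n => continuous_tangentialDeriv (H.contDiff_hn n))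
    (continuous_tangentialDeriv H.contDiff_h) H.unif_ht
  have h3 := ((h2.const_mul 2).add h1).neg
  rw [mul_zero, add_zero, neg_zero] at h3
  refine h3.congr fun n => ?_
  have hP := pohozaev (H.contDiff_u n) (H.contDiff_Kn n) (H.contDiff_hn n) (H.solves n)
    (F := fun _ => Complex.I) (differentiable_const _) H.norm_p
  simp only [Complex.I_re, zero_mul, deriv_const, mul_zero, Complex.zero_im, zero_add, zero_sub,
    Complex.I_im, mul_one] at hP
  have e1 : ∫ θ in (-Real.pi)..Real.pi,
      -(4 * tangentialDeriv (hn n) (circ p θ) * Real.exp (u n (circ p θ) / 2)) =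
      -4 * ∫ θ in (-Real.pi)..Real.pi,
        tangentialDeriv (hn n) (circ p θ) * Real.exp (u n (circ p θ) / 2) := by
    rw [← intervalIntegral.integral_const_mul]; congr 1; ext θ; ring
  have e2 : ∫ z in unitDisk, Real.exp (u n z) *
      (dirDeriv 1 (Kn n) z * (z * Complex.I).re + dirDeriv Complex.I (Kn n) z * (z * Complex.I).im) =
      ∫ z in unitDisk, (dirDeriv 1 (Kn n) z * (z * Complex.I).re +
        dirDeriv Complex.I (Kn n) z * (z * Complex.I).im) * Real.exp (u n z) := by
    congr 1; ext z; ring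
  have e3 : tangentialDeriv K p =
      dirDeriv 1 K p * (p * Complex.I).re + dirDeriv Complex.I K p * (p * Complex.I).im := by
    rw [tangentialDeriv_eq]; simp; try ring
  rw [e1, e2] at hP
  rw [e3]
  linarith

/-- Once the limit of the area is known, the tangential condition follows. -/
theorem tangential_of_tendsto_area (H : ConcentratingFamily u Kn hn K h p A L)
    (hα : Tendsto (fun n => ∫ z in unitDisk, Real.exp (u n z)) atTop
      (nhds (2 * Real.pi / √(h p ^ 2 + K p) / (h p + √(h p ^ 2 + K p))))) :
    2 * tangentialDeriv h p + tangentialDeriv K p / (h p + √(h p ^ 2 + K p)) = 0 := by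
  have hd := Real.sqrt_pos.2 H.D_pos
  have h1 := (H.tendsto_length.const_mul (2 * tangentialDeriv h p)).add
    (hα.const_mul (tangentialDeriv K p))
  have h2 := tendsto_nhds_unique h1 H.tendsto_kazdan_warner
  have h3 : 2 * Real.pi / √(h p ^ 2 + K p) * (2 * tangentialDeriv h p +
      tangentialDeriv K p / (h p + √(h p ^ 2 + K p))) = 0 := by
    rw [← h2]; ring
  exact (mul_eq_zero.1 h3).resolve_left (by positivity)

theorem tendsto_area_of_ne (H : ConcentratingFamily u Kn hn K h p A L) (hK : K p ≠ 0) :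
    Tendsto (fun n => ∫ z in unitDisk, Real.exp (u n z)) atTop
      (nhds (2 * Real.pi / √(h p ^ 2 + K p) / (h p + √(h p ^ 2 + K p)))) := by
  have hd := Real.sqrt_pos.2 H.D_pos
  have hd2 := Real.sq_sqrt H.D_pos.le
  have h1 := (H.tendsto_gauss_bonnet.sub (H.tendsto_length.const_mul (h p))).div_const (K p)
  set d := √(h p ^ 2 + K p)
  have hK2 : K p = (d - h p) * (h p + d) := by linarith
  have hne : h p + d ≠ 0 := fun h0 => hK (by rw [hK2, h0, mul_zero])
  have hne2 : d - h p ≠ 0 := fun h0 => hK (by rw [hK2, h0, zero_mul])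
  have e : (2 * Real.pi - h p * (2 * Real.pi / d)) / K p = 2 * Real.pi / d / (h p + d) := by
    rw [hK2]; field_simp
  rw [e] at h1
  refine h1.congr fun n => ?_
  rw [add_sub_cancel_right, mul_div_cancel_left₀ _ hK]

theorem h_pos_of_eq_zero (H : ConcentratingFamily u Kn hn K h p A L) (hK : K p = 0) :
    0 < h p ∧ √(h p ^ 2 + K p) = h p := by
  have hpi := Real.pi_pos
  have hd := Real.sqrt_pos.2 H.D_pos
  have h1 := H.tendsto_gauss_bonnet
  simp only [hK, zero_mul, zero_add] at h1
  have h2 := tendsto_nhds_unique h1 (H.tendsto_length.const_mul (h p))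
  set d := √(h p ^ 2 + K p)
  have h3 : h p = d := by
    field_simp at h2
    linarith
  exact ⟨by rw [h3]; exact hd, h3.symm⟩

end ConcentratingFamily

theorem HasPD.comp_holomorphic {f : ℂ → ℝ} {a b : ℝ} {z c : ℂ} {φ : ℂ → ℂ}
    (hf : HasPD f a b (φ z)) (hφ : HasDerivAt φ c z) :
    HasPD (fun w => f (φ w)) (a * c.re + b * c.im) (-(a * c.im) + b * c.re) z := by
  unfold HasPD at *
  have h := hf.comp z hφ.complexToReal_fderiv
  convert! h using 1
  ext x
  simp
  ring

theorem HasPD.comp_mul {f : ℂ → ℝ} {a b : ℝ} {z : ℂ} (r : ℝ) (hf : HasPD f a b (r * z)) :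
    HasPD (fun w => f (r * w)) (r * a) (r * b) z := by
  have h := hf.comp_holomorphic (φ := fun w => (r : ℂ) * w) (c := r)
    (by simpa using (hasDerivAt_id z).const_mul (r : ℂ))
  simpa [mul_comm] using h

theorem real_mul_mem_closedDisk {r : ℝ} (hr : r ∈ Set.Icc (0 : ℝ) 1) {z : ℂ}
    (hz : z ∈ unitClosedDisk) : (r * z : ℂ) ∈ unitClosedDisk := by
  simp only [unitClosedDisk, mem_closedBall_zero_iff] at hz ⊢
  rw [norm_mul, Complex.norm_real, Real.norm_eq_abs, abs_of_nonneg hr.1]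
  exact mul_le_one₀ hr.2 (norm_nonneg _) hz

theorem continuousOn_integral_dilation {f : ℂ → ℝ} (hf : ContinuousOn f unitClosedDisk) :
    ContinuousOn (fun r : ℝ => ∫ z in unitDisk, f (r * z)) (Set.Icc 0 1) := by
  obtain ⟨B, hB⟩ := (isCompact_closedBall (0 : ℂ) 1).exists_bound_of_continuousOn hf
  have hsub : unitDisk ⊆ unitClosedDisk := Metric.ball_subset_closedBall
  have hfin : IsFiniteMeasure (volume.restrict unitDisk) :=
    ⟨by rw [Measure.restrict_apply_univ]; exact measure_ball_lt_top⟩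
  refine continuousOn_of_dominated (bound := fun _ => B) (fun r hr => ?_) (fun r hr => ?_)
    (integrable_const B) ?_
  · refine ContinuousOn.aestronglyMeasurable ?_ Metric.isOpen_ball.measurableSet
    exact hf.comp (by fun_prop) fun z hz => real_mul_mem_closedDisk hr (hsub hz)
  · filter_upwards [ae_restrict_mem Metric.isOpen_ball.measurableSet] with z hz
    exact hB _ (real_mul_mem_closedDisk hr (hsub hz))
  · filter_upwards [ae_restrict_mem Metric.isOpen_ball.measurableSet] with z hz
    exact hf.comp (by fun_prop) fun r hr => real_mul_mem_closedDisk hr (hsub hz)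

/-- Growth of circle integrals in terms of the Laplacian. -/
theorem circle_integral_sub {w wx wy wxx wxy wyx wyy l : ℂ → ℝ}
    (h0 : ∀ z ∈ unitClosedDisk, HasPD w (wx z) (wy z) z)
    (h1 : ∀ z ∈ unitClosedDisk, HasPD wx (wxx z) (wxy z) z)
    (h2 : ∀ z ∈ unitClosedDisk, HasPD wy (wyx z) (wyy z) z)
    (hl : ∀ z ∈ unitClosedDisk, wxx z + wyy z = l z) (hlc : ContinuousOn l unitClosedDisk)
    {a b : ℝ} (ha : 0 ≤ a) (hab : a ≤ b) (hb : b ≤ 1) :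
    (∫ θ in (-Real.pi)..Real.pi, w (b * circ 1 θ)) - ∫ θ in (-Real.pi)..Real.pi, w (a * circ 1 θ) =
      ∫ r in a..b, r * ∫ z in unitDisk, l (r * z) := by
  have hpi := Real.pi_pos
  have hpp : -Real.pi ≤ Real.pi := by linarith
  have hcc := continuous_circ 1
  have hn1 : ‖(1 : ℂ)‖ = 1 := by simp
  have hmem : ∀ r ∈ Set.Icc a b, ∀ θ, (r * circ 1 θ : ℂ) ∈ unitClosedDisk := fun r hr θ =>
    real_mul_mem_closedDisk ⟨ha.trans hr.1, hr.2.trans hb⟩ (circ_mem_closed hn1 θ)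
  have hwc : ContinuousOn w unitClosedDisk :=
    fun z hz => (h0 z hz).continuousAt.continuousWithinAt
  have hxc : ContinuousOn wx unitClosedDisk :=
    fun z hz => (h1 z hz).continuousAt.continuousWithinAt
  have hyc : ContinuousOn wy unitClosedDisk :=
    fun z hz => (h2 z hz).continuousAt.continuousWithinAt
  have hcomp : ∀ g : ℂ → ℝ, ContinuousOn g unitClosedDisk →
      ContinuousOn (fun q : ℝ × ℝ => g (q.1 * circ 1 q.2)) (Set.Icc a b ×ˢ Set.univ) := fun g hg =>
    hg.comp (by fun_prop) fun q hq => hmem q.1 hq.1 q.2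
  set G : ℝ → ℝ → ℝ := fun r θ => wx (r * circ 1 θ) * (circ 1 θ).re +
    wy (r * circ 1 θ) * (circ 1 θ).im with hG
  have hGc : ContinuousOn (Function.uncurry G) (Set.Icc a b ×ˢ Set.univ) := by
    have e1 := hcomp wx hxc
    have e2 := hcomp wy hyc
    exact (e1.mul (by fun_prop)).add (e2.mul (by fun_prop))
  have hw : ∀ r ∈ Set.Icc a b, Continuous fun θ => w (r * circ 1 θ) := fun r hr =>
    hwc.comp_continuous (by fun_prop) (hmem r hr)
  have hbm : b ∈ Set.Icc a b := ⟨hab, le_rfl⟩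
  have ham : a ∈ Set.Icc a b := ⟨le_rfl, hab⟩
  rw [← intervalIntegral.integral_sub ((hw b hbm).intervalIntegrable _ _)
    ((hw a ham).intervalIntegrable _ _)]
  have hrad : ∀ θ, w (b * circ 1 θ) - w (a * circ 1 θ) = ∫ r in a..b, G r θ := by
    intro θ
    refine (intervalIntegral.integral_eq_sub_of_hasDerivAt (f := fun r : ℝ => w (r * circ 1 θ))
      (fun r hr => ?_) ?_).symm
    · rw [Set.uIcc_of_le hab] at hr
      have hd : HasDerivAt (fun r : ℝ => (r : ℂ) * circ 1 θ) (circ 1 θ) r := by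
        simpa using (Complex.ofRealCLM.hasDerivAt (x := r)).mul_const (circ 1 θ)
      exact HasPD.comp_hasDerivAt (γ := fun r : ℝ => (r : ℂ) * circ 1 θ) (h0 _ (hmem r hr θ)) hd
    · apply ContinuousOn.intervalIntegrable
      rw [Set.uIcc_of_le hab]
      exact hGc.comp (f := fun r => (r, θ)) (by fun_prop) fun r hr => ⟨hr, trivial⟩
  simp_rw [hrad]
  rw [intervalIntegral_intervalIntegral_swap]
  · refine intervalIntegral.integral_congr fun r hr => ?_
    rw [Set.uIcc_of_le hab] at hr
    have hr1 : r ∈ Set.Icc (0 : ℝ) 1 := ⟨ha.trans hr.1, hr.2.trans hb⟩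
    have h := integral_div_disk hn1 (A := fun z => wx (r * z)) (B := fun z => wy (r * z))
      (d := fun z => r * l (r * z))
      (fun z hz => (h1 _ (real_mul_mem_closedDisk hr1 hz)).comp_mul r)
      (fun z hz => (h2 _ (real_mul_mem_closedDisk hr1 hz)).comp_mul r)
      (fun z hz => by rw [← hl _ (real_mul_mem_closedDisk hr1 hz)]; ring)
      (continuousOn_const.mul (hlc.comp (by fun_prop) fun z hz => real_mul_mem_closedDisk hr1 hz))
    simp only [hG]
    rw [← h, integral_const_mul]
  · rw [Set.uIoc_of_le hpp, Set.uIoc_of_le hab]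
    refine IntegrableOn.mono_set (t := Set.Icc (-Real.pi) Real.pi ×ˢ Set.Icc a b) ?_
      (Set.prod_mono Set.Ioc_subset_Icc_self Set.Ioc_subset_Icc_self)
    refine ContinuousOn.integrableOn_compact (isCompact_Icc.prod isCompact_Icc) ?_
    exact hGc.comp (f := Prod.swap) (by fun_prop) fun q hq => ⟨hq.2, trivial⟩

/-- An exponential mean value inequality. -/
theorem exp_le_of_lap_ge {w wx wy wxx wxy wyx wyy l f : ℂ → ℝ}
    (h0 : ∀ z ∈ unitClosedDisk, HasPD w (wx z) (wy z) z)
    (h1 : ∀ z ∈ unitClosedDisk, HasPD wx (wxx z) (wxy z) z)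
    (h2 : ∀ z ∈ unitClosedDisk, HasPD wy (wyx z) (wyy z) z)
    (hl : ∀ z ∈ unitClosedDisk, wxx z + wyy z = l z) (hlc : ContinuousOn l unitClosedDisk)
    (hfc : ContinuousOn f unitClosedDisk) (hf0 : ∀ z ∈ unitClosedDisk, 0 ≤ f z)
    (hfl : ∀ z ∈ unitClosedDisk, -l z ≤ f z) (hfm : ∫ z in unitDisk, f z ≤ 2 * Real.pi)
    {ε : ℝ} (hw : ∀ z ∈ unitCircle, w z ≤ ε) :
    Real.exp (w 0) ≤ Real.exp ε *
      (1 + 1 / (2 * Real.pi) * ∫ r in (0 : ℝ)..1, ∫ z in unitDisk, f (r * z)) := by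
  have hpi := Real.pi_pos
  have hpp : -Real.pi ≤ Real.pi := by linarith
  have hcc := continuous_circ 1
  have hn1 : ‖(1 : ℂ)‖ = 1 := by simp
  have hsub : unitDisk ⊆ unitClosedDisk := Metric.ball_subset_closedBall
  have hwc : ContinuousOn w unitClosedDisk :=
    fun z hz => (h0 z hz).continuousAt.continuousWithinAt
  set m : ℝ → ℝ := fun r => ∫ z in unitDisk, f (r * z) with hm
  have hmc : ContinuousOn m (Set.Icc 0 1) := continuousOn_integral_dilation hfc
  have hlcc := continuousOn_integral_dilation hlc
  have h_int : ∀ g : ℂ → ℝ, ContinuousOn g unitClosedDisk → ∀ r ∈ Set.Icc (0 : ℝ) 1,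
      IntegrableOn (fun z => g (r * z)) unitDisk := by
    intro g hg r hr
    refine IntegrableOn.mono_set ?_ hsub
    exact ContinuousOn.integrableOn_compact (isCompact_closedBall (0 : ℂ) 1)
      (hg.comp (by fun_prop) fun z hz => real_mul_mem_closedDisk hr hz)
  have hm0 : ∀ r ∈ Set.Icc (0 : ℝ) 1, 0 ≤ m r := fun r hr =>
    setIntegral_nonneg Metric.isOpen_ball.measurableSet fun z hz =>
      hf0 _ (real_mul_mem_closedDisk hr (hsub hz))
  have hmr : ∀ r ∈ Set.Ioc (0 : ℝ) 1, r ^ 2 * m r ≤ 2 * Real.pi := by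
    intro r hr
    have e1 := Measure.setIntegral_comp_smul_of_pos (μ := volume) f unitDisk hr.1
    simp only [Complex.real_smul, Complex.finrank_real_complex, smul_eq_mul] at e1
    rw [hm]; dsimp only
    rw [e1, ← mul_assoc, mul_inv_cancel₀ (by have := hr.1; positivity), one_mul]
    refine le_trans (setIntegral_mono_set ?_ ?_ ?_) hfm
    · simpa using h_int f hfc 1 ⟨zero_le_one, le_rfl⟩
    · filter_upwards [ae_restrict_mem Metric.isOpen_ball.measurableSet] with z hz
      exact hf0 z (hsub hz)
    · refine LE.le.eventuallyLE ?_
      rw [unitDisk, smul_unitBall_of_pos hr.1]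
      exact Metric.ball_subset_ball hr.2
  set c := 1 / (2 * Real.pi) with hc
  have hc0 : 0 < c := by positivity
  have hcpi : c * (2 * Real.pi) = 1 := by rw [hc]; field_simp
  have hkc : ContinuousOn (fun r => r * m r) (Set.Icc 0 1) := continuousOn_id.mul hmc
  have hpt : w 0 ≤ ε + c * ∫ r in (0 : ℝ)..1, r * m r := by
    have e1 := circle_integral_sub h0 h1 h2 hl hlc le_rfl zero_le_one le_rfl
    simp only [Complex.ofReal_zero, zero_mul, Complex.ofReal_one, one_mul,
      intervalIntegral.integral_const, smul_eq_mul] at e1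
    have e2 : ∫ θ in (-Real.pi)..Real.pi, w (circ 1 θ) ≤ ∫ θ in (-Real.pi)..Real.pi, ε := by
      refine intervalIntegral.integral_mono_on hpp (Continuous.intervalIntegrable ?_ _ _)
        intervalIntegrable_const fun θ _ => hw _ (circ_mem hn1 θ)
      exact hwc.comp_continuous hcc fun θ => circ_mem_closed hn1 θ
    have e3 : -(∫ r in (0 : ℝ)..1, r * ∫ z in unitDisk, l (r * z)) ≤
        ∫ r in (0 : ℝ)..1, r * m r := by
      rw [← intervalIntegral.integral_neg]
      refine intervalIntegral.integral_mono_on zero_le_one ?_ ?_ fun r hr => ?_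
      · apply ContinuousOn.intervalIntegrable
        rw [Set.uIcc_of_le zero_le_one]
        exact (continuousOn_id.mul hlcc).neg
      · apply ContinuousOn.intervalIntegrable
        rwa [Set.uIcc_of_le zero_le_one]
      · rw [← mul_neg, ← integral_neg]
        refine mul_le_mul_of_nonneg_left ?_ hr.1
        refine setIntegral_mono_on (h_int l hlc r hr).neg (h_int f hfc r hr)
          Metric.isOpen_ball.measurableSet fun z hz => hfl _ (real_mul_mem_closedDisk hr (hsub hz))
    rw [intervalIntegral.integral_const, smul_eq_mul] at e2
    have e4 : 2 * Real.pi * w 0 ≤ 2 * Real.pi * ε + ∫ r in (0 : ℝ)..1, r * m r := by linarith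
    have e5 := mul_le_mul_of_nonneg_left e4 hc0.le
    have e6 : ∀ x : ℝ, c * (2 * Real.pi * x) = x := fun x => by rw [← mul_assoc, hcpi, one_mul]
    rwa [mul_add, e6, e6] at e5
  set Φ : ℝ → ℝ := fun s => ∫ r in s..1, r * m r with hΦ
  set y : ℝ → ℝ := fun s => Real.exp (c * Φ s) with hy
  have hIk : ∀ a ∈ Set.Icc (0 : ℝ) 1, ∀ b ∈ Set.Icc (0 : ℝ) 1,
      IntervalIntegrable (fun r => r * m r) volume a b := fun a ha b hb =>
    (hkc.mono (Set.uIcc_subset_Icc ha hb)).intervalIntegrable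
  have h1m : (1 : ℝ) ∈ Set.Icc (0 : ℝ) 1 := ⟨zero_le_one, le_rfl⟩
  have h0m : (0 : ℝ) ∈ Set.Icc (0 : ℝ) 1 := ⟨le_rfl, zero_le_one⟩
  have hΦc : ContinuousOn Φ (Set.Icc 0 1) := by
    have := intervalIntegral.continuousOn_primitive_interval' (a := 1) (b₁ := 0) (b₂ := 1)
      (f := fun r => r * m r) (μ := volume) (hIk 0 h0m 1 h1m)
      (by rw [Set.uIcc_of_le zero_le_one]; exact h1m)
    rw [Set.uIcc_of_le zero_le_one] at this
    refine this.neg.congr fun s _ => ?_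
    rw [hΦ]; exact intervalIntegral.integral_symm _ _
  have hΦd : ∀ s ∈ Set.Ioo (0 : ℝ) 1, HasDerivAt Φ (-(s * m s)) s := by
    intro s hs
    have hnh : Set.Icc (0 : ℝ) 1 ∈ nhds s := Icc_mem_nhds hs.1 hs.2
    refine intervalIntegral.integral_hasDerivAt_left (hIk s ⟨hs.1.le, hs.2.le⟩ 1 h1m) ?_
      (hkc.continuousAt hnh)
    exact hkc.stronglyMeasurableAtFilter_nhdsWithin measurableSet_Icc s |>.filter_mono
      (by rw [nhdsWithin_eq_nhds.2 hnh])
  have hyb : ∀ s ∈ Set.Ioc (0 : ℝ) 1, y s ≤ 1 / s := by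
    intro s hs
    have hb1 : Φ s ≤ ∫ r in s..1, 2 * Real.pi * r⁻¹ := by
      refine intervalIntegral.integral_mono_on hs.2 (hIk s ⟨hs.1.le, hs.2⟩ 1 h1m) ?_ fun r hr => ?_
      · apply ContinuousOn.intervalIntegrable
        rw [Set.uIcc_of_le hs.2]
        exact continuousOn_const.mul (continuousOn_inv₀.mono fun r hr => (hs.1.trans_le hr.1).ne')
      · have hr0 : 0 < r := hs.1.trans_le hr.1
        have := hmr r ⟨hr0, hr.2⟩
        rw [← div_eq_mul_inv, le_div_iff₀ hr0]
        nlinarith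
    rw [intervalIntegral.integral_const_mul, integral_inv_of_pos hs.1 one_pos, one_div,
      Real.log_inv] at hb1
    have hb2 : c * Φ s ≤ -Real.log s := by
      have := mul_le_mul_of_nonneg_left hb1 hc0.le
      rwa [← mul_assoc, hcpi, one_mul] at this
    calc y s ≤ Real.exp (-Real.log s) := Real.exp_le_exp.2 hb2
      _ = 1 / s := by rw [Real.exp_neg, Real.exp_log hs.1, one_div]
  have hyc : ContinuousOn y (Set.Icc 0 1) := (continuousOn_const.mul hΦc).rexp
  have hyi : ContinuousOn (fun s => Real.exp (c * Φ s) * (c * -(s * m s))) (Set.Icc 0 1) :=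
    hyc.mul (continuousOn_const.mul hkc.neg)
  have hFTC : ∫ s in (0 : ℝ)..1, Real.exp (c * Φ s) * (c * -(s * m s)) = y 1 - y 0 :=
    intervalIntegral.integral_eq_sub_of_hasDerivAt_of_le zero_le_one hyc
      (fun s hs => ((hΦd s hs).const_mul c).exp)
      (ContinuousOn.intervalIntegrable (by rwa [Set.uIcc_of_le zero_le_one]))
  have hy1 : y 1 = 1 := by simp [hy, hΦ]
  have hlast : -∫ s in (0 : ℝ)..1, Real.exp (c * Φ s) * (c * -(s * m s)) ≤
      c * ∫ s in (0 : ℝ)..1, m s := by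
    rw [← intervalIntegral.integral_neg, ← intervalIntegral.integral_const_mul]
    refine intervalIntegral.integral_mono_on zero_le_one ?_ ?_ fun s hs => ?_
    · apply ContinuousOn.intervalIntegrable
      rw [Set.uIcc_of_le zero_le_one]
      exact hyi.neg
    · apply ContinuousOn.intervalIntegrable
      rw [Set.uIcc_of_le zero_le_one]
      exact continuousOn_const.mul hmc
    · have hms := hm0 s hs
      rcases hs.1.eq_or_lt with h | h
      · rw [show Real.exp (c * Φ s) * (c * -(s * m s)) = 0 by rw [← h]; ring, neg_zero]
        exact mul_nonneg hc0.le hms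
      · have := hyb s ⟨h, hs.2⟩
        rw [le_div_iff₀ h] at this
        have : y s * s * (c * m s) ≤ 1 * (c * m s) :=
          mul_le_mul_of_nonneg_right this (by positivity)
        simp only [hy] at this
        linarith
  have hfin : y 0 ≤ 1 + c * ∫ s in (0 : ℝ)..1, m s := by linarith
  calc Real.exp (w 0) ≤ Real.exp (ε + c * Φ 0) := Real.exp_le_exp.2 hpt
    _ = Real.exp ε * y 0 := by rw [Real.exp_add]
    _ ≤ _ := mul_le_mul_of_nonneg_left hfin (Real.exp_pos _).le

theorem det_smul_one_complex (c : ℂ) :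
    (c • (1 : ℂ →L[ℝ] ℂ)).det = ‖c‖ ^ 2 := by
  rw [← Complex.normSq_eq_norm_sq, ← Algebra.norm_complex_apply, Algebra.norm_apply]
  rfl

theorem setLIntegral_disk_eq_ofReal {f : ℂ → ℝ} (hf : ContinuousOn f unitClosedDisk)
    (h0 : ∀ z ∈ unitClosedDisk, 0 ≤ f z) :
    ∫⁻ z in unitDisk, ENNReal.ofReal (f z) = ENNReal.ofReal (∫ z in unitDisk, f z) := by
  have hsub : unitDisk ⊆ unitClosedDisk := Metric.ball_subset_closedBall
  refine (ofReal_integral_eq_lintegral_ofReal ?_ ?_).symm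
  · exact (hf.integrableOn_compact (isCompact_closedBall (0 : ℂ) 1)).mono_set hsub
  · filter_upwards [ae_restrict_mem Metric.isOpen_ball.measurableSet] with z hz
    exact h0 z (hsub hz)

theorem integral_norm_sq_dilation_le {P P' P'' : ℂ → ℂ}
    (hP : ∀ z ∈ unitClosedDisk, HasDerivAt P (P' z) z)
    (hP' : ∀ z ∈ unitClosedDisk, HasDerivAt P' (P'' z) z) {r : ℝ} (hr : r ∈ Set.Icc (0 : ℝ) 1) :
    ∫ z in unitDisk, ‖P (r * z)‖ ^ 2 ≤ ∫ z in unitDisk, ‖P z‖ ^ 2 := by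
  have hn1 : ‖(1 : ℂ)‖ = 1 := by simp
  have hpp : -Real.pi ≤ Real.pi := by linarith [Real.pi_pos]
  have hPc : ContinuousOn P unitClosedDisk := fun z hz => (hP z hz).continuousAt.continuousWithinAt
  have hP'c : ContinuousOn P' unitClosedDisk :=
    fun z hz => (hP' z hz).continuousAt.continuousWithinAt
  have hmono : ∀ a b : ℝ, 0 ≤ a → a ≤ b → b ≤ 1 →
      ∫ θ in (-Real.pi)..Real.pi, ‖P (a * circ 1 θ)‖ ^ 2 ≤
        ∫ θ in (-Real.pi)..Real.pi, ‖P (b * circ 1 θ)‖ ^ 2 := by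
    intro a b ha hab hb
    have h0 : ∀ z ∈ unitClosedDisk, HasPD (fun z => ‖P z‖ ^ 2)
        (2 * ((P z).re * (P' z).re + (P z).im * (P' z).im))
        (2 * ((P z).im * (P' z).re - (P z).re * (P' z).im)) z := by
      intro z hz
      have h1 := HasPD.re (hP z hz)
      have h2 := HasPD.im (hP z hz)
      have h3 := (h1.mul h1).add (h2.mul h2)
      have e : (fun z => ‖P z‖ ^ 2) = fun z => (P z).re * (P z).re + (P z).im * (P z).im := by
        ext z; rw [← Complex.normSq_eq_norm_sq, Complex.normSq_apply]
      rw [e]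
      convert! h3 using 1 <;> ring
    have h1 := fun z hz => (((HasPD.re (hP z hz)).mul (HasPD.re (hP' z hz))).add
      ((HasPD.im (hP z hz)).mul (HasPD.im (hP' z hz)))).const_mul 2
    have h2 := fun z hz => (((HasPD.im (hP z hz)).mul (HasPD.re (hP' z hz))).sub
      ((HasPD.re (hP z hz)).mul (HasPD.im (hP' z hz)))).const_mul 2
    have h := circle_integral_sub h0 h1 h2 (l := fun z => 4 * ‖P' z‖ ^ 2)
      (fun z hz => by
        rw [← Complex.normSq_eq_norm_sq, Complex.normSq_apply]; ring)
      (continuousOn_const.mul (hP'c.norm.pow 2)) ha hab hb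
    rw [← sub_nonneg, h]
    refine intervalIntegral.integral_nonneg hab fun t ht => mul_nonneg (ha.trans ht.1) ?_
    exact integral_nonneg fun z => by positivity
  have hrc : ContinuousOn (fun z : ℂ => ‖P (r * z)‖ ^ 2) unitClosedDisk :=
    (hPc.comp (by fun_prop) fun z hz => real_mul_mem_closedDisk hr hz).norm.pow 2
  have hPn : ContinuousOn (fun z : ℂ => ‖P z‖ ^ 2) unitClosedDisk := hPc.norm.pow 2
  rw [integral_disk_polar hrc, integral_disk_polar hPn]
  have h_int : ∀ f : ℂ → ℝ, ContinuousOn f unitClosedDisk → IntervalIntegrable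
      (fun t : ℝ => ∫ θ in (-Real.pi)..Real.pi, t * f (t * circ 1 θ)) volume 0 1 := by
    intro f hf
    apply ContinuousOn.intervalIntegrable
    rw [Set.uIcc_of_le zero_le_one]
    have hcc := continuous_circ 1
    obtain ⟨B, hB⟩ := (isCompact_closedBall (0 : ℂ) 1).exists_bound_of_continuousOn hf
    have hmem : ∀ t ∈ Set.Icc (0 : ℝ) 1, ∀ θ, (t * circ 1 θ : ℂ) ∈ unitClosedDisk :=
      fun t ht θ => real_mul_mem_closedDisk ht (circ_mem_closed hn1 θ)
    simp_rw [intervalIntegral.integral_of_le hpp]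
    refine continuousOn_of_dominated (bound := fun _ => B) (fun t ht => ?_) (fun t ht => ?_)
      (integrable_const B) (Eventually.of_forall fun θ => ?_)
    · exact (continuous_const.mul (hf.comp_continuous (by fun_prop)
        (hmem t ht))).aestronglyMeasurable
    · refine Eventually.of_forall fun θ => ?_
      rw [norm_mul, Real.norm_of_nonneg ht.1]
      exact (mul_le_of_le_one_left (norm_nonneg _) ht.2).trans (hB _ (hmem t ht θ))
    · exact continuousOn_id.mul (hf.comp (by fun_prop) fun t ht => hmem t ht θ)
  refine intervalIntegral.integral_mono_on zero_le_one (h_int _ hrc) (h_int _ hPn)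
    fun t ht => ?_
  rw [intervalIntegral.integral_const_mul, intervalIntegral.integral_const_mul]
  refine mul_le_mul_of_nonneg_left ?_ ht.1
  have := hmono (r * t) t (mul_nonneg hr.1 ht.1) (mul_le_of_le_one_left ht.1 hr.2) ht.2
  simpa [mul_assoc] using this

/-- The involutive automorphism of the disk exchanging `0` and `q`. -/
def diskInvolution (q y : ℂ) : ℂ := (q - y) / (1 - starRingEnd ℂ q * y)

/-- The derivative of `diskInvolution q`. -/
def diskInvolutionDeriv (q y : ℂ) : ℂ :=
  (starRingEnd ℂ q * q - 1) / (1 - starRingEnd ℂ q * y) ^ 2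

theorem one_sub_conj_mul_ne_zero {q y : ℂ} (hq : ‖q‖ < 1) (hy : ‖y‖ ≤ 1) :
    1 - starRingEnd ℂ q * y ≠ 0 := by
  intro h
  have h1 : ‖starRingEnd ℂ q * y‖ = 1 := by rw [← sub_eq_zero.1 h]; simp
  rw [norm_mul, RCLike.norm_conj] at h1
  nlinarith [norm_nonneg q, norm_nonneg y]

theorem hasDerivAt_diskInvolution {q y : ℂ} (hq : ‖q‖ < 1) (hy : ‖y‖ ≤ 1) :
    HasDerivAt (diskInvolution q) (diskInvolutionDeriv q y) y := by
  have hd := one_sub_conj_mul_ne_zero hq hy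
  have h1 : HasDerivAt (fun y => q - y) (-1) y := (hasDerivAt_id y).const_sub q
  have h2 : HasDerivAt (fun y => 1 - starRingEnd ℂ q * y) (-(starRingEnd ℂ q)) y := by
    simpa using ((hasDerivAt_id y).const_mul (starRingEnd ℂ q)).const_sub 1
  convert! h1.div h2 hd using 1
  unfold diskInvolutionDeriv
  congr 1; ring

theorem hasDerivAt_diskInvolutionDeriv {q y : ℂ} (hq : ‖q‖ < 1) (hy : ‖y‖ ≤ 1) :
    HasDerivAt (diskInvolutionDeriv q)
      ((starRingEnd ℂ q * q - 1) * (2 * starRingEnd ℂ q) / (1 - starRingEnd ℂ q * y) ^ 3) y := by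
  have hd := one_sub_conj_mul_ne_zero hq hy
  have h2 : HasDerivAt (fun y => 1 - starRingEnd ℂ q * y) (-(starRingEnd ℂ q)) y := by
    simpa using ((hasDerivAt_id y).const_mul (starRingEnd ℂ q)).const_sub 1
  convert! (hasDerivAt_const y (starRingEnd ℂ q * q - 1)).div (h2.pow 2) (pow_ne_zero 2 hd) using 1
  simp only [Pi.pow_apply]
  field_simp
  ring

theorem hasDerivAt_diskInvolutionDeriv₂ {q y : ℂ} (hq : ‖q‖ < 1) (hy : ‖y‖ ≤ 1) :
    HasDerivAt (fun y => (starRingEnd ℂ q * q - 1) * (2 * starRingEnd ℂ q) /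
        (1 - starRingEnd ℂ q * y) ^ 3)
      ((starRingEnd ℂ q * q - 1) * (6 * starRingEnd ℂ q ^ 2) / (1 - starRingEnd ℂ q * y) ^ 4) y := by
  have hd := one_sub_conj_mul_ne_zero hq hy
  have h2 : HasDerivAt (fun y => 1 - starRingEnd ℂ q * y) (-(starRingEnd ℂ q)) y := by
    simpa using ((hasDerivAt_id y).const_mul (starRingEnd ℂ q)).const_sub 1
  convert! (hasDerivAt_const y ((starRingEnd ℂ q * q - 1) * (2 * starRingEnd ℂ q))).div (h2.pow 3)
    (pow_ne_zero 3 hd) using 1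
  simp only [Pi.pow_apply]
  field_simp
  ring

theorem diskInvolution_zero (q : ℂ) : diskInvolution q 0 = q := by simp [diskInvolution]

theorem diskInvolution_diskInvolution {q y : ℂ} (hq : ‖q‖ < 1) (hy : ‖y‖ ≤ 1) :
    diskInvolution q (diskInvolution q y) = y := by
  have hd := one_sub_conj_mul_ne_zero hq hy
  have hd' := one_sub_conj_mul_ne_zero hq hq.le
  unfold diskInvolution
  have e1 : q - (q - y) / (1 - starRingEnd ℂ q * y) =
      y * (1 - starRingEnd ℂ q * q) / (1 - starRingEnd ℂ q * y) := by
    rw [sub_div' hd]; congr 1; ring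
  have e2 : 1 - starRingEnd ℂ q * ((q - y) / (1 - starRingEnd ℂ q * y)) =
      (1 - starRingEnd ℂ q * q) / (1 - starRingEnd ℂ q * y) := by
    rw [← mul_div_assoc, sub_div' hd]; congr 1; ring
  rw [e1, e2, div_div_div_cancel_right₀ hd, mul_div_assoc, div_self hd', mul_one]

theorem norm_sub_sq_eq (q y : ℂ) : ‖q - y‖ ^ 2 =
    ‖1 - starRingEnd ℂ q * y‖ ^ 2 - (1 - ‖q‖ ^ 2) * (1 - ‖y‖ ^ 2) := by
  simp only [← Complex.normSq_eq_norm_sq, Complex.normSq_apply]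
  simp
  ring

theorem norm_diskInvolution_lt {q y : ℂ} (hq : ‖q‖ < 1) (hy : ‖y‖ < 1) :
    ‖diskInvolution q y‖ < 1 := by
  have hd := one_sub_conj_mul_ne_zero hq hy.le
  rw [diskInvolution, norm_div, div_lt_one (norm_pos_iff.2 hd)]
  refine lt_of_pow_lt_pow_left₀ 2 (norm_nonneg _) ?_
  rw [norm_sub_sq_eq]
  have h1 : 0 < 1 - ‖q‖ ^ 2 := by nlinarith [norm_nonneg q]
  have h2 : 0 < 1 - ‖y‖ ^ 2 := by nlinarith [norm_nonneg y]
  nlinarith [mul_pos h1 h2]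

theorem norm_diskInvolution_eq {q y : ℂ} (hq : ‖q‖ < 1) (hy : ‖y‖ = 1) :
    ‖diskInvolution q y‖ = 1 := by
  have hd := one_sub_conj_mul_ne_zero hq hy.le
  rw [diskInvolution, norm_div, div_eq_one_iff_eq (norm_ne_zero_iff.2 hd)]
  have h := norm_sub_sq_eq q y
  rw [hy] at h
  refine (pow_left_inj₀ (norm_nonneg _) (norm_nonneg _) two_ne_zero).1 ?_
  linarith

theorem norm_diskInvolution_le {q y : ℂ} (hq : ‖q‖ < 1) (hy : ‖y‖ ≤ 1) :
    ‖diskInvolution q y‖ ≤ 1 := by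
  rcases hy.eq_or_lt with h | h
  · exact (norm_diskInvolution_eq hq h).le
  · exact (norm_diskInvolution_lt hq h).le

/-- The indicator of a pseudo-hyperbolic disk of radius `r`. -/
def pseudoKernel (r : ℝ) (q z : ℂ) : ENNReal :=
  if ‖q - z‖ < r * ‖1 - starRingEnd ℂ q * z‖ then 1 else 0

theorem pseudoKernel_comm (r : ℝ) (q z : ℂ) : pseudoKernel r q z = pseudoKernel r z q := by
  have h : ‖1 - starRingEnd ℂ q * z‖ = ‖1 - starRingEnd ℂ z * q‖ := by
    rw [← RCLike.norm_conj (1 - starRingEnd ℂ q * z)]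
    simp [mul_comm]
  simp only [pseudoKernel, h, norm_sub_rev q z]

theorem measurable_pseudoKernel :
    Measurable fun x : ℝ × ℂ × ℂ => pseudoKernel x.1 x.2.1 x.2.2 := by
  unfold pseudoKernel
  refine Measurable.ite (measurableSet_lt ?_ ?_) measurable_const measurable_const
  · fun_prop
  · exact Continuous.measurable (by fun_prop)

theorem image_diskInvolution {q : ℂ} (hq : ‖q‖ < 1) {r : ℝ} (hr : r ∈ Set.Ioc (0 : ℝ) 1) :
    (fun y : ℂ => diskInvolution q (r * y)) '' unitDisk =
      unitDisk ∩ {z | ‖q - z‖ < r * ‖1 - starRingEnd ℂ q * z‖} := by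
  have hnr : ∀ y : ℂ, ‖(r * y : ℂ)‖ = r * ‖y‖ := fun y => by
    rw [norm_mul, Complex.norm_real, Real.norm_of_nonneg hr.1.le]
  have key : ∀ z : ℂ, ‖z‖ < 1 → (‖q - z‖ < r * ‖1 - starRingEnd ℂ q * z‖ ↔
      ‖diskInvolution q z‖ < r) := fun z hz => by
    rw [diskInvolution, norm_div, div_lt_iff₀
      (norm_pos_iff.2 (one_sub_conj_mul_ne_zero hq hz.le))]
  ext z
  simp only [unitDisk, Set.mem_image, mem_ball_zero_iff, Set.mem_inter_iff, Set.mem_ofPred_eq]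
  constructor
  · rintro ⟨y, hy, rfl⟩
    have hy' : ‖(r * y : ℂ)‖ < 1 := by
      rw [hnr]; nlinarith [norm_nonneg y, hr.1, hr.2]
    have h1 := norm_diskInvolution_lt hq hy'
    refine ⟨h1, (key _ h1).2 ?_⟩
    rw [diskInvolution_diskInvolution hq hy'.le, hnr]
    nlinarith [hr.1]
  · rintro ⟨hz, h⟩
    have h1 := (key z hz).1 h
    refine ⟨(r : ℂ)⁻¹ * diskInvolution q z, ?_, ?_⟩
    · rw [norm_mul, norm_inv, Complex.norm_real, Real.norm_of_nonneg hr.1.le, inv_mul_lt_iff₀ hr.1]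
      simpa using h1
    · rw [mul_inv_cancel_left₀ (by exact_mod_cast hr.1.ne')]
      exact diskInvolution_diskInvolution hq hz.le

theorem lintegral_pseudoKernel_mul {q : ℂ} (hq : ‖q‖ < 1) {r : ℝ} (hr : r ∈ Set.Ioc (0 : ℝ) 1)
    (G : ℂ → ENNReal) :
    ∫⁻ z in unitDisk, pseudoKernel r q z * G z = ENNReal.ofReal (r ^ 2) * ∫⁻ y in unitDisk,
      ENNReal.ofReal (‖diskInvolutionDeriv q (r * y)‖ ^ 2) * G (diskInvolution q (r * y)) := by
  have hmem : ∀ y ∈ unitDisk, ‖(r * y : ℂ)‖ ≤ 1 := fun y hy => by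
    have := real_mul_mem_closedDisk ⟨hr.1.le, hr.2⟩ (Metric.ball_subset_closedBall hy)
    simpa [unitClosedDisk] using this
  have hS : MeasurableSet {z : ℂ | ‖q - z‖ < r * ‖1 - starRingEnd ℂ q * z‖} :=
    measurableSet_lt (by fun_prop) (Continuous.measurable (by fun_prop))
  have h1 : ∫⁻ z in unitDisk, pseudoKernel r q z * G z =
      ∫⁻ z in unitDisk ∩ {z | ‖q - z‖ < r * ‖1 - starRingEnd ℂ q * z‖}, G z := by
    rw [Set.inter_comm, ← Measure.restrict_restrict hS, ← lintegral_indicator hS]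
    congr 1; ext z
    simp only [pseudoKernel, Set.indicator_apply, Set.mem_ofPred_eq]
    split_ifs <;> simp
  have hder : ∀ y ∈ unitDisk, HasDerivAt (fun y : ℂ => diskInvolution q (r * y))
      (diskInvolutionDeriv q (r * y) * r) y := fun y hy =>
    (hasDerivAt_diskInvolution hq (hmem y hy)).comp y
      (by simpa using (hasDerivAt_id y).const_mul (r : ℂ))
  rw [h1, ← image_diskInvolution hq hr, lintegral_image_eq_lintegral_abs_det_fderiv_mul volume
    (s := unitDisk) Metric.isOpen_ball.measurableSet
    (fun y hy => (hder y hy).complexToReal_fderiv.hasFDerivWithinAt), ← lintegral_const_mul']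
  · refine setLIntegral_congr_fun Metric.isOpen_ball.measurableSet fun y hy => ?_
    rw [det_smul_one_complex, abs_of_nonneg (by positivity), norm_mul, Complex.norm_real,
      Real.norm_of_nonneg hr.1.le, mul_pow, mul_comm, ENNReal.ofReal_mul (by positivity)]
    ring
  · exact ENNReal.ofReal_ne_top
  · intro a ha b hb hab
    have := congrArg (diskInvolution q) hab
    rw [diskInvolution_diskInvolution hq (hmem a ha),
      diskInvolution_diskInvolution hq (hmem b hb)] at this
    exact mul_left_cancel₀ (by exact_mod_cast hr.1.ne') this

theorem lintegral_pseudoKernel_norm_sq_le {P : ℂ → ℂ} (hP : Differentiable ℂ P) {z : ℂ}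
    (hz : ‖z‖ < 1) {r : ℝ} (hr : r ∈ Set.Ioc (0 : ℝ) 1) :
    ∫⁻ q in unitDisk, pseudoKernel r q z * ENNReal.ofReal (‖P q‖ ^ 2) ≤
      ENNReal.ofReal (r ^ 2) * ENNReal.ofReal (∫ q in unitDisk, ‖P q‖ ^ 2) := by
  have hP' : Differentiable ℂ (deriv P) := hP.deriv
  have hmem : ∀ y ∈ unitClosedDisk, ‖y‖ ≤ 1 := fun y hy => by simpa [unitClosedDisk] using hy
  set Q : ℂ → ℂ := fun y => P (diskInvolution z y) * diskInvolutionDeriv z y with hQ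
  have d1 := fun y hy => hasDerivAt_diskInvolution hz (hmem y hy)
  have d2 := fun y hy => hasDerivAt_diskInvolutionDeriv hz (hmem y hy)
  have d3 := fun y hy => hasDerivAt_diskInvolutionDeriv₂ hz (hmem y hy)
  have p1 : ∀ y ∈ unitClosedDisk, HasDerivAt (fun y => P (diskInvolution z y))
      (deriv P (diskInvolution z y) * diskInvolutionDeriv z y) y := fun y hy =>
    (hP (diskInvolution z y)).hasDerivAt.comp y (d1 y hy)
  have p2 : ∀ y ∈ unitClosedDisk, HasDerivAt (fun y => deriv P (diskInvolution z y))
      (deriv (deriv P) (diskInvolution z y) * diskInvolutionDeriv z y) y := fun y hy =>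
    (hP' (diskInvolution z y)).hasDerivAt.comp y (d1 y hy)
  have q1 := fun y hy => (p1 y hy).mul (d2 y hy)
  have q2 := fun y hy => (((p2 y hy).mul (d2 y hy)).mul (d2 y hy)).add ((p1 y hy).mul (d3 y hy))
  have hQc : ContinuousOn Q unitClosedDisk := fun y hy =>
    (q1 y hy).continuousAt.continuousWithinAt
  have hdil : ∫ y in unitDisk, ‖Q (r * y)‖ ^ 2 ≤ ∫ y in unitDisk, ‖Q y‖ ^ 2 :=
    integral_norm_sq_dilation_le q1 q2 ⟨hr.1.le, hr.2⟩
  have hform : ∀ s ∈ Set.Ioc (0 : ℝ) 1,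
      ∫⁻ q in unitDisk, pseudoKernel s q z * ENNReal.ofReal (‖P q‖ ^ 2) =
        ENNReal.ofReal (s ^ 2) * ENNReal.ofReal (∫ y in unitDisk, ‖Q (s * y)‖ ^ 2) := by
    intro s hs
    simp_rw [pseudoKernel_comm s _ z]
    rw [lintegral_pseudoKernel_mul hz hs, ← setLIntegral_disk_eq_ofReal]
    · simp only [hQ, norm_mul, mul_pow]
      congr 2; ext y
      rw [← ENNReal.ofReal_mul (by positivity), mul_comm]
    · exact (hQc.comp (by fun_prop) fun y hy =>
        real_mul_mem_closedDisk ⟨hs.1.le, hs.2⟩ hy).norm.pow 2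
    · intro y _; positivity
  rw [hform r hr]
  refine mul_le_mul_right ?_ _
  refine (ENNReal.ofReal_le_ofReal hdil).trans ?_
  have h1 := hform 1 ⟨one_pos, le_rfl⟩
  simp only [one_pow, ENNReal.ofReal_one, one_mul, Complex.ofReal_one] at h1
  rw [← h1, ← setLIntegral_disk_eq_ofReal (f := fun q => ‖P q‖ ^ 2) (hP.continuous.norm.pow 2).continuousOn
    fun y _ => by positivity]
  refine lintegral_mono fun q => ?_
  simp only [pseudoKernel]
  split_ifs <;> simp

theorem ofReal_exp_le_lintegral {v g : ℂ → ℝ} (hv : ContDiff ℝ 2 v) (hg : Continuous g)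
    (hg0 : ∀ z, 0 ≤ g z) (hvg : ∀ z ∈ unitClosedDisk, -lap v z ≤ g z)
    (hgm : ∫ z in unitDisk, g z ≤ 2 * Real.pi) {ε : ℝ} (hε : ∀ z ∈ unitCircle, v z ≤ ε)
    {q : ℂ} (hq : ‖q‖ < 1) :
    ENNReal.ofReal (Real.exp (v q)) ≤ ENNReal.ofReal (Real.exp ε) *
      (1 + ENNReal.ofReal (1 / (2 * Real.pi)) * ∫⁻ r in Set.Ioc (0 : ℝ) 1,
        ENNReal.ofReal ((r ^ 2)⁻¹) *
          ∫⁻ z in unitDisk, pseudoKernel r q z * ENNReal.ofReal (g z)) := by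
  have hmem : ∀ y ∈ unitClosedDisk, ‖y‖ ≤ 1 := fun y hy => by simpa [unitClosedDisk] using hy
  have d1 := fun y hy => hasDerivAt_diskInvolution hq (hmem y hy)
  have d2 := fun y hy => hasDerivAt_diskInvolutionDeriv hq (hmem y hy)
  have hφc : ContinuousOn (diskInvolution q) unitClosedDisk := fun y hy =>
    (d1 y hy).continuousAt.continuousWithinAt
  have hφ'c : ContinuousOn (diskInvolutionDeriv q) unitClosedDisk := fun y hy =>
    (d2 y hy).continuousAt.continuousWithinAt
  have h0 := fun y hy => (hasPD_self (hv.of_le (by norm_num)) _).comp_holomorphic (d1 y hy)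
  have hx := fun y hy => (hasPD_dirDeriv hv 1 _).comp_holomorphic (d1 y hy)
  have hy := fun y hy => (hasPD_dirDeriv hv Complex.I _).comp_holomorphic (d1 y hy)
  have hcr := fun y hy => HasPD.re (d2 y hy)
  have hci := fun y hy => HasPD.im (d2 y hy)
  have h1 := fun y hyy => ((hx y hyy).mul (hcr y hyy)).add ((hy y hyy).mul (hci y hyy))
  have h2 := fun y hyy => (((hx y hyy).mul (hci y hyy)).const_mul (-1)).add
    ((hy y hyy).mul (hcr y hyy))
  set f : ℂ → ℝ := fun y => ‖diskInvolutionDeriv q y‖ ^ 2 * g (diskInvolution q y) with hf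
  have hfc : ContinuousOn f unitClosedDisk :=
    (hφ'c.norm.pow 2).mul (hg.comp_continuousOn hφc)
  have hf0 : ∀ y, 0 ≤ f y := fun y => mul_nonneg (by positivity) (hg0 _)
  have hdil : ∀ r ∈ Set.Ioc (0 : ℝ) 1, ENNReal.ofReal (∫ y in unitDisk, f (r * y)) =
      ENNReal.ofReal ((r ^ 2)⁻¹) *
        ∫⁻ z in unitDisk, pseudoKernel r q z * ENNReal.ofReal (g z) := by
    intro r hr
    have hr2 : 0 < r ^ 2 := pow_pos hr.1 2
    have hfr : ContinuousOn (fun y : ℂ => f (r * y)) unitClosedDisk :=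
      hfc.comp (by fun_prop) fun y hy => real_mul_mem_closedDisk ⟨hr.1.le, hr.2⟩ hy
    rw [lintegral_pseudoKernel_mul hq hr, ← mul_assoc, ← ENNReal.ofReal_mul (by positivity),
      inv_mul_cancel₀ hr2.ne', ENNReal.ofReal_one, one_mul, ← setLIntegral_disk_eq_ofReal hfr
      fun y _ => hf0 _]
    simp_rw [hf]
    congr 1; ext y
    rw [ENNReal.ofReal_mul (by positivity)]
  have hfm : ∫ y in unitDisk, f y ≤ 2 * Real.pi := by
    refine le_trans ?_ hgm
    have e := hdil 1 ⟨one_pos, le_rfl⟩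
    simp only [Complex.ofReal_one, one_mul, one_pow, inv_one, ENNReal.ofReal_one] at e
    rw [← ENNReal.ofReal_le_ofReal_iff (integral_nonneg hg0), e,
      ← setLIntegral_disk_eq_ofReal hg.continuousOn fun y _ => hg0 y]
    refine lintegral_mono fun q => ?_
    simp only [pseudoKernel]
    split_ifs <;> simp
  have hmain := exp_le_of_lap_ge (w := fun y => v (diskInvolution q y)) (f := f)
    (l := fun y => ‖diskInvolutionDeriv q y‖ ^ 2 * lap v (diskInvolution q y))
    h0 h1 (fun y hyy => by convert! h2 y hyy using 1; ext y; ring)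
    (fun y hyy => by
      rw [← Complex.normSq_eq_norm_sq, Complex.normSq_apply]; unfold lap; ring)
    ((hφ'c.norm.pow 2).mul ((continuous_lap hv).comp_continuousOn hφc)) hfc (fun y _ => hf0 y)
    (fun y hyy => by
      have hin : diskInvolution q y ∈ unitClosedDisk := by
        simpa [unitClosedDisk] using norm_diskInvolution_le hq (hmem y hyy)
      have := mul_le_mul_of_nonneg_left (hvg _ hin) (sq_nonneg ‖diskInvolutionDeriv q y‖)
      simp only [hf]; linarith) hfm
    (ε := ε) (fun y hyy => hε _ (by
      have : ‖y‖ = 1 := by simpa [unitCircle] using hyy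
      simpa [unitCircle] using norm_diskInvolution_eq hq this))
  simp only [diskInvolution_zero] at hmain
  have hmc := continuousOn_integral_dilation hfc
  have hI : ENNReal.ofReal (∫ r in (0 : ℝ)..1, ∫ y in unitDisk, f (r * y)) =
      ∫⁻ r in Set.Ioc (0 : ℝ) 1, ENNReal.ofReal ((r ^ 2)⁻¹) *
        ∫⁻ z in unitDisk, pseudoKernel r q z * ENNReal.ofReal (g z) := by
    rw [intervalIntegral.integral_of_le zero_le_one, ofReal_integral_eq_lintegral_ofReal]
    · exact setLIntegral_congr_fun measurableSet_Ioc hdil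
    · exact (hmc.integrableOn_compact isCompact_Icc).mono_set Set.Ioc_subset_Icc_self
    · exact Eventually.of_forall fun r => integral_nonneg fun y => hf0 _
  have hI0 : 0 ≤ ∫ r in (0 : ℝ)..1, ∫ y in unitDisk, f (r * y) :=
    intervalIntegral.integral_nonneg zero_le_one fun r _ => integral_nonneg fun y => hf0 _
  rw [← hI, ← ENNReal.ofReal_mul (by positivity), ← ENNReal.ofReal_one,
    ← ENNReal.ofReal_add zero_le_one (by positivity), ← ENNReal.ofReal_mul (Real.exp_pos _).le]
  exact ENNReal.ofReal_le_ofReal hmain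

theorem lintegral_pseudoKernel_triple_le {P : ℂ → ℂ} (hP : Differentiable ℂ P) {g : ℂ → ℝ}
    (hg : Continuous g) :
    ∫⁻ q in unitDisk, ENNReal.ofReal (‖P q‖ ^ 2) * ∫⁻ r in Set.Ioc (0 : ℝ) 1,
        ENNReal.ofReal ((r ^ 2)⁻¹) *
          ∫⁻ z in unitDisk, pseudoKernel r q z * ENNReal.ofReal (g z) ≤
      (∫⁻ z in unitDisk, ENNReal.ofReal (g z)) *
        ENNReal.ofReal (∫ q in unitDisk, ‖P q‖ ^ 2) := by
  have hPc := hP.continuous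
  have hγ : Measurable fun z => ENNReal.ofReal (g z) := hg.measurable.ennreal_ofReal
  have hw : Measurable fun q => ENNReal.ofReal (‖P q‖ ^ 2) :=
    (hPc.norm.pow 2).measurable.ennreal_ofReal
  have hκ : ∀ r, Measurable fun x : ℂ × ℂ => pseudoKernel r x.1 x.2 := fun r =>
    measurable_pseudoKernel.comp (measurable_const.prodMk measurable_id)
  have hZ : Measurable fun x : ℝ × ℂ =>
      ∫⁻ z in unitDisk, pseudoKernel x.1 x.2 z * ENNReal.ofReal (g z) := by
    refine Measurable.lintegral_prod_right'
      (f := fun y : (ℝ × ℂ) × ℂ => pseudoKernel y.1.1 y.1.2 y.2 * ENNReal.ofReal (g y.2)) ?_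
    refine Measurable.mul ?_ (hγ.comp measurable_snd)
    exact measurable_pseudoKernel.comp (f := fun y : (ℝ × ℂ) × ℂ => (y.1.1, y.1.2, y.2))
      (by fun_prop)
  have hρ : Measurable fun r : ℝ => ENNReal.ofReal ((r ^ 2)⁻¹) := by fun_prop
  have hX : Measurable fun x : ℂ × ℝ => ENNReal.ofReal (‖P x.1‖ ^ 2) *
      (ENNReal.ofReal ((x.2 ^ 2)⁻¹) *
        ∫⁻ z in unitDisk, pseudoKernel x.2 x.1 z * ENNReal.ofReal (g z)) :=
    (hw.comp measurable_fst).mul ((hρ.comp measurable_snd).mul (hZ.comp measurable_swap))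
  have h1 : ∀ q, Measurable fun r : ℝ => ENNReal.ofReal ((r ^ 2)⁻¹) *
      ∫⁻ z in unitDisk, pseudoKernel r q z * ENNReal.ofReal (g z) := fun q =>
    hρ.mul (hZ.comp (measurable_id.prodMk measurable_const))
  simp_rw [← lintegral_const_mul _ (h1 _)]
  rw [lintegral_lintegral_swap hX.aemeasurable]
  calc _ ≤ ∫⁻ r in Set.Ioc (0 : ℝ) 1, (∫⁻ z in unitDisk, ENNReal.ofReal (g z)) *
        ENNReal.ofReal (∫ q in unitDisk, ‖P q‖ ^ 2) := ?_
    _ = _ := by simp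
  refine setLIntegral_mono measurable_const fun r hr => ?_
  have hr2 : 0 < r ^ 2 := pow_pos hr.1 2
  calc _ = ENNReal.ofReal ((r ^ 2)⁻¹) * ∫⁻ q in unitDisk, ∫⁻ z in unitDisk,
        ENNReal.ofReal (‖P q‖ ^ 2) * (pseudoKernel r q z * ENNReal.ofReal (g z)) := by
        rw [← lintegral_const_mul' _ _ ENNReal.ofReal_ne_top]
        congr 1; ext q
        rw [lintegral_const_mul' _ _ ENNReal.ofReal_ne_top]
        ring
    _ = ENNReal.ofReal ((r ^ 2)⁻¹) * ∫⁻ z in unitDisk, ENNReal.ofReal (g z) *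
        ∫⁻ q in unitDisk, pseudoKernel r q z * ENNReal.ofReal (‖P q‖ ^ 2) := by
        rw [lintegral_lintegral_swap]
        · congr 2; ext z
          rw [← lintegral_const_mul' _ _ ENNReal.ofReal_ne_top]
          congr 1; ext q
          ring
        · exact Measurable.aemeasurable ((hw.comp measurable_fst).mul
            ((hκ r).mul (hγ.comp measurable_snd)))
    _ ≤ ENNReal.ofReal ((r ^ 2)⁻¹) * ∫⁻ z in unitDisk, ENNReal.ofReal (g z) *
        (ENNReal.ofReal (r ^ 2) * ENNReal.ofReal (∫ q in unitDisk, ‖P q‖ ^ 2)) := by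
        refine mul_le_mul_right (setLIntegral_mono (hγ.mul_const _) fun z hz => ?_) _
        refine mul_le_mul_right ?_ _
        exact lintegral_pseudoKernel_norm_sq_le hP (by simpa [unitDisk] using hz) hr
    _ = _ := by
        rw [lintegral_mul_const _ hγ, mul_left_comm, ← mul_assoc (ENNReal.ofReal ((r ^ 2)⁻¹)),
          ← ENNReal.ofReal_mul (by positivity), inv_mul_cancel₀ hr2.ne', ENNReal.ofReal_one,
          one_mul]

/-- A weighted area comparison for almost superharmonic weights. -/
theorem integral_norm_sq_mul_exp_le {P : ℂ → ℂ} (hP : Differentiable ℂ P) {v g : ℂ → ℝ}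
    (hv : ContDiff ℝ 2 v) (hg : Continuous g) (hg0 : ∀ z, 0 ≤ g z)
    (hvg : ∀ z ∈ unitClosedDisk, -lap v z ≤ g z) {δ : ℝ} (hgm : ∫ z in unitDisk, g z ≤ δ)
    (hδ : δ ≤ 2 * Real.pi) {ε : ℝ} (hε : ∀ z ∈ unitCircle, v z ≤ ε) :
    ∫ z in unitDisk, ‖P z‖ ^ 2 * Real.exp (v z) ≤
      Real.exp ε * (1 + δ / (2 * Real.pi)) * ∫ z in unitDisk, ‖P z‖ ^ 2 := by
  have hPc := hP.continuous
  have hδ0 : 0 ≤ δ := (integral_nonneg hg0).trans hgm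
  set A := ∫ z in unitDisk, ‖P z‖ ^ 2 with hA
  have hA0 : 0 ≤ A := integral_nonneg fun z => by positivity
  have hw : Measurable fun q => ENNReal.ofReal (‖P q‖ ^ 2) :=
    (hPc.norm.pow 2).measurable.ennreal_ofReal
  rw [← ENNReal.ofReal_le_ofReal_iff (by positivity), ← setLIntegral_disk_eq_ofReal
    (by have := hv.continuous; fun_prop) (fun z _ => by positivity)]
  set T : ℂ → ENNReal := fun q => ∫⁻ r in Set.Ioc (0 : ℝ) 1, ENNReal.ofReal ((r ^ 2)⁻¹) *
    ∫⁻ z in unitDisk, pseudoKernel r q z * ENNReal.ofReal (g z) with hT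
  calc _ ≤ ∫⁻ q in unitDisk, ENNReal.ofReal (Real.exp ε) * (ENNReal.ofReal (‖P q‖ ^ 2) +
        ENNReal.ofReal (1 / (2 * Real.pi)) * (ENNReal.ofReal (‖P q‖ ^ 2) * T q)) := by
        refine setLIntegral_mono' Metric.isOpen_ball.measurableSet fun q hq => ?_
        rw [ENNReal.ofReal_mul (by positivity)]
        refine (mul_le_mul_right (ofReal_exp_le_lintegral hv hg hg0 hvg (hgm.trans hδ) hε
          (by simpa [unitDisk] using hq)) _).trans (le_of_eq ?_)
        simp only [hT]
        ring
    _ = ENNReal.ofReal (Real.exp ε) * ((∫⁻ q in unitDisk, ENNReal.ofReal (‖P q‖ ^ 2)) +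
        ENNReal.ofReal (1 / (2 * Real.pi)) *
          ∫⁻ q in unitDisk, ENNReal.ofReal (‖P q‖ ^ 2) * T q) := by
        rw [lintegral_const_mul' _ _ ENNReal.ofReal_ne_top, lintegral_add_left hw,
          lintegral_const_mul' _ _ ENNReal.ofReal_ne_top]
    _ ≤ ENNReal.ofReal (Real.exp ε) * (ENNReal.ofReal A +
        ENNReal.ofReal (1 / (2 * Real.pi)) * (ENNReal.ofReal δ * ENNReal.ofReal A)) := by
        rw [setLIntegral_disk_eq_ofReal (f := fun z => ‖P z‖ ^ 2) (hPc.norm.pow 2).continuousOn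
          fun z _ => by positivity]
        gcongr
        refine (lintegral_pseudoKernel_triple_le hP hg).trans ?_
        rw [setLIntegral_disk_eq_ofReal hg.continuousOn fun z _ => hg0 z]
        gcongr
    _ = _ := by
        rw [← ENNReal.ofReal_mul hδ0, ← ENNReal.ofReal_mul (by positivity),
          ← ENNReal.ofReal_add hA0 (by positivity), ← ENNReal.ofReal_mul (Real.exp_pos _).le]
        congr 1; ring

theorem abs_re_le_of_circ {P : ℂ → ℂ} (hP : Differentiable ℂ P) {p : ℂ} (hp : ‖p‖ = 1) {S : ℝ}
    (h : ∀ θ ∈ Set.Icc (-Real.pi) Real.pi, |(P (circ p θ)).re| ≤ S) :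
    ∀ z ∈ unitClosedDisk, |(P z).re| ≤ S := by
  have key : ∀ Q : ℂ → ℂ, Differentiable ℂ Q →
      (∀ θ ∈ Set.Icc (-Real.pi) Real.pi, (Q (circ p θ)).re ≤ S) →
      ∀ z ∈ unitClosedDisk, (Q z).re ≤ S := by
    intro Q hQ hQS z hz
    have h1 := norm_le_of_circ (F := fun z => Complex.exp (Q z)) hQ.cexp hp (C := Real.exp S)
      (fun θ hθ => by rw [Complex.norm_exp]; exact Real.exp_le_exp.2 (hQS θ hθ)) z hz
    rw [Complex.norm_exp] at h1
    exact Real.exp_le_exp.1 h1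
  intro z hz
  refine abs_le.2 ⟨?_, key P hP (fun θ hθ => (abs_le.1 (h θ hθ)).2) z hz⟩
  have := key (fun z => -P z) hP.neg (fun θ hθ => by
    have := (abs_le.1 (h θ hθ)).1
    simp only [Complex.neg_re]; linarith) z hz
  simp only [Complex.neg_re] at this
  linarith

theorem integral_re_mul_re_comm {P G : ℂ → ℂ} (hP : Differentiable ℂ P) (hG : Differentiable ℂ G)
    (p : ℂ) :
    ∫ θ in (-Real.pi)..Real.pi, (P (circ p θ)).re * (circ p θ * deriv G (circ p θ)).re =
      ∫ θ in (-Real.pi)..Real.pi, (G (circ p θ)).re * (circ p θ * deriv P (circ p θ)).re := by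
  have hc := continuous_circ p
  have hPc := hP.continuous
  have hGc := hG.continuous
  have hP'c := hP.deriv.continuous
  have hG'c := hG.deriv.continuous
  have key : ∀ P G : ℂ → ℂ, Differentiable ℂ P → Differentiable ℂ G → ∀ θ,
      HasDerivAt (fun θ => (P (circ p θ)).re * (G (circ p θ)).im)
        (-(circ p θ * deriv P (circ p θ)).im * (G (circ p θ)).im +
          (P (circ p θ)).re * (circ p θ * deriv G (circ p θ)).re) θ := by
    intro P G hP hG θ
    have h1 := hasDerivAt_entire_circ hP p θ
    have h2 := hasDerivAt_entire_circ hG p θ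
    have h3 := (Complex.reCLM.hasFDerivAt.comp_hasDerivAt θ h1).mul
      (Complex.imCLM.hasFDerivAt.comp_hasDerivAt θ h2)
    convert! h3 using 1
    simp
  have z1 := integral_periodic_deriv_eq_zero (key P G hP hG) (by fun_prop)
    (by simp only [circ_pi])
  have z2 := integral_periodic_deriv_eq_zero (key G P hG hP) (by fun_prop)
    (by simp only [circ_pi])
  have hz : (0 : ℂ) * 0 = 0 := by simp
  have hQ : Differentiable ℂ fun z => z * (deriv P z * G z - P z * deriv G z) := by
    have := hP.deriv
    have := hG.deriv
    fun_prop
  have z3 := integral_re_entire_circ hQ p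
  simp only [zero_mul, Complex.zero_re, mul_zero] at z3
  rw [intervalIntegral.integral_add (Continuous.intervalIntegrable (by fun_prop) _ _)
    (Continuous.intervalIntegrable (by fun_prop) _ _)] at z1 z2
  have e : ∫ θ in (-Real.pi)..Real.pi,
      (circ p θ * (deriv P (circ p θ) * G (circ p θ) - P (circ p θ) * deriv G (circ p θ))).re =
      (((∫ θ in (-Real.pi)..Real.pi, (G (circ p θ)).re * (circ p θ * deriv P (circ p θ)).re) -
        ∫ θ in (-Real.pi)..Real.pi, (P (circ p θ)).re * (circ p θ * deriv G (circ p θ)).re) +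
        ∫ θ in (-Real.pi)..Real.pi, -(circ p θ * deriv P (circ p θ)).im * (G (circ p θ)).im) -
        ∫ θ in (-Real.pi)..Real.pi, -(circ p θ * deriv G (circ p θ)).im * (P (circ p θ)).im := by
    rw [← intervalIntegral.integral_sub, ← intervalIntegral.integral_add,
      ← intervalIntegral.integral_sub]
    · refine intervalIntegral.integral_congr fun θ _ => ?_
      simp only [Complex.mul_re, Complex.sub_re, Complex.sub_im, Complex.mul_im]
      ring
    all_goals exact Continuous.intervalIntegrable (by fun_prop) _ _
  linarith

theorem abs_integral_re_mul_le {u : ℂ → ℝ} (hu : ContDiff ℝ 2 u) {G : ℂ → ℂ}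
    (hG : Differentiable ℂ G) {p : ℂ} (hp : ‖p‖ = 1) {ε : ℝ}
    (hGε : ∀ θ ∈ Set.Icc (-Real.pi) Real.pi,
      |-(circ p θ * deriv G (circ p θ)).im - tangentialDeriv u (circ p θ)| ≤ ε)
    {P : ℂ → ℂ} (hP : Differentiable ℂ P) {S : ℝ} (hS0 : 0 < S)
    (hS : ∀ θ ∈ Set.Icc (-Real.pi) Real.pi, |(P (circ p θ)).re| ≤ S) :
    |∫ θ in (-Real.pi)..Real.pi, (P (circ p θ)).re *
      ((circ p θ * deriv G (circ p θ)).re - normalDeriv u (circ p θ))| ≤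
      S * ((∫ z in unitDisk, |lap u z|) + 2 * Real.pi * ε) := by
  have hpi := Real.pi_pos
  have hpp : -Real.pi ≤ Real.pi := by linarith
  have hu1 : ContDiff ℝ 1 u := hu.of_le (by norm_num)
  have hc := continuous_circ p
  have hPc := hP.continuous
  have hGc := hG.continuous
  have hP'c := hP.deriv.continuous
  have hG'c := hG.deriv.continuous
  have huc := hu.continuous
  have hun := continuous_normalDeriv hu1
  have hut := continuous_tangentialDeriv hu1
  have hlap := continuous_lap hu
  set v' : ℝ → ℝ := fun θ => -(circ p θ * deriv G (circ p θ)).im - tangentialDeriv u (circ p θ)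
    with hv'
  have hv'c : Continuous v' := by fun_prop
  have hvd : ∀ θ, HasDerivAt (fun θ => (G (circ p θ)).re - u (circ p θ)) (v' θ) θ := by
    intro θ
    have h1 := Complex.reCLM.hasFDerivAt.comp_hasDerivAt θ (hasDerivAt_entire_circ hG p θ)
    convert! h1.sub (hasDerivAt_comp_circ hu1 p θ) using 1
    simp [hv']
  set k := (P 0).im with hk
  set I : ℝ → ℝ := fun θ => (P (circ p θ)).im - k with hI
  have hIc : Continuous I := by fun_prop
  have hId : ∀ θ, HasDerivAt I ((circ p θ * deriv P (circ p θ)).re) θ := by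
    intro θ
    have h1 := Complex.imCLM.hasFDerivAt.comp_hasDerivAt θ (hasDerivAt_entire_circ hP p θ)
    convert! h1.sub_const k using 1
    simp
  have hz := integral_periodic_deriv_eq_zero (fun θ => (hvd θ).mul (hId θ)) (by fun_prop)
    (by simp only [hI, circ_pi, Pi.mul_apply])
  rw [intervalIntegral.integral_add (Continuous.intervalIntegrable (by fun_prop) _ _)
    (Continuous.intervalIntegrable (by fun_prop) _ _)] at hz
  have hgreen := green_holomorphic hu hP hp
  have hcomm := integral_re_mul_re_comm hP hG p
  have hmain : ∫ θ in (-Real.pi)..Real.pi, (P (circ p θ)).re *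
      ((circ p θ * deriv G (circ p θ)).re - normalDeriv u (circ p θ)) =
      -(∫ z in unitDisk, (P z).re * lap u z) - ∫ θ in (-Real.pi)..Real.pi, v' θ * I θ := by
    have e1 : ∫ θ in (-Real.pi)..Real.pi, ((G (circ p θ)).re - u (circ p θ)) *
        (circ p θ * deriv P (circ p θ)).re = -∫ θ in (-Real.pi)..Real.pi, v' θ * I θ := by linarith
    rw [sub_eq_add_neg, ← e1, hgreen]
    simp only [sub_mul, mul_sub]
    rw [intervalIntegral.integral_sub, intervalIntegral.integral_sub, intervalIntegral.integral_sub,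
      hcomm]
    · ring
    all_goals exact Continuous.intervalIntegrable (by fun_prop) _ _
  have hI2 : ∫ θ in (-Real.pi)..Real.pi, I θ ^ 2 ≤ 2 * Real.pi * S ^ 2 := by
    have h1 := integral_re_sq_eq_im_sq (P := fun z => P z - P 0) (by fun_prop) (by simp) p
    have h2 := integral_re_entire_circ hP p
    simp only [Complex.sub_im, Complex.sub_re] at h1
    rw [show (∫ θ in (-Real.pi)..Real.pi, I θ ^ 2) =
      ∫ θ in (-Real.pi)..Real.pi, ((P (circ p θ)).im - (P 0).im) ^ 2 from rfl, ← h1]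
    have h3 : ∫ θ in (-Real.pi)..Real.pi, ((P (circ p θ)).re - (P 0).re) ^ 2 =
        (∫ θ in (-Real.pi)..Real.pi, (P (circ p θ)).re ^ 2) -
          2 * (P 0).re * (∫ θ in (-Real.pi)..Real.pi, (P (circ p θ)).re) +
          ∫ θ in (-Real.pi)..Real.pi, (P 0).re ^ 2 := by
      rw [← intervalIntegral.integral_const_mul, ← intervalIntegral.integral_sub,
        ← intervalIntegral.integral_add]
      · refine intervalIntegral.integral_congr fun θ _ => ?_
        ring
      all_goals exact Continuous.intervalIntegrable (by fun_prop) _ _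
    have h4 : ∫ θ in (-Real.pi)..Real.pi, (P (circ p θ)).re ^ 2 ≤
        ∫ θ in (-Real.pi)..Real.pi, S ^ 2 :=
      intervalIntegral.integral_mono_on hpp (Continuous.intervalIntegrable (by fun_prop) _ _)
        intervalIntegrable_const fun θ hθ => sq_le_sq' (abs_le.1 (hS θ hθ)).1 (abs_le.1 (hS θ hθ)).2
    rw [h3, h2]
    rw [intervalIntegral.integral_const, smul_eq_mul] at h4 ⊢
    nlinarith [sq_nonneg (P 0).re]
  have hε0 : 0 ≤ ε := (abs_nonneg _).trans (hGε 0 ⟨by linarith, hpi.le⟩)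
  have hb1 : |∫ θ in (-Real.pi)..Real.pi, v' θ * I θ| ≤ 2 * Real.pi * ε * S := by
    have h1 : ‖∫ θ in (-Real.pi)..Real.pi, v' θ * I θ‖ ≤
        ∫ θ in (-Real.pi)..Real.pi, ε / (2 * S) * (S ^ 2 + I θ ^ 2) := by
      refine intervalIntegral.norm_integral_le_of_norm_le hpp
        (Eventually.of_forall fun θ hθ => ?_) (Continuous.intervalIntegrable (by fun_prop) _ _)
      rw [norm_mul, Real.norm_eq_abs, Real.norm_eq_abs]
      have h2 := hGε θ (Set.Ioc_subset_Icc_self hθ)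
      have h3 : |I θ| ≤ 1 / (2 * S) * (S ^ 2 + I θ ^ 2) := by
        rw [one_div, ← div_eq_inv_mul, le_div_iff₀ (by positivity)]
        nlinarith [sq_nonneg (|I θ| - S), sq_abs (I θ)]
      calc |v' θ| * |I θ| ≤ ε * (1 / (2 * S) * (S ^ 2 + I θ ^ 2)) :=
            mul_le_mul h2 h3 (abs_nonneg _) hε0
        _ = _ := by ring
    rw [Real.norm_eq_abs, intervalIntegral.integral_const_mul, intervalIntegral.integral_add
      intervalIntegrable_const (Continuous.intervalIntegrable (by fun_prop) _ _),
      intervalIntegral.integral_const, smul_eq_mul] at h1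
    refine h1.trans ?_
    have h4 : ε / (2 * S) * ((Real.pi - -Real.pi) * S ^ 2 +
        ∫ θ in (-Real.pi)..Real.pi, I θ ^ 2) ≤ ε / (2 * S) * (4 * Real.pi * S ^ 2) :=
      mul_le_mul_of_nonneg_left (by linarith) (by positivity)
    refine h4.trans (le_of_eq ?_)
    field_simp; ring
  have hb2 : |∫ z in unitDisk, (P z).re * lap u z| ≤ S * ∫ z in unitDisk, |lap u z| := by
    rw [← integral_const_mul, ← Real.norm_eq_abs]
    refine norm_integral_le_of_norm_le (integrableOn_unitDisk (by fun_prop)) ?_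
    filter_upwards [ae_restrict_mem Metric.isOpen_ball.measurableSet] with z hz
    rw [norm_mul, Real.norm_eq_abs, Real.norm_eq_abs]
    exact mul_le_mul_of_nonneg_right
      (abs_re_le_of_circ hP hp hS z (Metric.ball_subset_closedBall hz)) (abs_nonneg _)
  rw [hmain]
  refine (abs_sub _ _).trans ?_
  rw [abs_neg]
  linarith

theorem abs_integral_mul_le {u : ℂ → ℝ} (hu : ContDiff ℝ 2 u) {G : ℂ → ℂ}
    (hG : Differentiable ℂ G) {p : ℂ} (hp : ‖p‖ = 1) {ε : ℝ}
    (hGε : ∀ θ ∈ Set.Icc (-Real.pi) Real.pi,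
      |-(circ p θ * deriv G (circ p θ)).im - tangentialDeriv u (circ p θ)| ≤ ε)
    {N : ℝ → ℝ} (hN : Continuous N) (hper : N (-Real.pi) = N Real.pi) {S : ℝ} (hS0 : 0 ≤ S)
    (hS : ∀ θ ∈ Set.Icc (-Real.pi) Real.pi, |N θ| ≤ S) :
    |∫ θ in (-Real.pi)..Real.pi, N θ *
      ((circ p θ * deriv G (circ p θ)).re - normalDeriv u (circ p θ))| ≤
      S * ((∫ z in unitDisk, |lap u z|) + 2 * Real.pi * ε) := by
  have hpi := Real.pi_pos
  have hpp : -Real.pi ≤ Real.pi := by linarith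
  have hu1 : ContDiff ℝ 1 u := hu.of_le (by norm_num)
  have hc := continuous_circ p
  have hG'c := hG.deriv.continuous
  have hun := continuous_normalDeriv hu1
  set a : ℝ → ℝ := fun θ => (circ p θ * deriv G (circ p θ)).re - normalDeriv u (circ p θ) with ha
  have hac : Continuous a := by fun_prop
  set Y := (∫ z in unitDisk, |lap u z|) + 2 * Real.pi * ε with hY
  set M := ∫ θ in (-Real.pi)..Real.pi, |a θ| with hM
  have key : ∀ η : ℝ, 0 < η → |∫ θ in (-Real.pi)..Real.pi, N θ * a θ| ≤ S * Y + η * (Y + M) := by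
    intro η hη
    obtain ⟨P, hP, hPN⟩ := exists_entire_approx hN.continuousOn hper hp hη
    have hPc := hP.continuous
    have h1 := abs_integral_re_mul_le hu hG hp hGε hP (S := S + η) (by positivity) fun θ hθ => by
      have h1 := hS θ hθ
      have h2 := hPN θ hθ
      have h3 := abs_add_le (N θ) ((P (circ p θ)).re - N θ)
      rw [add_sub_cancel] at h3
      linarith
    have h2 : |∫ θ in (-Real.pi)..Real.pi, ((P (circ p θ)).re - N θ) * a θ| ≤ η * M := by
      rw [hM, ← intervalIntegral.integral_const_mul, ← Real.norm_eq_abs]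
      refine intervalIntegral.norm_integral_le_of_norm_le hpp
        (Eventually.of_forall fun θ hθ => ?_) (Continuous.intervalIntegrable (by fun_prop) _ _)
      rw [norm_mul, Real.norm_eq_abs, Real.norm_eq_abs]
      exact mul_le_mul_of_nonneg_right (hPN θ (Set.Ioc_subset_Icc_self hθ)) (abs_nonneg _)
    have h3 : ∫ θ in (-Real.pi)..Real.pi, N θ * a θ =
        (∫ θ in (-Real.pi)..Real.pi, (P (circ p θ)).re * a θ) -
          ∫ θ in (-Real.pi)..Real.pi, ((P (circ p θ)).re - N θ) * a θ := by
      rw [← intervalIntegral.integral_sub]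
      · refine intervalIntegral.integral_congr fun θ _ => ?_
        ring
      all_goals exact Continuous.intervalIntegrable (by fun_prop) _ _
    rw [h3]
    refine (abs_sub _ _).trans ?_
    have h4 := h1.trans_eq (add_mul S η Y)
    linarith
  have ht : Tendsto (fun η : ℝ => S * Y + η * (Y + M)) (nhdsWithin 0 (Set.Ioi 0))
      (nhds (S * Y)) := by
    have : Continuous fun η : ℝ => S * Y + η * (Y + M) := by fun_prop
    simpa using (this.tendsto 0).mono_left nhdsWithin_le_nhds
  exact ge_of_tendsto ht (eventually_mem_nhdsWithin.mono fun η hη => key η hη)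

theorem exists_support_function {G : ℂ → ℂ} (hG : Differentiable ℂ G) {p : ℂ} (hp : ‖p‖ = 1) :
    ∃ N : ℝ → ℝ, Continuous N ∧ N (-Real.pi) = N Real.pi ∧
      (∀ θ ∈ Set.Icc (-Real.pi) Real.pi,
        |N θ| ≤ ∫ θ in (-Real.pi)..Real.pi, Real.exp ((G (circ p θ)).re / 2)) ∧
      ∫ θ in (-Real.pi)..Real.pi, Real.exp ((G (circ p θ)).re / 2) =
        ∫ θ in (-Real.pi)..Real.pi, N θ * (1 + (circ p θ * deriv G (circ p θ)).re / 2) ∧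
      ∫ θ in (-Real.pi)..Real.pi, N θ * Real.exp ((G (circ p θ)).re / 2) =
        2 * ∫ z in unitDisk, ‖Complex.exp (G z / 2)‖ ^ 2 := by
  have hpi := Real.pi_pos
  have hc := continuous_circ p
  have hGc := hG.continuous
  have hG'c := hG.deriv.continuous
  set P : ℂ → ℂ := fun z => Complex.exp (G z / 2) with hP
  have hPd : Differentiable ℂ P := (hG.div_const 2).cexp
  have hPc := hPd.continuous
  obtain ⟨F₁, hF₁⟩ := exists_entire_primitive hPd
  set F : ℂ → ℂ := fun z => F₁ z - F₁ p with hF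
  have hF' : ∀ z, HasDerivAt F (P z) z := fun z => (hF₁ z).sub_const _
  have hFd : Differentiable ℂ F := fun z => (hF' z).differentiableAt
  have hFc := hFd.continuous
  have hF0 : F (circ p 0) = 0 := by simp [hF, circ]
  set σ : ℝ → ℝ := fun θ => Real.exp ((G (circ p θ)).re / 2) with hσ
  have hσc : Continuous σ := by fun_prop
  set e : ℝ → ℂ := fun θ => Complex.exp (((G (circ p θ)).im / 2 : ℝ) * Complex.I) with he
  have hec : Continuous e := by fun_prop
  have hPe : ∀ θ, P (circ p θ) = σ θ * e θ := by
    intro θ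
    simp only [hP, hσ, he]
    rw [Complex.ofReal_exp, ← Complex.exp_add]
    congr 1
    apply Complex.ext <;> simp
  have hen : ∀ θ, ‖e θ‖ = 1 := fun θ => Complex.norm_exp_ofReal_mul_I _
  have hPn : ∀ θ, ‖P (circ p θ)‖ = σ θ := fun θ => by
    rw [hPe, norm_mul, hen, mul_one, Complex.norm_real, Real.norm_eq_abs, abs_of_pos (Real.exp_pos _)]
  have hFcd : ∀ θ, HasDerivAt (fun t => F (circ p t)) (Complex.I * (circ p θ * P (circ p θ))) θ := by
    intro θ
    have := hasDerivAt_entire_circ hFd p θ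
    rwa [(hF' _).deriv] at this
  set N : ℝ → ℝ := fun θ => ((starRingEnd ℂ) (F (circ p θ)) * (circ p θ * e θ)).re with hN
  have hstar : Continuous (starRingEnd ℂ) := Complex.continuous_conj
  have hNc : Continuous N := by fun_prop
  refine ⟨N, hNc, by simp only [hN, he, circ_pi], fun θ hθ => ?_, ?_, ?_⟩
  · have h1 : |N θ| ≤ ‖F (circ p θ)‖ := by
      refine (Complex.abs_re_le_norm _).trans (le_of_eq ?_)
      rw [norm_mul, norm_mul, hen, norm_circ hp, Complex.norm_conj, mul_one, mul_one]
    have h2 : F (circ p θ) = ∫ t in (0 : ℝ)..θ, Complex.I * (circ p t * P (circ p t)) := by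
      rw [intervalIntegral.integral_eq_sub_of_hasDerivAt (fun x _ => hFcd x)
        (Continuous.intervalIntegrable (by fun_prop) _ _), hF0, sub_zero]
    refine h1.trans ?_
    rw [h2]
    refine (intervalIntegral.norm_integral_le_abs_integral_norm).trans ?_
    have h3 : ∀ t, ‖Complex.I * (circ p t * P (circ p t))‖ = σ t := fun t => by
      rw [norm_mul, norm_mul, norm_circ hp, hPn]; simp
    simp only [h3]
    rw [← Real.norm_eq_abs]
    refine (intervalIntegral.norm_integral_le_integral_norm_uIoc).trans ?_
    rw [intervalIntegral.integral_of_le (by linarith)]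
    have h4 : ∀ t, ‖σ t‖ = σ t := fun t => abs_of_pos (Real.exp_pos _)
    simp only [h4]
    refine setIntegral_mono_set ?_ (Eventually.of_forall fun t => (Real.exp_pos _).le) ?_
    · exact (hσc.integrableOn_Icc).mono_set Set.Ioc_subset_Icc_self
    · refine Eventually.of_forall (fun t ht => ?_)
      have ht : t ∈ Set.uIoc 0 θ := ht
      rw [Set.mem_uIoc] at ht
      obtain ⟨ha, hb⟩ := hθ
      rcases ht with ht | ht <;> constructor <;> linarith [ht.1, ht.2]
  · have hd : ∀ θ, HasDerivAt
        (fun θ => ((starRingEnd ℂ) (F (circ p θ)) * (Complex.I * (circ p θ * e θ))).re)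
        (σ θ - N θ * (1 + (circ p θ * deriv G (circ p θ)).re / 2)) θ := by
      intro θ
      have h1 := hasDerivAt_entire_circ hG p θ
      have h2 := Complex.imCLM.hasFDerivAt.comp_hasDerivAt θ h1
      have h3 : HasDerivAt e (e θ * (((circ p θ * deriv G (circ p θ)).re / 2 : ℝ) * Complex.I)) θ := by
        have h4 : HasDerivAt (fun t => (G (circ p t)).im / 2)
            ((circ p θ * deriv G (circ p θ)).re / 2) θ := by
          convert! h2.div_const 2 using 1
          simp
        exact (h4.ofReal_comp.mul_const Complex.I).cexp
      have h5 : HasDerivAt (fun t => (starRingEnd ℂ) (F (circ p t)))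
          ((starRingEnd ℂ) (Complex.I * (circ p θ * P (circ p θ)))) θ := by
        exact (Complex.conjCLE.toContinuousLinearMap.hasFDerivAt).comp_hasDerivAt θ (hFcd θ)
      have h6 := h5.mul (((hasDerivAt_circ p θ).mul h3).const_mul Complex.I)
      have h7 := Complex.reCLM.hasFDerivAt.comp_hasDerivAt θ h6
      convert! h7 using 1
      rw [hPe]
      set c := circ p θ with hcc
      have hcn : c.re ^ 2 + c.im ^ 2 = 1 := norm_eq_one_of_mem (circ_mem hp θ)
      have hee : (e θ).re ^ 2 + (e θ).im ^ 2 = 1 := norm_eq_one_of_mem (by simp [unitCircle, hen])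
      simp [hN, ← hcc, Complex.mul_re, Complex.mul_im]
      set x := c.re
      set y := c.im
      set a := (e θ).re
      set b := (e θ).im
      linear_combination (-σ θ) * (x ^ 2 + y ^ 2) * hee - σ θ * hcn
    have hz := integral_periodic_deriv_eq_zero hd (by fun_prop) (by simp only [he, circ_pi])
    rw [intervalIntegral.integral_sub (Continuous.intervalIntegrable (by fun_prop) _ _)
      (Continuous.intervalIntegrable (by fun_prop) _ _)] at hz
    linarith
  · have hPd' : ∀ z, HasDerivAt P (deriv P z) z := fun z => (hPd z).hasDerivAt
    have hdiv := integral_div_disk hp (A := fun z => (F z).re * (P z).re + (F z).im * (P z).im)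
      (B := fun z => (F z).im * (P z).re - (F z).re * (P z).im)
      (d := fun z => 2 * ‖P z‖ ^ 2)
      (fun z _ => ((HasPD.re (hF' z)).mul (HasPD.re (hPd' z))).add
        ((HasPD.im (hF' z)).mul (HasPD.im (hPd' z))))
      (fun z _ => ((HasPD.im (hF' z)).mul (HasPD.re (hPd' z))).sub
        ((HasPD.re (hF' z)).mul (HasPD.im (hPd' z))))
      (fun z _ => by
        rw [← Complex.normSq_eq_norm_sq, Complex.normSq_apply]; ring)
      (Continuous.continuousOn (by fun_prop))
    rw [integral_const_mul] at hdiv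
    rw [hdiv]
    refine intervalIntegral.integral_congr fun θ _ => ?_
    simp only [hPe, hN]
    simp [Complex.mul_re, Complex.mul_im]
    ring

theorem abs_exp_half_sub_le {a b ε : ℝ} (h : |a - b| ≤ ε) :
    |Real.exp (a / 2) - Real.exp (b / 2)| ≤ (Real.exp (ε / 2) - 1) * Real.exp (b / 2) := by
  have hε : 0 ≤ ε := (abs_nonneg _).trans h
  obtain ⟨h1, h2⟩ := abs_le.1 h
  have e1 : Real.exp (a / 2) ≤ Real.exp (ε / 2) * Real.exp (b / 2) := by
    rw [← Real.exp_add]; exact Real.exp_le_exp.2 (by linarith)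
  have e2 : Real.exp (-(ε / 2)) * Real.exp (b / 2) ≤ Real.exp (a / 2) := by
    rw [← Real.exp_add]; exact Real.exp_le_exp.2 (by linarith)
  have e3 : 2 ≤ Real.exp (ε / 2) + Real.exp (-(ε / 2)) := by
    have := Real.add_one_le_exp (ε / 2)
    have := Real.add_one_le_exp (-(ε / 2))
    linarith
  have hb := Real.exp_pos (b / 2)
  rw [abs_le]
  constructor
  · nlinarith
  · linarith

theorem length_sub_area_le {u h : ℂ → ℝ} (hu : ContDiff ℝ 2 u) (hh : Continuous h)
    (hbc : ∀ z ∈ unitCircle, normalDeriv u z + 2 = 2 * h z * Real.exp (u z / 2)) {G : ℂ → ℂ}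
    (hG : Differentiable ℂ G) {p : ℂ} (hp : ‖p‖ = 1) {ε : ℝ}
    (hGu : ∀ θ ∈ Set.Icc (-Real.pi) Real.pi, |(G (circ p θ)).re - u (circ p θ)| ≤ ε)
    (hGε : ∀ θ ∈ Set.Icc (-Real.pi) Real.pi,
      |-(circ p θ * deriv G (circ p θ)).im - tangentialDeriv u (circ p θ)| ≤ ε) (h₀ : ℝ) :
    |(∫ θ in (-Real.pi)..Real.pi, Real.exp ((G (circ p θ)).re / 2)) -
      ∫ θ in (-Real.pi)..Real.pi, Real.exp (u (circ p θ) / 2)| ≤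
      (Real.exp (ε / 2) - 1) * ∫ θ in (-Real.pi)..Real.pi, Real.exp (u (circ p θ) / 2) ∧
    |(∫ θ in (-Real.pi)..Real.pi, Real.exp ((G (circ p θ)).re / 2)) -
      2 * h₀ * ∫ z in unitDisk, ‖Complex.exp (G z / 2)‖ ^ 2| ≤
      (∫ θ in (-Real.pi)..Real.pi, Real.exp ((G (circ p θ)).re / 2)) *
        ((∫ z in unitDisk, |lap u z|) / 2 + Real.pi * ε +
          (∫ θ in (-Real.pi)..Real.pi, |h (circ p θ) - h₀| * Real.exp (u (circ p θ) / 2)) +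
          |h₀| * ((Real.exp (ε / 2) - 1) *
            ∫ θ in (-Real.pi)..Real.pi, Real.exp (u (circ p θ) / 2))) := by
  have hpi := Real.pi_pos
  have hpp : -Real.pi ≤ Real.pi := by linarith
  have hu1 : ContDiff ℝ 1 u := hu.of_le (by norm_num)
  have hc := continuous_circ p
  have hGc := hG.continuous
  have hG'c := hG.deriv.continuous
  have huc := hu.continuous
  have hun := continuous_normalDeriv hu1
  obtain ⟨N, hNc, hper, hNS, hN1, hN2⟩ := exists_support_function hG hp
  set S := ∫ θ in (-Real.pi)..Real.pi, Real.exp ((G (circ p θ)).re / 2) with hS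
  set E : ℝ → ℝ := fun θ => Real.exp (u (circ p θ) / 2) with hE
  set σ : ℝ → ℝ := fun θ => Real.exp ((G (circ p θ)).re / 2) with hσ
  have hEc : Continuous E := by fun_prop
  have hσc : Continuous σ := by fun_prop
  have hS0 : 0 ≤ S := intervalIntegral.integral_nonneg hpp fun θ _ => (Real.exp_pos _).le
  have hσE : ∀ θ ∈ Set.Icc (-Real.pi) Real.pi, |σ θ - E θ| ≤ (Real.exp (ε / 2) - 1) * E θ :=
    fun θ hθ => abs_exp_half_sub_le (hGu θ hθ)
  refine ⟨?_, ?_⟩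
  · rw [hS, ← intervalIntegral.integral_sub (hσc.intervalIntegrable _ _)
      (hEc.intervalIntegrable _ _), ← intervalIntegral.integral_const_mul, ← Real.norm_eq_abs]
    exact intervalIntegral.norm_integral_le_of_norm_le hpp
      (Eventually.of_forall fun θ hθ => hσE θ (Set.Ioc_subset_Icc_self hθ))
      (Continuous.intervalIntegrable (by fun_prop) _ _)
  have hdual := abs_integral_mul_le hu hG hp hGε hNc hper hS0 hNS
  have hrest : |∫ θ in (-Real.pi)..Real.pi, N θ *
      ((h (circ p θ) - h₀) * E θ + h₀ * (E θ - σ θ))| ≤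
      S * ((∫ θ in (-Real.pi)..Real.pi, |h (circ p θ) - h₀| * E θ) +
        |h₀| * ((Real.exp (ε / 2) - 1) * ∫ θ in (-Real.pi)..Real.pi, E θ)) := by
    rw [← intervalIntegral.integral_const_mul, ← intervalIntegral.integral_const_mul,
      ← intervalIntegral.integral_add (Continuous.intervalIntegrable (by fun_prop) _ _)
      (Continuous.intervalIntegrable (by fun_prop) _ _), ← intervalIntegral.integral_const_mul,
      ← Real.norm_eq_abs]
    refine intervalIntegral.norm_integral_le_of_norm_le hpp (Eventually.of_forall fun θ hθ => ?_)
      (Continuous.intervalIntegrable (by fun_prop) _ _)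
    have hθ' := Set.Ioc_subset_Icc_self hθ
    rw [Real.norm_eq_abs, abs_mul]
    refine mul_le_mul (hNS θ hθ') ?_ (abs_nonneg _) hS0
    refine (abs_add_le _ _).trans ?_
    rw [abs_mul, abs_mul, abs_of_pos (Real.exp_pos (u (circ p θ) / 2)), abs_sub_comm (E θ)]
    have := mul_le_mul_of_nonneg_left (hσE θ hθ') (abs_nonneg h₀)
    linarith
  have hsplit : S - 2 * h₀ * ∫ z in unitDisk, ‖Complex.exp (G z / 2)‖ ^ 2 =
      1 / 2 * (∫ θ in (-Real.pi)..Real.pi, N θ *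
        ((circ p θ * deriv G (circ p θ)).re - normalDeriv u (circ p θ))) +
      ∫ θ in (-Real.pi)..Real.pi, N θ *
        ((h (circ p θ) - h₀) * E θ + h₀ * (E θ - σ θ)) := by
    rw [mul_assoc, mul_left_comm 2 h₀, ← hN2, hN1, ← intervalIntegral.integral_const_mul,
      ← intervalIntegral.integral_const_mul, ← intervalIntegral.integral_add,
      ← intervalIntegral.integral_sub]
    · refine intervalIntegral.integral_congr fun θ _ => ?_
      have hb := hbc _ (circ_mem hp θ)
      simp only [hE, hσ]
      linear_combination (N θ / 2) * hb
    all_goals exact Continuous.intervalIntegrable (by fun_prop) _ _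
  rw [hsplit]
  refine (abs_add_le _ _).trans ?_
  rw [abs_mul, abs_of_pos (by norm_num : (0 : ℝ) < 1 / 2)]
  linarith

theorem contDiff_re_entire {G : ℂ → ℂ} (hG : Differentiable ℂ G) {n : WithTop ℕ∞} :
    ContDiff ℝ n fun z => (G z).re :=
  Complex.reCLM.contDiff.comp (hG.contDiff.restrict_scalars ℝ)

theorem dirDeriv_re_entire {G : ℂ → ℂ} (hG : Differentiable ℂ G) (v z : ℂ) :
    dirDeriv v (fun z => (G z).re) z = (v * deriv G z).re := by
  have h := Complex.reCLM.hasFDerivAt.comp z (hG z).hasDerivAt.complexToReal_fderiv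
  have h2 : HasFDerivAt (fun z => (G z).re) _ z := h
  rw [dirDeriv, h2.fderiv]
  simp [mul_comm]

theorem lap_re_entire {G : ℂ → ℂ} (hG : Differentiable ℂ G) (z : ℂ) :
    lap (fun z => (G z).re) z = 0 := by
  have h1 : ∀ v : ℂ, dirDeriv v (fun z => (G z).re) = fun z => (v * deriv G z).re :=
    fun v => funext (dirDeriv_re_entire hG v)
  have hd := hG.deriv
  simp only [lap, h1]
  rw [dirDeriv_re_entire (G := fun z => 1 * deriv G z) (by fun_prop),
    dirDeriv_re_entire (G := fun z => Complex.I * deriv G z) (by fun_prop),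
    deriv_const_mul _ (hd z), deriv_const_mul _ (hd z), ← Complex.add_re]
  rw [show 1 * (1 * deriv (deriv G) z) + Complex.I * (Complex.I * deriv (deriv G) z) = 0 by
    linear_combination deriv (deriv G) z * Complex.I_mul_I]
  simp

theorem lap_sub {u w : ℂ → ℝ} (hu : ContDiff ℝ 2 u) (hw : ContDiff ℝ 2 w) (z : ℂ) :
    lap (fun z => u z - w z) z = lap u z - lap w z := by
  have h1 : ∀ {f g : ℂ → ℝ}, ContDiff ℝ 1 f → ContDiff ℝ 1 g → ∀ v : ℂ,
      dirDeriv v (fun z => f z - g z) = fun z => dirDeriv v f z - dirDeriv v g z := by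
    intro f g hf hg v
    funext x
    simp only [dirDeriv]
    rw [fderiv_fun_sub (hf.differentiable (by norm_num) x) (hg.differentiable (by norm_num) x)]
    rfl
  have hu1 : ContDiff ℝ 1 u := hu.of_le (by norm_num)
  have hw1 : ContDiff ℝ 1 w := hw.of_le (by norm_num)
  simp only [lap, h1 hu1 hw1]
  rw [h1 (dirDeriv_contDiff hu (by norm_num) _) (dirDeriv_contDiff hw (by norm_num) _),
    h1 (dirDeriv_contDiff hu (by norm_num) _) (dirDeriv_contDiff hw (by norm_num) _)]
  ring

theorem area_sub_le {u : ℂ → ℝ} (hu : ContDiff ℝ 2 u) {G : ℂ → ℂ}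
    (hG : Differentiable ℂ G) {p : ℂ} (hp : ‖p‖ = 1) {ε : ℝ}
    (hGu : ∀ θ ∈ Set.Icc (-Real.pi) Real.pi, |(G (circ p θ)).re - u (circ p θ)| ≤ ε)
    {δ : ℝ} (hδ : ∫ z in unitDisk, |lap u z| ≤ δ) (hδ2 : δ ≤ 2 * Real.pi) :
    |(∫ z in unitDisk, Real.exp (u z)) - ∫ z in unitDisk, ‖Complex.exp (G z / 2)‖ ^ 2| ≤
      (Real.exp ε * (1 + δ / (2 * Real.pi)) - 1) *
        ∫ z in unitDisk, ‖Complex.exp (G z / 2)‖ ^ 2 := by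
  have hPd : Differentiable ℂ fun z => Complex.exp (G z / 2) := (hG.div_const 2).cexp
  have hPc := hPd.continuous
  have huc := hu.continuous
  have hGc := hG.continuous
  have hlc : Continuous fun z => |lap u z| := (continuous_lap hu).abs
  have hw : ContDiff ℝ 2 fun z => (G z).re := contDiff_re_entire hG
  have hcirc : ∀ z ∈ unitCircle, |(G z).re - u z| ≤ ε := by
    intro z hz
    obtain ⟨θ, hθ, rfl⟩ := circ_surj hp (by simpa [unitCircle] using hz : ‖z‖ = 1)
    exact hGu θ (Set.Ioc_subset_Icc_self hθ)
  have hn : ∀ z, ‖Complex.exp (G z / 2)‖ ^ 2 = Real.exp ((G z).re) := by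
    intro z
    rw [Complex.norm_exp, ← Real.exp_nat_mul]
    congr 1
    simp; ring
  have huw : ContDiff ℝ 2 fun z => u z - (G z).re := hu.sub hw
  have hwu : ContDiff ℝ 2 fun z => (G z).re - u z := hw.sub hu
  have hX1 := integral_norm_sq_mul_exp_le hPd huw hlc (fun z => abs_nonneg _)
    (fun z _ => by
      have := lap_sub hu hw z
      rw [lap_re_entire hG, sub_zero] at this
      rw [this]
      exact neg_le_abs _) hδ hδ2
    (fun z hz => by
      have := (abs_le.1 (hcirc z hz)).1
      linarith)
  have hX2 := integral_norm_sq_mul_exp_le hPd hwu hlc (fun z => abs_nonneg _)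
    (fun z _ => by
      have := lap_sub hw hu z
      rw [lap_re_entire hG, zero_sub] at this
      rw [this, neg_neg]
      exact le_abs_self _) hδ hδ2
    (fun z hz => by
      have := (abs_le.1 (hcirc z hz)).2
      linarith)
  have e1 : ∫ z in unitDisk, ‖Complex.exp (G z / 2)‖ ^ 2 * Real.exp (u z - (G z).re) =
      ∫ z in unitDisk, Real.exp (u z) := by
    congr 1; ext z
    rw [hn, ← Real.exp_add]; congr 1; ring
  rw [e1] at hX1
  have hlow : 2 * (∫ z in unitDisk, ‖Complex.exp (G z / 2)‖ ^ 2) -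
      (∫ z in unitDisk, ‖Complex.exp (G z / 2)‖ ^ 2 * Real.exp ((G z).re - u z)) ≤
      ∫ z in unitDisk, Real.exp (u z) := by
    rw [← integral_const_mul, ← integral_sub (integrableOn_unitDisk (by fun_prop))
      (integrableOn_unitDisk (by fun_prop))]
    refine setIntegral_mono (integrableOn_unitDisk (by fun_prop))
      (integrableOn_unitDisk (by fun_prop)) fun z => ?_
    have h2 : 2 ≤ Real.exp (u z - (G z).re) + Real.exp ((G z).re - u z) := by
      have := Real.add_one_le_exp (u z - (G z).re)
      have := Real.add_one_le_exp ((G z).re - u z)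
      linarith
    have h3 : Real.exp (u z) = Real.exp ((G z).re) * Real.exp (u z - (G z).re) := by
      rw [← Real.exp_add]; congr 1; ring
    simp only [hn]
    rw [h3]
    nlinarith [Real.exp_pos ((G z).re)]
  rw [abs_le]
  constructor <;> linarith

namespace ConcentratingFamily
variable {u Kn hn : ℕ → ℂ → ℝ} {K h : ℂ → ℝ} {p : ℂ} {A L : ℝ}

theorem tendsto_integral_abs_lap (H : ConcentratingFamily u Kn hn K h p A L) (hK : K p = 0) :
    Tendsto (fun n => ∫ z in unitDisk, |lap (u n) z|) atTop (nhds 0) := by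
  have hunif : TendstoUniformlyOn (fun n z => |Kn n z|) (fun z => |K z|) atTop unitClosedDisk := by
    have h1 := H.unif_K
    rw [Metric.tendstoUniformlyOn_iff] at h1 ⊢
    intro ε hε
    filter_upwards [h1 ε hε] with n hn z hz
    refine lt_of_le_of_lt ?_ (hn z hz)
    rw [Real.dist_eq, Real.dist_eq]
    exact abs_abs_sub_abs_le _ _
  have h1 := (H.tendsto_disk (fun n => (H.contDiff_Kn n).continuous.abs)
    H.contDiff_K.continuous.abs hunif).const_mul 2
  simp only [hK, abs_zero, zero_mul, sub_zero, mul_zero] at h1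
  refine h1.congr fun n => ?_
  rw [← integral_const_mul]
  refine setIntegral_congr_fun Metric.isOpen_ball.measurableSet fun z hz => ?_
  have h2 := (H.solves n).1 z hz
  rw [show lap (u n) z = -(2 * Kn n z * Real.exp (u n z)) by linarith, abs_neg, abs_mul, abs_mul,
    abs_of_pos (Real.exp_pos _), abs_of_pos (by norm_num : (0 : ℝ) < 2), mul_assoc]

theorem tendsto_integral_abs_sub_mul (H : ConcentratingFamily u Kn hn K h p A L) :
    Tendsto (fun n => ∫ θ in (-Real.pi)..Real.pi,
      |hn n (circ p θ) - h p| * Real.exp (u n (circ p θ) / 2)) atTop (nhds 0) := by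
  have hunif : TendstoUniformlyOn (fun n z => |hn n z - h p|) (fun z => |h z - h p|) atTop
      unitCircle := by
    have h1 := H.unif_h
    rw [Metric.tendstoUniformlyOn_iff] at h1 ⊢
    intro ε hε
    filter_upwards [h1 ε hε] with n hn z hz
    refine lt_of_le_of_lt ?_ (hn z hz)
    rw [Real.dist_eq, Real.dist_eq]
    refine (abs_abs_sub_abs_le _ _).trans (le_of_eq ?_)
    congr 1; ring
  have h1 := H.tendsto_circle
    (fun n => ((H.contDiff_hn n).continuous.sub continuous_const).abs)
    (H.contDiff_h.continuous.sub continuous_const).abs hunif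
  simpa using h1

theorem tendsto_area_of_eq_zero (H : ConcentratingFamily u Kn hn K h p A L) (hK : K p = 0) :
    Tendsto (fun n => ∫ z in unitDisk, Real.exp (u n z)) atTop
      (nhds (2 * Real.pi / √(h p ^ 2 + K p) / (h p + √(h p ^ 2 + K p)))) := by
  have hpi := Real.pi_pos
  obtain ⟨h0, hsq⟩ := H.h_pos_of_eq_zero hK
  have hβ := H.tendsto_length
  rw [hsq] at hβ ⊢
  have hδ := H.tendsto_integral_abs_lap hK
  have hη := H.tendsto_integral_abs_sub_mul
  set ε : ℕ → ℝ := fun n => 1 / ((n : ℝ) + 1) with hε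
  have hεt : Tendsto ε atTop (nhds 0) := tendsto_one_div_add_atTop_nhds_zero_nat
  have hG : ∀ n, ∃ G : ℂ → ℂ, Differentiable ℂ G ∧ (G 0).im = 0 ∧
      ∀ θ ∈ Set.Icc (-Real.pi) Real.pi, |(G (circ p θ)).re - u n (circ p θ)| ≤ ε n ∧
        |-(circ p θ * deriv G (circ p θ)).im - tangentialDeriv (u n) (circ p θ)| ≤ ε n := by
    intro n
    have hu1 : ContDiff ℝ 1 (u n) := (H.contDiff_u n).of_le (by norm_num)
    exact exists_entire_C1_approx (fun θ _ => hasDerivAt_comp_circ hu1 p θ)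
      ((continuous_tangentialDeriv hu1).comp (continuous_circ p)).continuousOn
      (by rw [circ_pi]) (by rw [circ_pi]) H.norm_p (by positivity)
  choose G hGd _ hGb using hG
  have hlen := fun n => length_sub_area_le (H.contDiff_u n) (H.contDiff_hn n).continuous
    (H.solves n).2 (hGd n) H.norm_p (fun θ hθ => (hGb n θ hθ).1) (fun θ hθ => (hGb n θ hθ).2) (h p)
  set S : ℕ → ℝ := fun n => ∫ θ in (-Real.pi)..Real.pi, Real.exp ((G n (circ p θ)).re / 2)
  set β : ℕ → ℝ := fun n => ∫ θ in (-Real.pi)..Real.pi, Real.exp (u n (circ p θ) / 2)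
  set A₀ : ℕ → ℝ := fun n => ∫ z in unitDisk, ‖Complex.exp (G n z / 2)‖ ^ 2
  set α : ℕ → ℝ := fun n => ∫ z in unitDisk, Real.exp (u n z)
  have hc : Tendsto (fun n => Real.exp (ε n / 2) - 1) atTop (nhds 0) := by
    have : Continuous fun x : ℝ => Real.exp (x / 2) - 1 := by fun_prop
    have h1 : Tendsto (fun n => Real.exp (ε n / 2) - 1) atTop (nhds (Real.exp (0 / 2) - 1)) :=
      (this.tendsto 0).comp hεt
    simpa using h1
  have hcβ : Tendsto (fun n => (Real.exp (ε n / 2) - 1) * β n) atTop (nhds 0) := by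
    simpa using hc.mul hβ
  have hSβ : Tendsto (fun n => S n - β n) atTop (nhds 0) :=
    squeeze_zero_norm (fun n => (hlen n).1) hcβ
  have hS : Tendsto S atTop (nhds (2 * Real.pi / h p)) := by
    simpa using hSβ.add hβ
  have hSA : Tendsto (fun n => S n - 2 * h p * A₀ n) atTop (nhds 0) := by
    refine squeeze_zero_norm (fun n => (hlen n).2) ?_
    have := hS.mul ((((hδ.div_const 2).add (hεt.const_mul Real.pi)).add hη).add
      (hcβ.const_mul |h p|))
    simpa using this
  have hA : Tendsto A₀ atTop (nhds (2 * Real.pi / h p / (h p + h p))) := by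
    have h1 := (hS.sub hSA).div_const (2 * h p)
    rw [sub_zero, two_mul (h p)] at h1
    refine h1.congr fun n => ?_
    have : h p + h p ≠ 0 := by positivity
    field_simp
    ring
  have hαA : Tendsto (fun n => α n - A₀ n) atTop (nhds 0) := by
    have ht : Tendsto (fun n => (Real.exp (ε n) * (1 + (∫ z in unitDisk, |lap (u n) z|) /
        (2 * Real.pi)) - 1) * A₀ n) atTop (nhds 0) := by
      have h1 := (((Real.continuous_exp.tendsto 0).comp hεt).mul
        ((hδ.div_const (2 * Real.pi)).const_add 1)).sub_const 1
      simpa using h1.mul hA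
    refine squeeze_zero_norm' ?_ ht
    filter_upwards [hδ.eventually (gt_mem_nhds (by positivity : (0 : ℝ) < 2 * Real.pi))] with n hn
    exact area_sub_le (H.contDiff_u n) (hGd n) H.norm_p (fun θ hθ => (hGb n θ hθ).1) le_rfl hn.le
  simpa using hαA.add hA

/-- The location condition for a concentrating family. -/
theorem tangential_condition (H : ConcentratingFamily u Kn hn K h p A L) :
    2 * tangentialDeriv h p + tangentialDeriv K p / (h p + √(h p ^ 2 + K p)) = 0 := by
  by_cases hK : K p = 0
  · exact H.tangential_of_tendsto_area (H.tendsto_area_of_eq_zero hK)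
  · exact H.tangential_of_tendsto_area (H.tendsto_area_of_ne hK)

end ConcentratingFamily

theorem TendstoC2On.tendstoUniformlyOn {F : ℕ → ℂ → ℝ} {G : ℂ → ℝ} {s : Set ℂ}
    (h : TendstoC2On F G s) : TendstoUniformlyOn F G atTop s := by
  have h0 := h 0 (by norm_num)
  rw [Metric.tendstoUniformlyOn_iff] at h0 ⊢
  intro ε hε
  filter_upwards [h0 ε hε] with n hn z hz
  refine lt_of_le_of_lt ?_ (hn z hz)
  rw [dist_eq_norm, dist_eq_norm]
  have := (iteratedFDeriv ℝ 0 G z - iteratedFDeriv ℝ 0 (F n) z).le_opNorm 0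
  simpa using this

theorem TendstoC2On.fderiv_apply {F : ℕ → ℂ → ℝ} {G : ℂ → ℝ} {s : Set ℂ}
    (h : TendstoC2On F G s) {v : ℂ → ℂ} (hv : ∀ z ∈ s, ‖v z‖ ≤ 1) :
    TendstoUniformlyOn (fun n z => fderiv ℝ (F n) z (v z)) (fun z => fderiv ℝ G z (v z))
      atTop s := by
  have h1 := h 1 (by norm_num)
  rw [Metric.tendstoUniformlyOn_iff] at h1 ⊢
  intro ε hε
  filter_upwards [h1 ε hε] with n hn z hz
  refine lt_of_le_of_lt ?_ (hn z hz)
  rw [dist_eq_norm, dist_eq_norm]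
  have h2 := (iteratedFDeriv ℝ 1 G z - iteratedFDeriv ℝ 1 (F n) z).le_opNorm ![v z]
  simp only [sub_apply, iteratedFDeriv_one_apply, Fin.isValue,
    Matrix.cons_val_fin_one, Finset.univ_unique, Fin.default_eq_zero, Finset.prod_singleton] at h2
  exact h2.trans (mul_le_of_le_one_right (norm_nonneg _) (hv z hz))

theorem exists_eventually_abs_le {F : ℕ → ℂ → ℝ} {G : ℂ → ℝ} {s : Set ℂ} (hs : IsCompact s)
    (hG : Continuous G) (h : TendstoUniformlyOn F G atTop s) :
    ∃ B : ℝ, ∀ᶠ n in atTop, ∀ z ∈ s, |F n z| ≤ B := by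
  obtain ⟨B, hB⟩ := hs.exists_bound_of_continuousOn hG.continuousOn
  refine ⟨B + 1, ?_⟩
  filter_upwards [Metric.tendstoUniformlyOn_iff.1 h 1 one_pos] with n hn z hz
  have h1 := hn z hz
  have h2 := hB z hz
  rw [Real.dist_eq, abs_lt] at h1
  rw [Real.norm_eq_abs, abs_le] at h2
  rw [abs_le]
  constructor <;> linarith [h1.1, h1.2, h2.1, h2.2]

theorem exists_concentratingFamily {u Kn hn : ℕ → ℂ → ℝ} {K h : ℂ → ℝ}
    (hureg : ∀ n, ContDiff ℝ 2 (u n))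
    (hKnreg : ∀ n, ContDiff ℝ 2 (Kn n)) (hKreg : ContDiff ℝ 2 K)
    (hhnreg : ∀ n, ContDiff ℝ 2 (hn n)) (hhreg : ContDiff ℝ 2 h)
    (hKconv : TendstoC2On Kn K unitClosedDisk) (hhconv : TendstoC2On hn h unitCircle)
    (hsol : ∀ n, SolvesLiouville (Kn n) (hn n) (u n)) {C₀ : ℝ} (hmass : MassBound u C₀)
    {p : ℂ} (hp : p ∈ unitCircle)
    (hploc : TendstoLocallyUniformlyBotOn u (unitClosedDisk \ {p})) :
    ∃ A L : ℝ, ConcentratingFamily u Kn hn K h p A L := by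
  have hpn : ‖p‖ = 1 := by simpa [unitCircle] using hp
  have hpi := Real.pi_pos
  have h21 : (1 : WithTop ℕ∞) ≤ 2 := by norm_num
  have hK1 := hKreg.of_le h21
  have hh1 := hhreg.of_le h21
  have uK := hKconv.tendstoUniformlyOn
  have uh := hhconv.tendstoUniformlyOn
  have uKx := hKconv.fderiv_apply (v := fun _ => 1) (by simp)
  have uKy := hKconv.fderiv_apply (v := fun _ => Complex.I) (by simp)
  have uht := hhconv.fderiv_apply (v := fun z => Complex.I * z) (fun z hz => by
    have : ‖z‖ = 1 := by simpa [unitCircle] using hz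
    simp [this])
  have cD : IsCompact unitClosedDisk := isCompact_closedBall 0 1
  have cC : IsCompact unitCircle := isCompact_sphere 0 1
  obtain ⟨B₁, hB₁⟩ := exists_eventually_abs_le cD hK1.continuous uK
  obtain ⟨B₂, hB₂⟩ := exists_eventually_abs_le cD (continuous_dirDeriv hK1 1) uKx
  obtain ⟨B₃, hB₃⟩ := exists_eventually_abs_le cD (continuous_dirDeriv hK1 Complex.I) uKy
  obtain ⟨B₄, hB₄⟩ := exists_eventually_abs_le cC hh1.continuous uh
  obtain ⟨B₅, hB₅⟩ := exists_eventually_abs_le cC (continuous_tangentialDeriv hh1) uht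
  have harea0 : ∀ n, 0 ≤ ∫ z in unitDisk, Real.exp (u n z) := fun n =>
    integral_nonneg fun z => (Real.exp_pos _).le
  have hlen0 : ∀ n, 0 ≤ ∫ z in unitCircle, Real.exp (u n z / 2) ∂arcMeasure := fun n =>
    integral_nonneg fun z => (Real.exp_pos _).le
  refine ⟨max C₀ (Real.pi * C₀), max B₁ (max B₂ (max B₃ (max B₄ B₅))), ?_⟩
  refine
    { contDiff_u := hureg
      contDiff_Kn := fun n => (hKnreg n).of_le h21
      contDiff_hn := fun n => (hhnreg n).of_le h21
      contDiff_K := hK1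
      contDiff_h := hh1
      solves := hsol
      norm_p := hpn
      area_le := fun n => le_max_of_le_left (by linarith [hmass n, hlen0 n])
      length_le := fun n => le_max_of_le_right ?_
      bot := hploc
      unif_K := uK
      unif_h := uh
      unif_Kx := uKx
      unif_Ky := uKy
      unif_ht := uht
      bounds := ?_ }
  · have huc := (hureg n).continuous
    refine (integral_circ_le_arc hpn (f := fun z => Real.exp (u n z / 2)) (by fun_prop)
      fun z => (Real.exp_pos _).le).trans ?_
    exact mul_le_mul_of_nonneg_left (by linarith [hmass n, harea0 n]) hpi.le
  · filter_upwards [hB₁, hB₂, hB₃, hB₄, hB₅] with n h1 h2 h3 h4 h5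
    refine ⟨fun z hz => ⟨?_, ?_, ?_⟩, fun z hz => ⟨?_, ?_⟩⟩
    · exact (h1 z hz).trans (by simp)
    · exact (h2 z hz).trans (by simp)
    · exact (h3 z hz).trans (by simp)
    · exact (h4 z hz).trans (by simp)
    · exact (h5 z hz).trans (by simp)

/-- first blow-up condition: at the blow-up point `p`,
`2 h_τ(p) + K_τ(p)/Φ(p) = 0`, where `Φ = H + √(H² + K)` and `H` is the harmonic
extension of `h` (so `Φ(p) = h(p) + √(h(p)² + K(p))`). -/
theorem blowup_tangential_condition
    (u Kn hn : ℕ → ℂ → ℝ) (K h : ℂ → ℝ)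
    (hureg : ∀ n, ContDiff ℝ 2 (u n))
    (hKnreg : ∀ n, ContDiff ℝ 2 (Kn n)) (hKreg : ContDiff ℝ 2 K)
    (hhnreg : ∀ n, ContDiff ℝ 2 (hn n)) (hhreg : ContDiff ℝ 2 h)
    (hKconv : TendstoC2On Kn K unitClosedDisk)
    (hhconv : TendstoC2On hn h unitCircle)
    (hsol : ∀ n, SolvesLiouville (Kn n) (hn n) (u n))
    (hblow : BlowsUp u)
    (C₀ : ℝ) (hmass : MassBound u C₀)
    (p : ℂ) (hp : p ∈ unitCircle)
    (hploc : TendstoLocallyUniformlyBotOn u (unitClosedDisk \ {p}))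
    (H : ℂ → ℝ) (hHreg : ContDiff ℝ 1 H)
    (hHharm : ∀ z ∈ unitDisk, lap H z = 0)
    (hHbd : ∀ z ∈ unitCircle, H z = h z) :
    2 * tangentialDeriv h p +
      tangentialDeriv K p / (H p + Real.sqrt ((H p) ^ 2 + K p)) = 0 := by
  obtain ⟨A, L, hF⟩ := exists_concentratingFamily hureg hKnreg hKreg hhnreg hhreg hKconv hhconv
    hsol hmass hp hploc
  rw [hHbd p hp]
  exact hF.tangential_condition
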